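/- arXiv:1111.1379 — 2 statements merged into one kernel-verified Lean document; each statement's English description precedes it below -/
import Mathlib

section
/- Let D ⊂ ℂ be a domain, F a family of holomorphic functions on D all of whose zeros are multiple, and let s ≥ 2 be an even integer. Let h be a holomorphic function on D, not identically zero, having no common zeros with any f ∈ F. Assume for every f ∈ F: (a) f(z) = 0 implies f''(z) = h(z), and (b) f''(z) = h(z) implies f'''(z) = 0 and f^{(s)}(z) = 0. Then F is normal on D. -/
/-- A family `F` of holomorphic functions on `D` is normal if every sequence in `F`
has a subsequence which either converges locally uniformly on `D` (to a finite limit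
function), or diverges to `∞` locally uniformly on `D`.  This is normality with respect
to the spherical metric. -/
def SphericallyNormalOn (F : Set (ℂ → ℂ)) (D : Set ℂ) : Prop :=
  ∀ f : ℕ → ℂ → ℂ, (∀ n, f n ∈ F) → ∃ φ : ℕ → ℕ, StrictMono φ ∧
    ((∃ g : ℂ → ℂ, TendstoLocallyUniformlyOn (fun n => f (φ n)) g Filter.atTop D) ∨
      (∀ K : Set ℂ, K ⊆ D → IsCompact K → ∀ M : ℝ,
        ∀ᶠ n in Filter.atTop, ∀ z ∈ K, M ≤ ‖f (φ n) z‖))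

section

open Filter Topology Metric Set

namespace NF

/-- Uniform convergence on `U` along `l` to a finite limit or to infinity. -/
def ConvF (f : ℕ → ℂ → ℂ) (l : Filter ℕ) (U : Set ℂ) : Prop :=
  (∃ g : ℂ → ℂ, TendstoUniformlyOn f g l U) ∨ ∀ M : ℝ, ∀ᶠ n in l, ∀ z ∈ U, M ≤ ‖f n z‖

/-- Normality of a sequence at a point. -/
def NormAt (f : ℕ → ℂ → ℂ) (z : ℂ) : Prop :=
  ∃ ε > 0, ∀ φ : ℕ → ℕ, StrictMono φ → ∃ ψ : ℕ → ℕ, StrictMono ψ ∧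
    ConvF f (map (φ ∘ ψ) atTop) (ball z ε)

lemma ConvF.anti {f : ℕ → ℂ → ℂ} {l l' : Filter ℕ} {U : Set ℂ} (h : ConvF f l' U) (hl : l ≤ l') :
    ConvF f l U := by
  rcases h with ⟨g, hg⟩ | h
  · exact Or.inl ⟨g, fun u hu => hl (hg u hu)⟩
  · exact Or.inr fun M => hl (h M)

lemma diag (P : ℕ → Filter ℕ → Prop) (anti : ∀ i l l', l ≤ l' → P i l' → P i l)
    (h : ∀ i (φ : ℕ → ℕ), StrictMono φ → ∃ ψ : ℕ → ℕ, StrictMono ψ ∧ P i (map (φ ∘ ψ) atTop)) :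
    ∃ φ : ℕ → ℕ, StrictMono φ ∧ ∀ i, P i (map φ atTop) := by
  choose! ψ hψ hP using h
  -- `Φ i` is the `i`-th nested subsequence
  let Φ : ℕ → ℕ → ℕ := fun i => Nat.rec (id ∘ ψ 0 id) (fun i φ => φ ∘ ψ (i + 1) φ) i
  have h0 : Φ 0 = id ∘ ψ 0 id := rfl
  have hs : ∀ i, Φ (i + 1) = Φ i ∘ ψ (i + 1) (Φ i) := fun i => rfl
  have hmono : ∀ i, StrictMono (Φ i) := by
    intro i
    induction i with
    | zero => rw [h0]; exact strictMono_id.comp (hψ _ _ strictMono_id)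
    | succ i ih => rw [hs]; exact ih.comp (hψ _ _ ih)
  have hPΦ : ∀ i, P i (map (Φ i) atTop) := by
    intro i
    cases i with
    | zero => rw [h0]; exact hP _ _ strictMono_id
    | succ i => rw [hs]; exact hP _ _ (hmono i)
  have hnest : ∀ i k n, ∃ m, n ≤ m ∧ Φ (i + k) n = Φ i m := by
    intro i k
    induction k with
    | zero => exact fun n => ⟨n, le_rfl, rfl⟩
    | succ k ih =>
      intro n
      obtain ⟨m, hm, he⟩ := ih (ψ (i + k + 1) (Φ (i + k)) n)
      refine ⟨m, ((hψ _ _ (hmono _)).id_le n).trans hm, ?_⟩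
      rw [← he, ← add_assoc, hs]; rfl
  refine ⟨fun n => Φ n n, ?_, ?_⟩
  · apply strictMono_nat_of_lt_succ
    intro n
    have : Φ (n + 1) (n + 1) = Φ n (ψ (n + 1) (Φ n) (n + 1)) := rfl
    rw [this]
    exact hmono n (lt_of_lt_of_le (Nat.lt_succ_self n) ((hψ _ _ (hmono n)).id_le (n + 1)))
  · intro i
    refine anti i _ _ ?_ (hPΦ i)
    intro s hs
    rw [mem_map] at hs ⊢
    obtain ⟨N, hN⟩ := mem_atTop_sets.1 hs
    refine mem_atTop_sets.2 ⟨max N i, fun n hn => ?_⟩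
    obtain ⟨k, rfl⟩ := Nat.exists_eq_add_of_le (le_of_max_le_right hn)
    obtain ⟨m, hm, he⟩ := hnest i k (i + k)
    change Φ (i + k) (i + k) ∈ s
    rw [he]
    exact hN m ((le_of_max_le_left hn).trans hm)

lemma glue {f : ℕ → ℂ → ℂ} {D : Set ℂ} (hD : IsOpen D) (hc : IsConnected D)
    (h : ∀ z ∈ D, NormAt f z) :
    ∃ φ : ℕ → ℕ, StrictMono φ ∧
    ((∃ g : ℂ → ℂ, TendstoLocallyUniformlyOn f g (map φ atTop) D) ∨
      (∀ K : Set ℂ, K ⊆ D → IsCompact K → ∀ M : ℝ,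
        ∀ᶠ n in map φ atTop, ∀ z ∈ K, M ≤ ‖f n z‖)) := by
  choose! ε hε hsub using h
  obtain ⟨t, htD, htc, htcov⟩ := TopologicalSpace.countable_cover_nhdsWithin
    (f := fun z => ball z (ε z)) (s := D)
    (fun x hx => mem_nhdsWithin_of_mem_nhds (ball_mem_nhds x (hε x hx)))
  have htne : t.Nonempty := by
    obtain ⟨x, hx⟩ := hc.nonempty
    obtain ⟨y, hy, -⟩ := mem_iUnion₂.1 (htcov hx)
    exact ⟨y, hy⟩
  obtain ⟨e, rfl⟩ := htc.exists_eq_range htne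
  obtain ⟨φ, hφ, hP⟩ := diag (fun i l => ConvF f l (ball (e i) (ε (e i))))
    (fun i l l' hl h => h.anti hl)
    (fun i φ hφ => hsub (e i) (htD (mem_range_self i)) φ hφ)
  refine ⟨φ, hφ, ?_⟩
  set l := map φ atTop with hl
  have hloc : ∀ z ∈ D, ∃ U : Set ℂ, IsOpen U ∧ z ∈ U ∧ ConvF f l U := by
    intro z hz
    obtain ⟨y, ⟨i, rfl⟩, hy⟩ := mem_iUnion₂.1 (htcov hz)
    exact ⟨_, isOpen_ball, hy, hP i⟩
  let A : Set ℂ := {z | ∃ U : Set ℂ, IsOpen U ∧ z ∈ U ∧ ∃ g : ℂ → ℂ, TendstoUniformlyOn f g l U}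
  let B : Set ℂ := {z | ∃ U : Set ℂ, IsOpen U ∧ z ∈ U ∧
    ∀ M : ℝ, ∀ᶠ n in l, ∀ z ∈ U, M ≤ ‖f n z‖}
  have hA : IsOpen A := by
    rw [isOpen_iff_mem_nhds]
    rintro z ⟨U, hU, hzU, hg⟩
    exact mem_of_superset (hU.mem_nhds hzU) fun w hw => ⟨U, hU, hw, hg⟩
  have hB : IsOpen B := by
    rw [isOpen_iff_mem_nhds]
    rintro z ⟨U, hU, hzU, hg⟩
    exact mem_of_superset (hU.mem_nhds hzU) fun w hw => ⟨U, hU, hw, hg⟩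
  have hAB : Disjoint A B := by
    rw [Set.disjoint_left]
    rintro z ⟨U, hU, hzU, g, hg⟩ ⟨V, hV, hzV, hM⟩
    have h1 := (hg.tendsto_at hzU).norm
    have h2 : ∀ᶠ n in l, ‖f n z‖ < ‖g z‖ + 1 := h1.eventually_lt_const (by linarith)
    obtain ⟨n, hn1, hn2⟩ := (h2.and (hM (‖g z‖ + 1))).exists
    exact absurd (hn2 z hzV) (by linarith)
  have hcov : D ⊆ A ∪ B := by
    intro z hz
    obtain ⟨U, hU, hzU, hg | hM⟩ := hloc z hz
    · exact Or.inl ⟨U, hU, hzU, hg⟩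
    · exact Or.inr ⟨U, hU, hzU, hM⟩
  rcases hc.isPreconnected.subset_or_subset hA hB hAB hcov with hDA | hDB
  · left
    refine ⟨fun z => limUnder l (fun n => f n z), ?_⟩
    intro u hu z hz
    obtain ⟨U, hU, hzU, g, hg⟩ := hDA hz
    refine ⟨U, mem_nhdsWithin_of_mem_nhds (hU.mem_nhds hzU), ?_⟩
    filter_upwards [hg u hu] with n hn w hw
    have : limUnder l (fun n => f n w) = g w := (hg.tendsto_at hw).limUnder_eq
    rw [this]; exact hn w hw
  · right
    intro K hKD hK M
    refine hK.induction_on (p := fun K => ∀ᶠ n in l, ∀ z ∈ K, M ≤ ‖f n z‖) (by simp)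
      (fun s t hst ht => ht.mono fun n hn z hz => hn z (hst hz))
      (fun s t hs ht => by
        filter_upwards [hs, ht] with n h1 h2 z hz
        exact hz.elim (h1 z) (h2 z)) ?_
    intro z hz
    obtain ⟨U, hU, hzU, hM⟩ := hDB (hKD hz)
    exact ⟨U, mem_nhdsWithin_of_mem_nhds (hU.mem_nhds hzU), hM M⟩

/-- Minimum principle on a closed disc. -/
lemma min_principle {f : ℂ → ℂ} {c : ℂ} {r m : ℝ} (hr : 0 < r)
    (hf : DifferentiableOn ℂ f (ball c r)) (hcont : ContinuousOn f (closedBall c r))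
    (h0 : ∀ z ∈ closedBall c r, f z ≠ 0) (hm : ∀ z ∈ sphere c r, m ≤ ‖f z‖) :
    ∀ z ∈ closedBall c r, m ≤ ‖f z‖ := by
  intro z hz
  rcases le_or_gt m 0 with hm0 | hm0
  · exact hm0.trans (norm_nonneg _)
  have hd : DiffContOnCl ℂ (fun z => (f z)⁻¹) (ball c r) := by
    refine ⟨hf.inv fun z hz => h0 z (ball_subset_closedBall hz), ?_⟩
    rw [closure_ball c hr.ne']
    exact hcont.inv₀ h0
  have := Complex.norm_le_of_forall_mem_frontier_norm_le (C := m⁻¹) isBounded_ball hd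
    (by
      rw [frontier_ball c hr.ne']
      intro z hz
      rw [norm_inv]
      exact inv_anti₀ hm0 (hm z hz)) (z := z) (by rwa [closure_ball c hr.ne'])
  rw [norm_inv] at this
  exact (inv_le_inv₀ (norm_pos_iff.2 (h0 z hz)) hm0).1 this

/-- Maximum principle on a closed disc. -/
lemma max_principle {f : ℂ → ℂ} {c : ℂ} {r m : ℝ} (hr : 0 < r)
    (hf : DifferentiableOn ℂ f (ball c r)) (hcont : ContinuousOn f (closedBall c r))
    (hm : ∀ z ∈ sphere c r, ‖f z‖ ≤ m) :
    ∀ z ∈ closedBall c r, ‖f z‖ ≤ m := by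
  intro z hz
  have hd : DiffContOnCl ℂ f (ball c r) := by
    refine ⟨hf, ?_⟩
    rwa [closure_ball c hr.ne']
  exact Complex.norm_le_of_forall_mem_frontier_norm_le isBounded_ball hd
    (by rw [frontier_ball c hr.ne']; exact hm) (by rwa [closure_ball c hr.ne'])

/-- Hurwitz's theorem. -/
lemma hurwitz {F : ℕ → ℂ → ℂ} {G : ℂ → ℂ} {l : Filter ℕ} [l.NeBot] {U : Set ℂ} {a : ℂ}
    (hU : IsOpen U) (haU : a ∈ U)
    (hF : ∀ᶠ n in l, DifferentiableOn ℂ (F n) U) (hlim : TendstoLocallyUniformlyOn F G l U)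
    (h0 : G a = 0) (hne : ¬ ∀ᶠ z in 𝓝 a, G z = 0) (η : ℝ) (hη : 0 < η) :
    ∀ᶠ n in l, ∃ z ∈ ball a η, F n z = 0 := by
  have hG : DifferentiableOn ℂ G U := hlim.differentiableOn hF hU
  have hGa : AnalyticAt ℂ G a := hG.analyticAt (hU.mem_nhds haU)
  have h1 : ∀ᶠ z in 𝓝[≠] a, G z ≠ 0 := hGa.eventually_eq_zero_or_eventually_ne_zero.resolve_left hne
  rw [eventually_nhdsWithin_iff] at h1
  obtain ⟨r, hr, hrb⟩ := Metric.eventually_nhds_iff_ball.1 (h1.and (hU.mem_nhds haU))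
  obtain ⟨r', hr', hr'2⟩ : ∃ r', 0 < r' ∧ r' < min r η := exists_between (lt_min hr hη)
  have hr'r : r' < r := hr'2.trans_le (min_le_left _ _)
  have hr'η : r' < η := hr'2.trans_le (min_le_right _ _)
  have hcb : closedBall a r' ⊆ U := fun z hz => (hrb z (closedBall_subset_ball hr'r hz)).2
  have hsne : (sphere a r').Nonempty := NormedSpace.sphere_nonempty.2 hr'.le
  obtain ⟨z₀, hz₀, hmin⟩ := (isCompact_sphere a r').exists_isMinOn hsne
    ((hG.continuousOn.mono (sphere_subset_closedBall.trans hcb)).norm)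
  set c := ‖G z₀‖ with hc
  have hcpos : 0 < c := by
    rw [hc, norm_pos_iff]
    have hz₀' : z₀ ∈ ball a r := closedBall_subset_ball hr'r (sphere_subset_closedBall hz₀)
    refine (hrb z₀ hz₀').1 ?_
    intro h
    rw [h, mem_sphere, dist_self] at hz₀
    exact hr'.ne hz₀
  have hunif := (tendstoLocallyUniformlyOn_iff_forall_isCompact hU).1 hlim _ hcb
    (isCompact_closedBall a r')
  rw [Metric.tendstoUniformlyOn_iff] at hunif
  filter_upwards [hF, hunif (c / 4) (by linarith)] with n hFn hn
  by_contra hcon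
  push Not at hcon
  have hm := min_principle (f := F n) (m := 3 * c / 4) hr'
    (hFn.mono (ball_subset_closedBall.trans hcb)) (hFn.continuousOn.mono hcb)
    (fun z hz => hcon z (closedBall_subset_ball hr'η hz))
    (by
      intro z hz
      have h2 : c ≤ ‖G z‖ := hmin hz
      have h3 := hn z (sphere_subset_closedBall hz)
      rw [dist_eq_norm] at h3
      have h4 := norm_sub_norm_le (G z) (F n z)
      linarith) a (mem_closedBall_self hr'.le)
  have h3 := hn a (mem_closedBall_self hr'.le)
  rw [h0, dist_zero_left] at h3
  linarith

lemma hurwitz_transfer {F A : ℕ → ℂ → ℂ} {G B : ℂ → ℂ} {l : Filter ℕ} [l.NeBot] {U : Set ℂ} {a : ℂ}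
    (hU : IsOpen U) (haU : a ∈ U)
    (hF : ∀ᶠ n in l, DifferentiableOn ℂ (F n) U) (hlim : TendstoLocallyUniformlyOn F G l U)
    (hA : TendstoLocallyUniformlyOn A B l U) (hB : ContinuousOn B U)
    (himp : ∀ᶠ n in l, ∀ z ∈ U, F n z = 0 → A n z = 0)
    (h0 : G a = 0) (hne : ¬ ∀ᶠ z in 𝓝 a, G z = 0) : B a = 0 := by
  by_contra hBa
  have hpos : 0 < ‖B a‖ := norm_pos_iff.2 hBa
  obtain ⟨t, ht, htA⟩ := (Metric.tendstoLocallyUniformlyOn_iff.1 hA) (‖B a‖ / 2) (by linarith) a haU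
  rw [hU.nhdsWithin_eq haU] at ht
  have hBc : ∀ᶠ z in 𝓝 a, dist (B z) (B a) < ‖B a‖ / 2 :=
    (hB.continuousAt (hU.mem_nhds haU)).eventually (ball_mem_nhds _ (by linarith))
  obtain ⟨η, hη, hηb⟩ := Metric.eventually_nhds_iff_ball.1
    ((hBc.and ht).and (hU.mem_nhds haU))
  obtain ⟨n, hn1, hn2, z, hz, hz0⟩ :=
    (himp.and (htA.and (hurwitz hU haU hF hlim h0 hne η hη))).exists
  obtain ⟨⟨h1, h2⟩, h3⟩ := hηb z hz
  have h4 := hn2 z h2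
  rw [hn1 z h3 hz0, dist_zero_right] at h4
  rw [dist_comm, dist_eq_norm] at h1
  have := norm_sub_norm_le (B a) (B z)
  linarith

/-- Montel's theorem, local form. -/
lemma montel {f : ℕ → ℂ → ℂ} {c : ℂ} {r M : ℝ} (hr : 0 < r)
    (hf : ∀ n, DifferentiableOn ℂ (f n) (ball c (2 * r)))
    (hM : ∀ n, ∀ z ∈ ball c (2 * r), ‖f n z‖ ≤ M) :
    ∃ ψ : ℕ → ℕ, StrictMono ψ ∧ ∃ g : ℂ → ℂ,
      TendstoUniformlyOn (fun n => f (ψ n)) g atTop (closedBall c r) := by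
  have hM0 : 0 ≤ M := (norm_nonneg _).trans (hM 0 c (mem_ball_self (by linarith)))
  have hsub : closedBall c r ⊆ ball c (2 * r) := closedBall_subset_ball (by linarith)
  haveI : CompactSpace (closedBall c r) := isCompact_iff_compactSpace.1 (isCompact_closedBall c r)
  let b : ℕ → BoundedContinuousFunction (closedBall c r) ℂ := fun n =>
    BoundedContinuousFunction.mkOfCompact
      ⟨fun z => f n z, ((hf n).continuousOn.mono hsub).domRestrict⟩
  have hlip : ∀ n, ∀ z ∈ closedBall c r, ∀ w ∈ closedBall c r, dist w z < r →
      dist (f n w) (f n z) ≤ 2 * M / r * dist w z := by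
    intro n z hz w hw hwz
    have hsub2 : ball z r ⊆ ball c (2 * r) := by
      apply ball_subset_ball'
      rw [mem_closedBall] at hz; linarith
    refine Complex.dist_le_div_mul_dist_of_mapsTo_ball ((hf n).mono hsub2) ?_ hwz
    intro y hy
    rw [mem_closedBall, dist_eq_norm]
    have h1 := hM n y (hsub2 hy)
    have h2 := hM n z (hsub hz)
    have := norm_sub_le (f n y) (f n z)
    linarith
  have hcomp : IsCompact (closure (range b)) := by
    refine BoundedContinuousFunction.arzela_ascoli (closedBall (0 : ℂ) M)
      (isCompact_closedBall _ _) _ ?_ ?_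
    · rintro _ x ⟨n, rfl⟩
      rw [mem_closedBall, dist_zero_right]
      exact hM n x (hsub x.2)
    · intro x
      rw [Metric.equicontinuousAt_iff]
      intro ε hε
      refine ⟨min r (ε / (2 * M / r + 1)), by positivity, ?_⟩
      rintro y hy ⟨_, n, rfl⟩
      have hy1 : dist y x < r := hy.trans_le (min_le_left _ _)
      have hy2 : dist y x < ε / (2 * M / r + 1) := hy.trans_le (min_le_right _ _)
      have hpos : 0 < 2 * M / r + 1 := by positivity
      rw [lt_div_iff₀ hpos] at hy2
      have := hlip n x x.2 y y.2 hy1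
      change dist (f n x) (f n y) < ε
      rw [dist_comm]
      have hd : dist (y : ℂ) x = dist y x := rfl
      rw [hd] at this
      have h0 : 0 ≤ dist y x := dist_nonneg
      rcases h0.eq_or_lt with h | h
      · rw [← h] at this; linarith
      · nlinarith
  obtain ⟨g, -, ψ, hψ, hlim⟩ := hcomp.tendsto_subseq (x := b)
    (fun n => subset_closure (mem_range_self n))
  classical
  refine ⟨ψ, hψ, fun z => if hz : z ∈ closedBall c r then g ⟨z, hz⟩ else 0, ?_⟩
  rw [BoundedContinuousFunction.tendsto_iff_tendstoUniformly, Metric.tendstoUniformly_iff] at hlim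
  rw [Metric.tendstoUniformlyOn_iff]
  intro ε hε
  filter_upwards [hlim ε hε] with n hn z hz
  have := hn ⟨z, hz⟩
  simp only [hz, dif_pos]
  exact this

end NF

namespace NF

lemma iterDeriv_scale (f : ℂ → ℂ) (c ρ z0 : ℂ) (k : ℕ) :
    iteratedDeriv k (fun ζ => c * f (z0 + ρ * ζ)) =
      fun ζ => c * ρ ^ k * iteratedDeriv k f (z0 + ρ * ζ) := by
  induction k with
  | zero => funext ζ; simp
  | succ k ih =>
    rw [iteratedDeriv_succ, ih]
    funext ζ
    rw [deriv_const_mul_field]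
    have h1 : deriv (fun ζ => iteratedDeriv k f (z0 + ρ * ζ)) ζ
        = ρ * deriv (fun x => iteratedDeriv k f (z0 + x)) (ρ * ζ) := by
      have := deriv_comp_mul_left (𝕜 := ℂ) ρ (fun x => iteratedDeriv k f (z0 + x)) ζ
      simpa using this
    rw [h1, deriv_comp_const_add, iteratedDeriv_succ]
    ring

/-- The local hypothesis on `f` with respect to `h` on `U`. -/
def Good (s : ℕ) (f h : ℂ → ℂ) (U : Set ℂ) : Prop :=
  DifferentiableOn ℂ f U ∧
  (∀ z ∈ U, f z = 0 → deriv f z = 0 ∧ iteratedDeriv 2 f z = h z ∧ iteratedDeriv 3 f z = 0) ∧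
  (∀ z ∈ U, iteratedDeriv 2 f z = h z → iteratedDeriv s f z = 0)

lemma Good.mono {s : ℕ} {f h : ℂ → ℂ} {U V : Set ℂ} (hg : Good s f h U) (hVU : V ⊆ U) :
    Good s f h V :=
  ⟨hg.1.mono hVU, fun z hz => hg.2.1 z (hVU hz), fun z hz => hg.2.2 z (hVU hz)⟩

lemma Good.scale {s : ℕ} {f h : ℂ → ℂ} {U : Set ℂ} (hg : Good s f h U) {c ρ : ℂ} (z0 : ℂ)
    (hc : c ≠ 0) (hρ : ρ ≠ 0) :
    Good s (fun ζ => c * f (z0 + ρ * ζ)) (fun ζ => c * ρ ^ 2 * h (z0 + ρ * ζ))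
      ((fun ζ => z0 + ρ * ζ) ⁻¹' U) := by
  refine ⟨?_, ?_, ?_⟩
  · refine DifferentiableOn.const_mul ?_ c
    refine hg.1.comp (f := fun ζ => z0 + ρ * ζ) (by fun_prop) (fun z hz => hz)
  · intro ζ hζ h0
    have h0' : f (z0 + ρ * ζ) = 0 := by simpa [hc] using h0
    obtain ⟨h1, h2, h3⟩ := hg.2.1 _ hζ h0'
    refine ⟨?_, ?_, ?_⟩
    · have := congrFun (iterDeriv_scale f c ρ z0 1) ζ
      rw [iteratedDeriv_one, iteratedDeriv_one, h1] at this
      simpa using this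
    · rw [iterDeriv_scale]; simp only [h2]
    · rw [iterDeriv_scale]; simp only [h3, mul_zero]
  · intro ζ hζ h2
    rw [iterDeriv_scale] at h2 ⊢
    have : iteratedDeriv 2 f (z0 + ρ * ζ) = h (z0 + ρ * ζ) := by
      have : c * ρ ^ 2 ≠ 0 := by positivity
      exact mul_left_cancel₀ this h2
    simp only [hg.2.2 _ hζ this, mul_zero]

end NF

namespace NF

lemma log_exists {f : ℂ → ℂ} {z0 : ℂ} {d : ℝ} (hd : 0 < d) {lam : ℝ} (hl : 0 < lam)
    (hf : DifferentiableOn ℂ f (ball z0 d)) (h0 : ∀ z ∈ ball z0 d, f z ≠ 0) :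
    ∃ w : ℂ → ℂ, (∀ z ∈ ball z0 d, HasDerivAt w (deriv f z / f z) z) ∧
      ∀ z ∈ ball z0 d, ‖f z‖ = lam * Real.exp (w z).re := by
  have hz0 : z0 ∈ ball z0 d := mem_ball_self hd
  have hq : DifferentiableOn ℂ (fun z => deriv f z / f z) (ball z0 d) :=
    (hf.deriv isOpen_ball).div hf h0
  obtain ⟨w, hw0, hw⟩ := hq.isExactOn_ball.with_val_at z0 (Complex.log (f z0 / lam))
  refine ⟨w, hw, ?_⟩
  have hlc : (lam : ℂ) ≠ 0 := by exact_mod_cast hl.ne'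
  have hder : ∀ z ∈ ball z0 d, HasDerivAt (fun z => f z * Complex.exp (-w z)) 0 z := by
    intro z hz
    have h1 := (hf.differentiableAt (isOpen_ball.mem_nhds hz)).hasDerivAt
    have h2 := h1.mul ((hw z hz).neg.cexp)
    refine h2.congr_deriv ?_
    have := h0 z hz
    simp only [Pi.neg_apply]
    field_simp
    ring
  have hconst : ∀ z ∈ ball z0 d, f z * Complex.exp (-w z) = lam := by
    intro z hz
    have := isOpen_ball.is_const_of_deriv_eq_zero (convex_ball z0 d).isPreconnected
      (f := fun z => f z * Complex.exp (-w z))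
      (fun z hz => (hder z hz).differentiableAt.differentiableWithinAt)
      (fun z hz => (hder z hz).deriv) hz hz0
    rw [this, hw0, Complex.exp_neg, Complex.exp_log (div_ne_zero (h0 z0 hz0) hlc)]
    have := h0 z0 hz0
    field_simp
  intro z hz
  have h1 := hconst z hz
  have h2 : f z = lam * Complex.exp (w z) := by
    rw [← h1, mul_assoc, ← Complex.exp_add]; simp
  rw [h2, norm_mul, Complex.norm_exp, Complex.norm_real, Real.norm_of_nonneg hl.le]

lemma cayley_lt {w w0 : ℂ} (h : 0 < w.re) (h0 : 0 < w0.re) :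
    ‖(w - w0) / (w + (starRingEnd ℂ) w0)‖ ≤ 1 := by
  rw [norm_div]
  refine div_le_one_of_le₀ ?_ (norm_nonneg _)
  rw [← sq_le_sq₀ (norm_nonneg _) (norm_nonneg _), ← Complex.normSq_eq_norm_sq,
    ← Complex.normSq_eq_norm_sq, Complex.normSq_apply, Complex.normSq_apply]
  simp
  nlinarith [mul_pos h h0]

lemma cayley_bound {w w0 : ℂ} (h : 0 < w.re) (h0 : 0 < w0.re) {t : ℝ} (ht0 : 0 ≤ t) (ht : t ≤ 1)
    (hm : ‖(w - w0) / (w + (starRingEnd ℂ) w0)‖ ≤ t) : w0.re * (1 - t) ≤ w.re * (1 + t) := by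
  have hne : 0 < ‖w + (starRingEnd ℂ) w0‖ := by
    rw [norm_pos_iff]
    intro h'
    have := congrArg Complex.re h'
    simp at this
    linarith
  rw [norm_div, div_le_iff₀ hne, ← sq_le_sq₀ (norm_nonneg _) (by positivity), mul_pow,
    ← Complex.normSq_eq_norm_sq,
    ← Complex.normSq_eq_norm_sq, Complex.normSq_apply, Complex.normSq_apply] at hm
  simp at hm
  have ht2 : t ^ 2 ≤ 1 := by nlinarith
  have h3 : (w0.re - w.re) ^ 2 ≤ (t * (w.re + w0.re)) ^ 2 := by
    have : 0 ≤ (1 - t ^ 2) * ((w.im - w0.im) * (w.im - w0.im)) :=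
      mul_nonneg (by linarith) (mul_self_nonneg _)
    nlinarith
  have h4 : w0.re - w.re ≤ t * (w.re + w0.re) :=
    le_trans (le_abs_self _) (abs_le_of_sq_le_sq h3 (by positivity))
  nlinarith

lemma harnack {f : ℂ → ℂ} {z0 : ℂ} {d : ℝ} (hd : 0 < d) {lam : ℝ} (hl : 0 < lam)
    (hf : DifferentiableOn ℂ f (ball z0 d)) (hgt : ∀ z ∈ ball z0 d, lam < ‖f z‖) :
    ‖deriv f z0‖ ≤ ‖f z0‖ * (2 * Real.log (‖f z0‖ / lam) / d) ∧
    ∀ z ∈ ball z0 d,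
      Real.log (‖f z0‖ / lam) * (1 - ‖z - z0‖ / d) ≤
        Real.log (‖f z‖ / lam) * (1 + ‖z - z0‖ / d) := by
  have hz0 : z0 ∈ ball z0 d := mem_ball_self hd
  have h0 : ∀ z ∈ ball z0 d, f z ≠ 0 := fun z hz =>
    norm_pos_iff.1 (hl.trans (hgt z hz))
  obtain ⟨w, hw, hwf⟩ := log_exists hd hl hf h0
  have hre : ∀ z ∈ ball z0 d, Real.log (‖f z‖ / lam) = (w z).re := by
    intro z hz
    rw [hwf z hz, mul_div_cancel_left₀ _ hl.ne', Real.log_exp]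
  have hpos : ∀ z ∈ ball z0 d, 0 < (w z).re := by
    intro z hz
    rw [← hre z hz]
    exact Real.log_pos ((one_lt_div hl).2 (hgt z hz))
  have hne : ∀ z ∈ ball z0 d, w z + (starRingEnd ℂ) (w z0) ≠ 0 := by
    intro z hz h'
    have := congrArg Complex.re h'
    simp at this
    linarith [hpos z hz, hpos z0 hz0]
  let m : ℂ → ℂ := fun z => (w z - w z0) / (w z + (starRingEnd ℂ) (w z0))
  have hm0 : m z0 = 0 := by simp [m]
  have hmd : ∀ z ∈ ball z0 d, DifferentiableAt ℂ m z := fun z hz =>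
    ((hw z hz).differentiableAt.sub_const _).div ((hw z hz).differentiableAt.add_const _) (hne z hz)
  have hmD : DifferentiableOn ℂ m (ball z0 d) := fun z hz => (hmd z hz).differentiableWithinAt
  have hmaps : MapsTo m (ball z0 d) (closedBall (m z0) 1) := by
    intro z hz
    rw [hm0, mem_closedBall_zero_iff]
    exact cayley_lt (hpos z hz) (hpos z0 hz0)
  constructor
  · have h1 := Complex.norm_deriv_le_div_of_mapsTo_ball hmD hmaps hd
    have h2 : HasDerivAt m ((deriv f z0 / f z0) / (2 * (w z0).re)) z0 := by
      have := ((hw z0 hz0).sub_const (w z0)).div ((hw z0 hz0).add_const ((starRingEnd ℂ) (w z0)))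
        (hne z0 hz0)
      refine this.congr_deriv ?_
      have h3 : w z0 + (starRingEnd ℂ) (w z0) = 2 * (w z0).re := by
        rw [Complex.add_conj]; push_cast; rfl
      rw [h3]
      have : ((w z0).re : ℂ) ≠ 0 := by exact_mod_cast (hpos z0 hz0).ne'
      have := h0 z0 hz0
      field_simp
      ring
    rw [h2.deriv, norm_div, norm_div, norm_mul, Complex.norm_real, Complex.norm_two,
      Real.norm_of_nonneg (hpos z0 hz0).le] at h1
    rw [hre z0 hz0]
    have hx := hpos z0 hz0
    have hfp : 0 < ‖f z0‖ := norm_pos_iff.2 (h0 z0 hz0)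
    rw [div_le_iff₀ (by positivity), div_le_iff₀ hfp] at h1
    calc _ ≤ _ := h1
      _ = _ := by ring
  · intro z hz
    rw [hre z0 hz0, hre z hz]
    have hzd : ‖z - z0‖ < d := by simpa [dist_eq_norm] using hz
    refine cayley_bound (hpos z hz) (hpos z0 hz0) (by positivity) ((div_le_one hd).2 hzd.le) ?_
    have := Complex.dist_le_div_mul_dist_of_mapsTo_ball hmD hmaps hz
    rw [hm0, dist_zero_right, dist_eq_norm] at this
    calc _ ≤ _ := this
      _ = _ := by ring

lemma hopf {f : ℂ → ℂ} {z0 z1 : ℂ} {d : ℝ} (hd : 0 < d) {lam : ℝ} (hl : 0 < lam)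
    (hf : DifferentiableOn ℂ f (ball z0 d)) (hgt : ∀ z ∈ ball z0 d, lam < ‖f z‖)
    (hz1 : ‖z1 - z0‖ = d) (hfz1 : ‖f z1‖ = lam) (hd1 : DifferentiableAt ℂ f z1) :
    Real.log (‖f z0‖ / lam) ≤ 2 * d * ‖deriv f z1‖ / lam := by
  have H := (harnack hd hl hf hgt).2
  set x0 := Real.log (‖f z0‖ / lam) with hx0
  have hx0p : 0 < x0 := Real.log_pos ((one_lt_div hl).2 (hgt z0 (mem_ball_self hd)))
  -- derivative along the radius
  let γ : ℝ → ℂ := fun τ => z1 + (τ : ℂ) * (z0 - z1)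
  have hγ : HasDerivAt γ (z0 - z1) 0 := by
    have : HasDerivAt (fun τ : ℝ => (τ : ℂ)) 1 0 := Complex.ofRealCLM.hasDerivAt
    exact ((this.mul_const (z0 - z1)).const_add z1).congr_deriv (one_mul _)
  have hγ0 : γ 0 = z1 := by simp [γ]
  have hcomp : HasDerivAt (fun τ => f (γ τ)) (deriv f z1 * (z0 - z1)) 0 := by
    have h1 : HasDerivAt f (deriv f z1) (γ 0) := by rw [hγ0]; exact hd1.hasDerivAt
    exact h1.comp (0:ℝ) hγ
  have hlim := (hasDerivAt_iff_tendsto_slope_zero.1 hcomp).norm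
  have hlim' := hlim.mono_left (nhdsGT_le_nhdsNE 0)
  have hev : ∀ᶠ τ : ℝ in 𝓝[>] 0, lam * x0 / 2 ≤ ‖τ⁻¹ • (f (γ (0 + τ)) - f (γ 0))‖ := by
    have : Ioo (0:ℝ) 1 ∈ 𝓝[>] (0:ℝ) := Ioo_mem_nhdsGT (by norm_num)
    filter_upwards [this] with τ hτ
    have hdist : ‖γ τ - z0‖ = (1 - τ) * d := by
      have : γ τ - z0 = ((1 - τ : ℝ) : ℂ) * (z1 - z0) := by simp [γ]; ring
      rw [this, norm_mul, Complex.norm_real, Real.norm_of_nonneg (by linarith [hτ.2]), hz1]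
    have hmem : γ τ ∈ ball z0 d := by
      rw [mem_ball, dist_eq_norm, hdist]; nlinarith [hτ.1]
    have h1 := H _ hmem
    rw [hdist, mul_div_cancel_right₀ _ hd.ne'] at h1
    have hgp : 0 < ‖f (γ τ)‖ / lam := div_pos (hl.trans (hgt _ hmem)) hl
    have hlogp : 0 < Real.log (‖f (γ τ)‖ / lam) :=
      Real.log_pos ((one_lt_div hl).2 (hgt _ hmem))
    have h2 : x0 * τ ≤ Real.log (‖f (γ τ)‖ / lam) * 2 := by nlinarith [hτ.1]
    have h3 := Real.log_le_sub_one_of_pos hgp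
    have h4 : lam * (x0 * τ / 2) ≤ ‖f (γ τ)‖ - lam := by
      have h5 : x0 * τ / 2 ≤ ‖f (γ τ)‖ / lam - 1 := by linarith
      have h6 := mul_le_mul_of_nonneg_left h5 hl.le
      rw [mul_sub, mul_div_cancel₀ _ hl.ne'] at h6
      linarith
    rw [zero_add, hγ0, norm_smul, norm_inv, Real.norm_of_nonneg hτ.1.le, inv_mul_eq_div,
      le_div_iff₀ hτ.1]
    have h5 := norm_sub_norm_le (f (γ τ)) (f z1)
    rw [hfz1] at h5
    linarith
  have h := ge_of_tendsto hlim' hev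
  rw [norm_mul, norm_sub_rev z0 z1, hz1] at h
  rw [le_div_iff₀ hl]
  linarith

/-- Combined version. -/
lemma hopf_log_deriv {f : ℂ → ℂ} {z0 z1 : ℂ} {d : ℝ} (hd : 0 < d) {lam : ℝ} (hl : 0 < lam)
    (hf : DifferentiableOn ℂ f (ball z0 d)) (hgt : ∀ z ∈ ball z0 d, lam < ‖f z‖)
    (hz1 : ‖z1 - z0‖ = d) (hfz1 : ‖f z1‖ = lam) (hd1 : DifferentiableAt ℂ f z1) :
    ‖deriv f z0‖ ≤ ‖f z0‖ * (4 * ‖deriv f z1‖ / lam) := by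
  refine (harnack hd hl hf hgt).1.trans ?_
  refine mul_le_mul_of_nonneg_left ?_ (norm_nonneg _)
  rw [div_le_iff₀ hd]
  have := hopf hd hl hf hgt hz1 hfz1 hd1
  calc _ ≤ 2 * (2 * d * ‖deriv f z1‖ / lam) := by linarith
    _ = _ := by ring

end NF

namespace NF

lemma nearest {u : ℂ → ℝ} {z p : ℂ} {lam : ℝ}
    (hu : ContinuousOn u (closedBall z ‖p - z‖)) (hz : lam < u z) (hp : u p ≤ lam) :
    ∃ z1, 0 < ‖z1 - z‖ ∧ ‖z1 - z‖ ≤ ‖p - z‖ ∧ (∀ y ∈ ball z ‖z1 - z‖, lam < u y) ∧ u z1 = lam := by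
  have hcl : IsClosed (closedBall z ‖p - z‖ ∩ u ⁻¹' Iic lam) :=
    hu.preimage_isClosed_of_isClosed isClosed_closedBall isClosed_Iic
  have hcomp : IsCompact (closedBall z ‖p - z‖ ∩ u ⁻¹' Iic lam) :=
    (isCompact_closedBall z ‖p - z‖).of_isClosed_subset hcl inter_subset_left
  have hpm : p ∈ closedBall z ‖p - z‖ := by simp [dist_eq_norm]
  obtain ⟨z1, ⟨hz1b, hz1l⟩, hmin⟩ := hcomp.exists_isMinOn ⟨p, hpm, hp⟩
    (f := fun y => ‖y - z‖) (by fun_prop)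
  have hle : ‖z1 - z‖ ≤ ‖p - z‖ := by simpa [dist_eq_norm] using hz1b
  have hpos : 0 < ‖z1 - z‖ := by
    rw [norm_pos_iff, sub_ne_zero]
    rintro rfl
    exact absurd hz1l (not_le.2 hz)
  have hgt : ∀ y ∈ ball z ‖z1 - z‖, lam < u y := by
    intro y hy
    by_contra hc
    have hy' : ‖y - z‖ < ‖z1 - z‖ := by simpa [dist_eq_norm] using hy
    have := hmin (a := y) ⟨by rw [mem_closedBall, dist_eq_norm]; linarith, not_lt.1 hc⟩
    simp only [mem_setOf_eq] at this
    linarith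
  refine ⟨z1, hpos, hle, hgt, le_antisymm hz1l ?_⟩
  have hcl1 : z1 ∈ closure (ball z ‖z1 - z‖) := by
    rw [closure_ball z hpos.ne', mem_closedBall, dist_eq_norm]
  have hsub : closure (ball z ‖z1 - z‖) ⊆ closedBall z ‖p - z‖ := by
    rw [closure_ball z hpos.ne']; exact closedBall_subset_closedBall hle
  have hc := (hu z1 hz1b).mono (subset_closure.trans hsub)
  haveI : (𝓝[ball z ‖z1 - z‖] z1).NeBot := mem_closure_iff_nhdsWithin_neBot.1 hcl1
  refine ge_of_tendsto hc ?_
  filter_upwards [self_mem_nhdsWithin] with y hy using (hgt y hy).le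

lemma boundB {g : ℂ → ℂ} {c z p : ℂ} {R K lam : ℝ} (hl : 0 < lam) (hK : 0 ≤ K)
    (hg : DifferentiableOn ℂ g (ball c R))
    (hgK : ∀ z ∈ ball c R, ‖g z‖ ≤ lam → ‖deriv g z‖ ^ 2 ≤ K * ‖g z‖)
    (hp : ‖g p‖ ≤ lam) (hzp : ‖p - z‖ + ‖z - c‖ < R) :
    ‖g z‖ ≤ lam * Real.exp (2 * Real.sqrt (K / lam) * ‖p - z‖) := by
  rcases le_or_gt ‖g z‖ lam with h | h
  · refine h.trans ?_
    have : 1 ≤ Real.exp (2 * Real.sqrt (K / lam) * ‖p - z‖) :=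
      Real.one_le_exp (by positivity)
    nlinarith
  have hsub : closedBall z ‖p - z‖ ⊆ ball c R := by
    intro y hy
    rw [mem_closedBall] at hy
    rw [mem_ball]
    have := dist_triangle y z c
    rw [dist_eq_norm z c] at this
    linarith
  obtain ⟨z1, hpos, hle, hgt, heq⟩ := nearest (u := fun z => ‖g z‖)
    (hg.continuousOn.mono hsub).norm h hp
  have hz1 : z1 ∈ ball c R := hsub (by rw [mem_closedBall, dist_eq_norm]; exact hle)
  have hbs : ball z ‖z1 - z‖ ⊆ ball c R :=
    (ball_subset_closedBall.trans (closedBall_subset_closedBall hle)).trans hsub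
  have h1 := hopf hpos hl (hg.mono hbs) hgt rfl heq (hg.differentiableAt (isOpen_ball.mem_nhds hz1))
  have h2 := hgK z1 hz1 heq.le
  rw [heq] at h2
  have h3 : ‖deriv g z1‖ / lam ≤ Real.sqrt (K / lam) := by
    apply Real.le_sqrt_of_sq_le
    rw [div_pow, div_le_div_iff₀ (by positivity) hl]
    nlinarith
  have h4 : Real.log (‖g z‖ / lam) ≤ 2 * Real.sqrt (K / lam) * ‖p - z‖ := by
    calc _ ≤ _ := h1
      _ = 2 * ‖z1 - z‖ * (‖deriv g z1‖ / lam) := by ring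
      _ ≤ 2 * ‖p - z‖ * Real.sqrt (K / lam) := by gcongr
      _ = _ := by ring
  have hgp : 0 < ‖g z‖ / lam := div_pos (hl.trans h) hl
  rw [Real.log_le_iff_le_exp hgp, div_le_iff₀ hl] at h4
  linarith

end NF

namespace NF

lemma deriv_mul_sub {v : ℂ → ℂ} {a z : ℂ} (hv : DifferentiableAt ℂ v z) :
    deriv (fun z => (z - a) * v z) z = v z + (z - a) * deriv v z := by
  have h1 : HasDerivAt (fun z : ℂ => z - a) 1 z := (hasDerivAt_id z).sub_const a
  have := (h1.mul hv.hasDerivAt).deriv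
  rw [one_mul] at this
  exact this

/-- Structure at a double zero. -/
lemma dbl {g : ℂ → ℂ} {U : Set ℂ} {a : ℂ} (hU : IsOpen U) (haU : a ∈ U)
    (hg : DifferentiableOn ℂ g U) (h0 : g a = 0) (h1 : deriv g a = 0) :
    ∃ u : ℂ → ℂ, DifferentiableOn ℂ u U ∧ (∀ z, g z = (z - a) ^ 2 * u z) ∧
      (∀ z ∈ U, deriv g z = (z - a) * (2 * u z + (z - a) * deriv u z)) ∧
      (∀ z ∈ U, iteratedDeriv 2 g z =
        2 * u z + 4 * (z - a) * deriv u z + (z - a) ^ 2 * deriv (deriv u) z) ∧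
      iteratedDeriv 2 g a = 2 * u a ∧ iteratedDeriv 3 g a = 6 * deriv u a := by
  let u := dslope (dslope g a) a
  have hu : DifferentiableOn ℂ u U := by
    have h2 : DifferentiableOn ℂ (dslope g a) U :=
      (Complex.differentiableOn_dslope (hU.mem_nhds haU)).2 hg
    exact (Complex.differentiableOn_dslope (hU.mem_nhds haU)).2 h2
  have hform : ∀ z, g z = (z - a) ^ 2 * u z := by
    intro z
    have e1 := sub_smul_dslope g a z
    have e2 := sub_smul_dslope (dslope g a) a z
    rw [dslope_same, h1, sub_zero, smul_eq_mul] at e2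
    rw [h0, sub_zero, smul_eq_mul, ← e2] at e1
    rw [← e1]; simp only [u]; ring
  have hud : ∀ z ∈ U, DifferentiableAt ℂ u z := fun z hz => hu.differentiableAt (hU.mem_nhds hz)
  have hu' : DifferentiableOn ℂ (deriv u) U := hu.deriv hU
  have hud' : ∀ z ∈ U, DifferentiableAt ℂ (deriv u) z :=
    fun z hz => hu'.differentiableAt (hU.mem_nhds hz)
  have hu'' : DifferentiableOn ℂ (deriv (deriv u)) U := hu'.deriv hU
  have hg' : ∀ z ∈ U, deriv g z = (z - a) * (2 * u z + (z - a) * deriv u z) := by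
    intro z hz
    have e : g = fun z => (z - a) * ((z - a) * u z) := by
      funext z; rw [hform z]; ring
    have hz' := hud z hz
    have hd : DifferentiableAt ℂ (fun z => (z - a) * u z) z := by fun_prop
    rw [e, deriv_mul_sub hd, deriv_mul_sub (hud z hz)]
    ring
  have hv : ∀ z ∈ U, DifferentiableAt ℂ (fun z => 2 * u z + (z - a) * deriv u z) z := by
    intro z hz
    have h3 := hud z hz
    have h4 := hud' z hz
    fun_prop
  have hv' : ∀ z ∈ U, deriv (fun z => 2 * u z + (z - a) * deriv u z) z
      = 3 * deriv u z + (z - a) * deriv (deriv u) z := by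
    intro z hz
    have h3 := hud z hz
    have h4 := hud' z hz
    have hA : HasDerivAt (fun z => 2 * u z) (2 * deriv u z) z := h3.hasDerivAt.const_mul 2
    have hB : HasDerivAt (fun z => (z - a) * deriv u z)
        (deriv u z + (z - a) * deriv (deriv u) z) z := by
      rw [← deriv_mul_sub h4]
      apply DifferentiableAt.hasDerivAt
      fun_prop
    rw [(hA.fun_add hB).deriv]; ring
  have hg'' : ∀ z ∈ U, iteratedDeriv 2 g z =
        2 * u z + 4 * (z - a) * deriv u z + (z - a) ^ 2 * deriv (deriv u) z := by
    intro z hz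
    have ev : deriv g =ᶠ[𝓝 z] fun z => (z - a) * (2 * u z + (z - a) * deriv u z) := by
      filter_upwards [hU.mem_nhds hz] with y hy using hg' y hy
    rw [iteratedDeriv_succ, iteratedDeriv_one, ev.deriv_eq, deriv_mul_sub (hv z hz), hv' z hz]
    ring
  refine ⟨u, hu, hform, hg', hg'', ?_, ?_⟩
  · rw [hg'' a haU]; simp
  · have ev : iteratedDeriv 2 g =ᶠ[𝓝 a] fun z =>
        2 * u z + (z - a) * (4 * deriv u z + (z - a) * deriv (deriv u) z) := by
      filter_upwards [hU.mem_nhds haU] with y hy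
      rw [hg'' y hy]; ring
    have h3 := hud a haU
    have h4 := hud' a haU
    have h5 := hu''.differentiableAt (hU.mem_nhds haU)
    have hd : DifferentiableAt ℂ (fun z => 4 * deriv u z + (z - a) * deriv (deriv u) z) a := by
      fun_prop
    have hA : HasDerivAt (fun z => 2 * u z) (2 * deriv u a) a := h3.hasDerivAt.const_mul 2
    have hB : HasDerivAt (fun z => (z - a) * (4 * deriv u z + (z - a) * deriv (deriv u) z))
        (4 * deriv u a + (a - a) * deriv (deriv u) a +
          (a - a) * deriv (fun z => 4 * deriv u z + (z - a) * deriv (deriv u) z) a) a := by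
      rw [← deriv_mul_sub hd]
      apply DifferentiableAt.hasDerivAt
      fun_prop
    rw [iteratedDeriv_succ, ev.deriv_eq, (hA.fun_add hB).deriv]
    ring

lemma ext_removable {F : ℂ → ℂ}
    (h : ∀ a, ∃ N : ℂ → ℂ, AnalyticAt ℂ N a ∧ ∀ᶠ z in 𝓝[≠] a, F z = N z) :
    ∃ Q : ℂ → ℂ, Differentiable ℂ Q ∧ ∀ a, ContinuousAt F a → Q a = F a := by
  choose N hN hFN using h
  have key : ∀ a, ∀ M : ℂ → ℂ, ContinuousAt M a → (∀ᶠ z in 𝓝[≠] a, F z = M z) →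
      limUnder (𝓝[≠] a) F = M a := by
    intro a M hM hev
    apply Tendsto.limUnder_eq
    exact (hM.tendsto.mono_left nhdsWithin_le_nhds).congr' (hev.mono fun z hz => hz.symm)
  refine ⟨fun a => limUnder (𝓝[≠] a) F, ?_, ?_⟩
  · intro a
    refine (hN a).differentiableAt.congr_of_eventuallyEq ?_
    have h1 := hFN a
    rw [eventually_nhdsWithin_iff] at h1
    filter_upwards [h1.eventually_nhds, (hN a).eventually_analyticAt] with z hz hz2
    rcases eq_or_ne z a with rfl | hne
    · exact key _ _ (hN _).continuousAt (hFN _)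
    · refine key _ _ hz2.continuousAt ?_
      have : ∀ᶠ y in 𝓝 z, y ≠ a := eventually_ne_nhds hne
      filter_upwards [nhdsWithin_le_nhds hz, nhdsWithin_le_nhds this] with y hy hy2 using hy hy2
  · intro a ha
    exact key a F ha (Eventually.of_forall fun _ => rfl)

end NF

namespace NF

lemma iterDeriv_diff {g : ℂ → ℂ} (hg : Differentiable ℂ g) (k : ℕ) :
    Differentiable ℂ (iteratedDeriv k g) := by
  have : ContDiff ℂ (⊤ : ℕ∞) g := hg.contDiff
  exact this.differentiable_iteratedDeriv k (by exact_mod_cast WithTop.coe_lt_top k)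

lemma const_of_deriv_zero {g : ℂ → ℂ} (hg : Differentiable ℂ g) (h : ∀ z, deriv g z = 0) (z : ℂ) :
    g z = g 0 := is_const_of_deriv_eq_zero hg h z 0

lemma exp_ode {P : ℂ → ℂ} {μ : ℂ} (hP : Differentiable ℂ P) (h : ∀ z, deriv P z = μ * P z) (z : ℂ) :
    P z = P 0 * Complex.exp (μ * z) := by
  have hd : ∀ z, HasDerivAt (fun z => P z * Complex.exp (-(μ * z))) 0 z := by
    intro z
    have h1 := (hP z).hasDerivAt
    have h2 : HasDerivAt (fun z => Complex.exp (-(μ * z))) (Complex.exp (-(μ * z)) * (-(μ * 1))) z :=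
      (((hasDerivAt_id z).const_mul μ).neg).cexp
    refine (h1.mul h2).congr_deriv ?_
    rw [h z]; ring
  have := const_of_deriv_zero (g := fun z => P z * Complex.exp (-(μ * z)))
    (fun z => (hd z).differentiableAt) (fun z => (hd z).deriv) z
  simp only [mul_zero, neg_zero, Complex.exp_zero, mul_one] at this
  rw [← this, mul_assoc, ← Complex.exp_add]; simp

/-- Solutions of `G'' = μ² G` take every nonzero value unless identically zero. -/
lemma ode_surj {G : ℂ → ℂ} {μ h0 : ℂ} (hμ : μ ≠ 0) (hh0 : h0 ≠ 0) (hG : Differentiable ℂ G)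
    (h : ∀ z, deriv (deriv G) z = μ ^ 2 * G z) : (∀ z, G z = 0) ∨ ∃ z, G z = h0 := by
  have hG' : Differentiable ℂ (deriv G) := by
    simpa [iteratedDeriv_one] using iterDeriv_diff hG 1
  set P : ℂ → ℂ := fun z => deriv G z + μ * G z with hPdef
  set N : ℂ → ℂ := fun z => deriv G z + (-μ) * G z with hNdef
  have hP : ∀ z, deriv P z = μ * P z := by
    intro z
    have : HasDerivAt P (deriv (deriv G) z + μ * deriv G z) z :=
      (hG' z).hasDerivAt.fun_add ((hG z).hasDerivAt.const_mul μ)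
    rw [this.deriv, h z]; simp only [hPdef]; ring
  have hN : ∀ z, deriv N z = (-μ) * N z := by
    intro z
    have : HasDerivAt N (deriv (deriv G) z + (-μ) * deriv G z) z :=
      (hG' z).hasDerivAt.fun_add ((hG z).hasDerivAt.const_mul (-μ))
    rw [this.deriv, h z]; simp only [hNdef]; ring
  have eP := exp_ode (by fun_prop) hP
  have eN := exp_ode (by fun_prop) hN
  have eG : ∀ z, 2 * μ * G z = P 0 * Complex.exp (μ * z) - N 0 * Complex.exp (-μ * z) := by
    intro z
    rw [← eP z, ← eN z]; simp only [hPdef, hNdef]; ring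
  have h2μ : 2 * μ ≠ 0 := mul_ne_zero two_ne_zero hμ
  have solve : ∀ x : ℂ, x ≠ 0 → P 0 * (x * x) + (-(2 * μ * h0)) * x + (-N 0) = 0 →
      ∃ z, G z = h0 := by
    intro x hx hq
    refine ⟨Complex.log x / μ, ?_⟩
    have := eG (Complex.log x / μ)
    rw [mul_div_cancel₀ _ hμ, neg_mul, mul_div_cancel₀ _ hμ, Complex.exp_neg, Complex.exp_log hx] at this
    apply mul_left_cancel₀ h2μ
    rw [this]
    field_simp
    linear_combination hq
  by_cases hP0 : P 0 = 0
  · by_cases hN0 : N 0 = 0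
    · left
      intro z
      have := eG z
      rw [hP0, hN0] at this
      simpa [hμ] using this
    · right
      refine solve (-N 0 / (2 * μ * h0)) (by simp [hN0, hμ, hh0]) ?_
      rw [hP0]; field_simp; ring
  · right
    by_cases hN0 : N 0 = 0
    · refine solve (2 * μ * h0 / P 0) (by simp [hP0, hμ, hh0]) ?_
      rw [hN0]; field_simp; ring
    · obtain ⟨t, ht⟩ := IsAlgClosed.exists_eq_mul_self (discrim (P 0) (-(2 * μ * h0)) (-N 0))
      obtain ⟨x, hx⟩ := exists_quadratic_eq_zero hP0 ⟨t, ht⟩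
      refine solve x ?_ hx
      rintro rfl
      simp at hx
      exact hN0 hx

/-- Endgame. -/
lemma endgame {g : ℂ → ℂ} {h0 κ : ℂ} {K : ℝ} {s : ℕ} (hs : 2 ≤ s) (hse : Even s) (hh0 : h0 ≠ 0)
    (hK : 2 * ‖h0‖ < K) (hg : Differentiable ℂ g)
    (hg0 : ‖g 0‖ = 1) (hg1 : K ≤ ‖deriv g 0‖ ^ 2)
    (hz : ∀ z, g z = 0 → deriv g z = 0 ∧ iteratedDeriv 2 g z = h0 ∧ iteratedDeriv 3 g z = 0)
    (hG : (∀ z, iteratedDeriv 2 g z = h0) ∨ ∀ z, iteratedDeriv 2 g z = h0 → iteratedDeriv s g z = 0)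
    (hT : ∀ z, 2 * g z * iteratedDeriv 2 g z - deriv g z ^ 2 = κ * g z ^ 2) : False := by
  have hKpos : 0 < K := lt_of_le_of_lt (by positivity) hK
  have hd1 : Differentiable ℂ (deriv g) := by
    simpa [iteratedDeriv_one] using iterDeriv_diff hg 1
  have hd2 : Differentiable ℂ (iteratedDeriv 2 g) := iterDeriv_diff hg 2
  have e2 : ∀ z, deriv (deriv g) z = iteratedDeriv 2 g z := by
    intro z; rw [iteratedDeriv_succ, iteratedDeriv_one]
  have e3 : ∀ z, deriv (iteratedDeriv 2 g) z = iteratedDeriv 3 g z := by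
    intro z; rw [iteratedDeriv_succ (n := 2)]
  have hg'0 : deriv g 0 ≠ 0 := by
    intro h; rw [h] at hg1; simp at hg1; linarith
  have h3 : ∀ z, iteratedDeriv 3 g z = κ * deriv g z := by
    intro z
    by_cases hgz : g z = 0
    · obtain ⟨a, -, b⟩ := hz z hgz
      rw [a, b, mul_zero]
    · have hA : HasDerivAt (fun z => 2 * g z * iteratedDeriv 2 g z - deriv g z ^ 2)
          ((2 * deriv g z) * iteratedDeriv 2 g z + 2 * g z * iteratedDeriv 3 g z
            - (2:ℕ) * deriv g z ^ (2-1) * iteratedDeriv 2 g z) z := by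
        refine ((((hg z).hasDerivAt.const_mul 2).fun_mul
          (hd2 z).hasDerivAt).fun_sub ((hd1 z).hasDerivAt.fun_pow 2)).congr_deriv ?_
        rw [e3, e2]
      have hB : HasDerivAt (fun z => κ * g z ^ 2) (κ * ((2:ℕ) * g z ^ (2-1) * deriv g z)) z :=
        ((hg z).hasDerivAt.fun_pow 2).const_mul κ
      have heq : (fun z => 2 * g z * iteratedDeriv 2 g z - deriv g z ^ 2) = fun z => κ * g z ^ 2 :=
        funext hT
      rw [heq] at hA
      have := hA.unique hB
      push_cast at this
      apply mul_left_cancel₀ (mul_ne_zero two_ne_zero hgz)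
      linear_combination this
  by_cases hκ : κ = 0
  · -- quadratic case
    have hconst : ∀ z, iteratedDeriv 2 g z = iteratedDeriv 2 g 0 :=
      const_of_deriv_zero hd2 (fun z => by rw [e3, h3, hκ, zero_mul])
    set b := iteratedDeriv 2 g 0 with hb
    have hlin : ∀ z, deriv g z - b * z = deriv g 0 := by
      intro z
      have := const_of_deriv_zero (g := fun z => deriv g z - b * z) (by fun_prop) (fun z => by
        have : HasDerivAt (fun z => deriv g z - b * z) (deriv (deriv g) z - b * 1) z :=
          (hd1 z).hasDerivAt.fun_sub ((hasDerivAt_id z).const_mul b)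
        rw [this.deriv, e2, hconst, mul_one, sub_self]) z
      simpa using this
    have hb0 : K ≤ 2 * ‖b‖ := by
      have := hT 0
      rw [hκ, zero_mul, sub_eq_zero, ← hb] at this
      rw [← norm_pow, ← this, norm_mul, norm_mul, hg0] at hg1
      simpa using hg1
    have hbne : b ≠ 0 := by
      rintro h; rw [h] at hb0; simp at hb0; linarith
    set y := -deriv g 0 / b
    have hy : deriv g y = 0 := by
      have := hlin y
      have h4 : b * y = -deriv g 0 := mul_div_cancel₀ _ hbne
      rw [h4] at this
      linear_combination this
    have hgy : g y = 0 := by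
      have := hT y
      rw [hy, hconst, hκ] at this
      simpa [hbne] using this
    have := (hz y hgy).2.1
    rw [hconst] at this
    rw [this] at hb0
    linarith
  · obtain ⟨μ, hμ⟩ := IsAlgClosed.exists_eq_mul_self κ
    have hμ0 : μ ≠ 0 := by rintro rfl; simp at hμ; exact hκ hμ
    have hstep : ∀ k, iteratedDeriv (k + 3) g = fun z => κ * iteratedDeriv (k + 1) g z := by
      intro k
      induction k with
      | zero => funext z; simpa using h3 z
      | succ k ih =>
        funext z
        rw [show k + 1 + 3 = (k + 3) + 1 by ring, iteratedDeriv_succ, ih, deriv_const_mul_field,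
          ← iteratedDeriv_succ]
    have hno : ∀ z, iteratedDeriv 2 g z ≠ h0 := by
      intro z hzz
      rcases hG with hG | hG
      · have : iteratedDeriv 3 g 0 = 0 := by
          rw [← e3, show iteratedDeriv 2 g = fun _ => h0 from funext hG, deriv_const]
        rw [h3] at this
        exact (mul_ne_zero hκ hg'0) this
      · have := hG z hzz
        obtain ⟨j, hj⟩ := hse
        have hall : ∀ j, iteratedDeriv (2 * j + 2) g z = κ ^ j * h0 := by
          intro j
          induction j with
          | zero => simpa using hzz
          | succ j ih =>
            rw [show 2 * (j + 1) + 2 = (2 * j + 1) + 3 by ring, hstep]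
            simp only
            rw [ih]; ring
        have h5 := hall (j - 1)
        rw [show 2 * (j - 1) + 2 = s by omega, this] at h5
        exact (mul_ne_zero (pow_ne_zero _ hκ) hh0) h5.symm
    have hode : ∀ z, deriv (deriv (iteratedDeriv 2 g)) z = μ ^ 2 * iteratedDeriv 2 g z := by
      intro z
      rw [show deriv (iteratedDeriv 2 g) = iteratedDeriv 3 g from funext e3,
        ← iteratedDeriv_succ, hstep 1, hμ]
      ring
    rcases ode_surj hμ0 hh0 hd2 hode with h | ⟨z, h⟩
    · have : iteratedDeriv 3 g 0 = 0 := by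
        rw [← e3, show iteratedDeriv 2 g = fun _ => 0 from funext h, deriv_const]
      rw [h3] at this
      exact (mul_ne_zero hκ hg'0) this
    · exact hno z h

end NF

namespace NF

lemma sqrt_aux {x y K : ℝ} (hy : 0 < y) (h : x ^ 2 ≤ K * y) : x / y ≤ Real.sqrt (K / y) := by
  apply Real.le_sqrt_of_sq_le
  rw [div_pow, div_le_div_iff₀ (by positivity) hy]
  nlinarith

lemma quot_local {g : ℂ → ℂ} {h0 : ℂ} (hh0 : h0 ≠ 0) (hg : Differentiable ℂ g) {a : ℂ}
    (ha : g a = 0) (h1 : deriv g a = 0) (h2 : iteratedDeriv 2 g a = h0)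
    (h3 : iteratedDeriv 3 g a = 0) :
    ∃ N : ℂ → ℂ, AnalyticAt ℂ N a ∧
      ∀ᶠ z in 𝓝[≠] a, (2 * g z * iteratedDeriv 2 g z - deriv g z ^ 2) / g z ^ 2 = N z := by
  obtain ⟨u, hu, hform, hg', hg'', hu0, hu1⟩ := dbl isOpen_univ (mem_univ a) hg.differentiableOn ha h1
  have hu : Differentiable ℂ u := differentiableOn_univ.1 hu
  have hua : u a ≠ 0 := by
    intro h; rw [h2, h, mul_zero] at hu0; exact hh0 hu0
  have hu'a : deriv u a = 0 := by
    rw [h3] at hu1; simpa using hu1.symm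
  have hA := fun z => hu.analyticAt z
  have hA' : AnalyticAt ℂ (deriv u) a := (hA a).deriv
  have hA'' : AnalyticAt ℂ (deriv (deriv u)) a := hA'.deriv
  have hd1 : Differentiable ℂ (deriv u) := by
    simpa [iteratedDeriv_one] using iterDeriv_diff hu 1
  have hy : Differentiable ℂ (dslope (deriv u) a) :=
    differentiableOn_univ.1 ((Complex.differentiableOn_dslope univ_mem).2 hd1.differentiableOn)
  refine ⟨fun z => (4 * u z * dslope (deriv u) a z + 2 * u z * deriv (deriv u) z - deriv u z ^ 2)
    / u z ^ 2, ?_, ?_⟩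
  · have := hA a
    have hyy := hy.analyticAt a
    exact (((((analyticAt_const).mul this).mul hyy).add (((analyticAt_const).mul this).mul hA'')).sub
      (hA'.pow 2)).div (this.pow 2) (pow_ne_zero 2 hua)
  · have hne : ∀ᶠ z in 𝓝[≠] a, u z ≠ 0 :=
      nhdsWithin_le_nhds ((hu a).continuousAt.eventually_ne hua)
    filter_upwards [hne, self_mem_nhdsWithin] with z hz hza
    have hza' : z - a ≠ 0 := sub_ne_zero.2 hza
    have hds := sub_smul_dslope (deriv u) a z
    rw [hu'a, sub_zero, smul_eq_mul] at hds
    rw [hform z, hg' z (mem_univ _), hg'' z (mem_univ _)]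
    rw [div_eq_div_iff (pow_ne_zero _ (mul_ne_zero (pow_ne_zero _ hza') hz)) (pow_ne_zero _ hz)]
    linear_combination (-(4 * u z ^ 3 * (z - a) ^ 3)) * hds

/-- The entire-function classification. -/
lemma classification {g : ℂ → ℂ} {h0 : ℂ} {K lam : ℝ} {s : ℕ} (hs : 2 ≤ s) (hse : Even s)
    (hh0 : h0 ≠ 0) (hK : 2 * ‖h0‖ < K) (hl : 0 < lam) (hg : Differentiable ℂ g)
    (hgK : ∀ z, ‖g z‖ ≤ lam → ‖deriv g z‖ ^ 2 ≤ K * ‖g z‖)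
    (hg0 : ‖g 0‖ = 1) (hg1 : K ≤ ‖deriv g 0‖ ^ 2)
    (hz : ∀ z, g z = 0 → deriv g z = 0 ∧ iteratedDeriv 2 g z = h0 ∧ iteratedDeriv 3 g z = 0)
    (hG : (∀ z, iteratedDeriv 2 g z = h0) ∨
      ∀ z, iteratedDeriv 2 g z = h0 → iteratedDeriv s g z = 0) : False := by
  have hKpos : 0 < K := lt_of_le_of_lt (by positivity) hK
  have hh0p : 0 < ‖h0‖ := norm_pos_iff.2 hh0
  have hg'0 : deriv g 0 ≠ 0 := by
    intro h; rw [h] at hg1; simp at hg1; linarith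
  -- C1
  obtain ⟨p, hp⟩ : ∃ p, ‖g p‖ ≤ lam := by
    by_contra hcon
    push Not at hcon
    have hne : ∀ z, g z ≠ 0 := fun z => norm_pos_iff.1 (hl.trans (hcon z))
    have hinv : Differentiable ℂ (fun z => (g z)⁻¹) := fun z => (hg z).inv (hne z)
    have hb : Bornology.IsBounded (range fun z => (g z)⁻¹) := by
      rw [isBounded_iff_forall_norm_le]
      refine ⟨lam⁻¹, ?_⟩
      rintro _ ⟨z, rfl⟩
      simp only [norm_inv]
      exact inv_anti₀ hl (hcon z).le
    have hc : g = fun _ => g 0 := by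
      funext z
      exact inv_injective (hinv.apply_eq_apply_of_bounded hb z 0)
    apply hg'0
    rw [hc, deriv_const]
  -- C2
  have C2 : ∀ e, 0 < e → e ≤ lam → ∀ z, e ≤ ‖g z‖ → ‖deriv g z‖ ≤ ‖g z‖ * (4 * Real.sqrt (K / e)) := by
    intro e he hel z hez
    have hgz : 0 < ‖g z‖ := he.trans_le hez
    rcases le_or_gt ‖g z‖ lam with h | h
    · have h1 := sqrt_aux hgz (hgK z h)
      rw [div_le_iff₀ hgz] at h1
      have h2 : Real.sqrt (K / ‖g z‖) ≤ Real.sqrt (K / e) := Real.sqrt_le_sqrt (by gcongr)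
      have h3 := Real.sqrt_nonneg (K / e)
      nlinarith
    · obtain ⟨z1, hpos, hle, hgt, heq⟩ := nearest (u := fun z => ‖g z‖)
        hg.continuous.continuousOn.norm h hp
      refine (hopf_log_deriv hpos hl hg.differentiableOn hgt rfl heq (hg z1)).trans ?_
      refine mul_le_mul_of_nonneg_left ?_ (norm_nonneg _)
      have h1 := hgK z1 heq.le
      rw [heq] at h1
      have h2 := sqrt_aux hl h1
      have h3 : Real.sqrt (K / lam) ≤ Real.sqrt (K / e) := Real.sqrt_le_sqrt (by gcongr)
      rw [mul_div_assoc]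
      linarith
  -- C3
  set M := lam * Real.exp (2 * Real.sqrt (K / lam)) with hM
  have hMpos : 0 < M := by positivity
  set δ := min (1 / 8) (‖h0‖ / (32 * M)) with hδ
  have hδpos : 0 < δ := by positivity
  have hδ1 : δ ≤ 1 / 8 := min_le_left _ _
  have hδ2 : 32 * M * δ ≤ ‖h0‖ := by
    have : δ ≤ ‖h0‖ / (32 * M) := min_le_right _ _
    rw [le_div_iff₀ (by positivity)] at this
    linarith
  have C3 : ∀ a, g a = 0 → ∀ z, ‖z - a‖ ≤ 4 * δ → ‖h0‖ / 4 * ‖z - a‖ ^ 2 ≤ ‖g z‖ := by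
    intro a ha z hza
    obtain ⟨h1, h2, h3⟩ := hz a ha
    obtain ⟨u, hu, hform, hg', hg'', hu0, hu1⟩ :=
      dbl isOpen_univ (mem_univ a) hg.differentiableOn ha h1
    have hu : Differentiable ℂ u := differentiableOn_univ.1 hu
    have hub : ∀ y ∈ closedBall a 1, ‖u y‖ ≤ M := by
      refine max_principle one_pos hu.differentiableOn hu.continuous.continuousOn ?_
      intro y hy
      rw [mem_sphere, dist_eq_norm] at hy
      have h4 := boundB (g := g) (c := a) (z := y) (p := a) (R := 3) hl hKpos.le hg.differentiableOn
        (fun z _ => hgK z) (by rw [ha, norm_zero]; exact hl.le)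
        (by rw [norm_sub_rev a y, hy]; norm_num)
      rw [norm_sub_rev a y, hy, mul_one, hform y, norm_mul, norm_pow, hy, one_pow, one_mul] at h4
      exact h4
    have hmaps : MapsTo u (ball a 1) (closedBall (u a) (2 * M)) := by
      intro y hy
      rw [mem_closedBall, dist_eq_norm]
      have h4 := hub y (ball_subset_closedBall hy)
      have h5 := hub a (mem_closedBall_self zero_le_one)
      linarith [norm_sub_le (u y) (u a)]
    have hzb : z ∈ ball a 1 := by
      rw [mem_ball, dist_eq_norm]; linarith
    have h4 := Complex.dist_le_div_mul_dist_of_mapsTo_ball hu.differentiableOn hmaps hzb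
    rw [dist_eq_norm, dist_eq_norm, div_one] at h4
    have h5 : ‖u a‖ = ‖h0‖ / 2 := by
      rw [h2] at hu0
      rw [hu0, norm_mul]; simp
    have h6 : ‖h0‖ / 4 ≤ ‖u z‖ := by
      have h7 := norm_sub_norm_le (u a) (u z)
      rw [norm_sub_rev, h5] at h7
      have h8 : 2 * M * ‖z - a‖ ≤ 2 * M * (4 * δ) := by gcongr
      linarith
    rw [hform z, norm_mul, norm_pow, mul_comm]
    gcongr
  have sep : ∀ a b, g a = 0 → g b = 0 → a ≠ b → 4 * δ < ‖b - a‖ := by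
    intro a b ha hb hab
    by_contra hcon
    have := C3 a ha b (not_lt.1 hcon)
    rw [hb, norm_zero] at this
    have h1 : 0 < ‖b - a‖ := norm_pos_iff.2 (sub_ne_zero.2 hab.symm)
    have : 0 < ‖h0‖ / 4 * ‖b - a‖ ^ 2 := by positivity
    linarith
  set ε := min (min lam 1) (‖h0‖ / 4 * δ ^ 2) with hε
  have hεpos : 0 < ε := by positivity
  have hε1 : ε ≤ lam := (min_le_left _ _).trans (min_le_left _ _)
  have hε2 : ε ≤ 1 := (min_le_left _ _).trans (min_le_right _ _)
  have hε3 : ε ≤ ‖h0‖ / 4 * δ ^ 2 := min_le_right _ _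
  set C := 4 * Real.sqrt (K / ε) with hC
  have hCnn : 0 ≤ C := by positivity
  -- C4
  have C4 : ∀ z, (∀ a, g a = 0 → δ ≤ ‖z - a‖) → ‖deriv g z‖ ≤ ‖g z‖ * C := by
    intro z hza
    rcases le_or_gt ε ‖g z‖ with h | h
    · exact C2 ε hεpos hε1 z h
    have hgz : g z ≠ 0 := by
      intro h0; have := hza z h0; simp at this; linarith
    have hgzp : 0 < ‖g z‖ := norm_pos_iff.2 hgz
    obtain ⟨z1, hpos, hle, hgt, heq⟩ := nearest (u := fun z => -‖g z‖) (p := 0) (z := z) (lam := -ε)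
      hg.continuous.continuousOn.norm.neg (by linarith) (by simp only [hg0]; linarith)
    have heq : ‖g z1‖ = ε := by linarith
    have hgt : ∀ y ∈ ball z ‖z1 - z‖, ‖g y‖ < ε := fun y hy => by
      have := hgt y hy; linarith
    have hnz : ∀ y ∈ ball z ‖z1 - z‖, g y ≠ 0 := by
      intro a ha ha0
      have hd := hza a ha0
      have hdp : 0 < ‖z - a‖ := hδpos.trans_le hd
      set t : ℝ := δ / ‖z - a‖ with ht
      have ht0 : 0 ≤ t := by positivity
      have ht1 : t ≤ 1 := (div_le_one hdp).2 hd
      set y : ℂ := a + (t : ℂ) * (z - a) with hy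
      have hya : ‖y - a‖ = δ := by
        rw [hy, add_sub_cancel_left, norm_mul, Complex.norm_real, Real.norm_of_nonneg ht0, ht,
          div_mul_cancel₀ _ hdp.ne']
      have hyz : y ∈ ball z ‖z1 - z‖ := by
        have : y - z = ((1 - t : ℝ) : ℂ) * (a - z) := by rw [hy]; push_cast; ring
        rw [mem_ball, dist_eq_norm, this, norm_mul, Complex.norm_real,
          Real.norm_of_nonneg (by linarith)]
        rw [mem_ball, dist_eq_norm] at ha
        nlinarith [norm_nonneg (a - z)]
      have h1 := C3 a ha0 y (by rw [hya]; linarith)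
      rw [hya] at h1
      linarith [hgt y hyz]
    have hz1ne : g z1 ≠ 0 := norm_pos_iff.1 (by rw [heq]; exact hεpos)
    have hder : ∀ y, g y ≠ 0 → deriv (fun z => (g z)⁻¹) y = -deriv g y / g y ^ 2 := fun y hy =>
      ((hg y).hasDerivAt.fun_inv hy).deriv
    have H := hopf_log_deriv (f := fun z => (g z)⁻¹) (z0 := z) (z1 := z1) (lam := ε⁻¹) hpos
      (by positivity) (fun y hy => ((hg y).inv (hnz y hy)).differentiableWithinAt)
      (fun y hy => by
        rw [norm_inv]
        exact inv_strictAnti₀ (norm_pos_iff.2 (hnz y hy)) (hgt y hy)) rfl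
      (by rw [norm_inv, heq]) ((hg z1).inv hz1ne)
    rw [hder z hgz, hder z1 hz1ne, norm_div, norm_div, norm_neg, norm_neg, norm_pow, norm_pow,
      norm_inv, heq] at H
    have h1 := hgK z1 (heq.le.trans hε1)
    rw [heq] at h1
    have h2 := sqrt_aux hεpos h1
    have h3 : ‖deriv g z‖ / ‖g z‖ ^ 2 ≤ ‖g z‖⁻¹ * C := by
      calc _ ≤ _ := H
        _ = ‖g z‖⁻¹ * (4 * (‖deriv g z1‖ / ε)) := by field_simp
        _ ≤ _ := by rw [hC]; gcongr
    rw [div_le_iff₀ (by positivity)] at h3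
    calc _ ≤ _ := h3
      _ = _ := by field_simp
  -- C5
  set q : ℂ → ℂ := fun z => (2 * g z * iteratedDeriv 2 g z - deriv g z ^ 2) / g z ^ 2 with hq
  have hd1 : Differentiable ℂ (deriv g) := by
    simpa [iteratedDeriv_one] using iterDeriv_diff hg 1
  have hd2 : Differentiable ℂ (iteratedDeriv 2 g) := iterDeriv_diff hg 2
  have e2 : ∀ z, deriv (deriv g) z = iteratedDeriv 2 g z := by
    intro z; rw [iteratedDeriv_succ, iteratedDeriv_one]
  have C5 : ∀ z, (∀ a, g a = 0 → 2 * δ ≤ ‖z - a‖) → ‖q z‖ ≤ 2 * (C / δ) + C ^ 2 := by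
    intro z hza
    have hfar : ∀ y ∈ closedBall z δ, ∀ a, g a = 0 → δ ≤ ‖y - a‖ := by
      intro y hy a ha
      rw [mem_closedBall, dist_eq_norm] at hy
      have := hza a ha
      have h1 := norm_sub_le_norm_sub_add_norm_sub z y a
      rw [norm_sub_rev z y] at h1
      linarith
    have hnz : ∀ y ∈ closedBall z δ, g y ≠ 0 := by
      intro y hy h0
      have := hfar y hy y h0
      simp at this; linarith
    have hL : ∀ y ∈ closedBall z δ, ‖deriv g y / g y‖ ≤ C := by
      intro y hy
      rw [norm_div, div_le_iff₀ (norm_pos_iff.2 (hnz y hy)), mul_comm]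
      exact C4 y (hfar y hy)
    have hdiff : ∀ y ∈ closedBall z δ, DifferentiableAt ℂ (fun y => deriv g y / g y) y :=
      fun y hy => (hd1 y).div (hg y) (hnz y hy)
    have hDC : DiffContOnCl ℂ (fun y => deriv g y / g y) (ball z δ) := by
      apply DifferentiableOn.diffContOnCl
      rw [closure_ball z hδpos.ne']
      exact fun y hy => (hdiff y hy).differentiableWithinAt
    have h1 := Complex.norm_deriv_le_of_forall_mem_sphere_norm_le hδpos hDC
      (fun y hy => hL y (sphere_subset_closedBall hy))
    have hzz : z ∈ closedBall z δ := mem_closedBall_self hδpos.le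
    have hgz := hnz z hzz
    have h2 : deriv (fun y => deriv g y / g y) z =
        (iteratedDeriv 2 g z * g z - deriv g z * deriv g z) / g z ^ 2 := by
      rw [((hd1 z).hasDerivAt.fun_div (hg z).hasDerivAt hgz).deriv, e2]
    have h3 : q z = 2 * deriv (fun y => deriv g y / g y) z + (deriv g z / g z) ^ 2 := by
      rw [h2]; simp only [hq]; field_simp; ring
    rw [h3]
    refine (norm_add_le _ _).trans ?_
    rw [norm_mul, norm_pow, Complex.norm_two]
    have h4 := hL z hzz
    gcongr
  -- extension
  obtain ⟨Q, hQ, hQq⟩ := ext_removable (F := q) (by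
    intro a
    by_cases ha : g a = 0
    · obtain ⟨h1, h2, h3⟩ := hz a ha
      exact quot_local hh0 hg ha h1 h2 h3
    · refine ⟨q, ?_, Eventually.of_forall fun _ => rfl⟩
      have a0 := hg.analyticAt a
      have a1 := hd1.analyticAt a
      have a2 := hd2.analyticAt a
      exact (((analyticAt_const.mul a0).mul a2).sub (a1.pow 2)).div (a0.pow 2) (pow_ne_zero 2 ha))
  have hQq' : ∀ z, g z ≠ 0 → Q z = q z := by
    intro z hgz
    apply hQq
    have a0 := (hg z).continuousAt
    have a1 := (hd1 z).continuousAt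
    have a2 := (hd2 z).continuousAt
    exact (((continuousAt_const.mul a0).mul a2).sub (a1.pow 2)).div₀ (a0.pow 2) (pow_ne_zero 2 hgz)
  -- C6
  have hfar : ∀ z, (∀ a, g a = 0 → 2 * δ ≤ ‖z - a‖) → ‖Q z‖ ≤ 2 * (C / δ) + C ^ 2 := by
    intro z hza
    have hgz : g z ≠ 0 := by
      intro h0; have := hza z h0; simp at this; linarith
    rw [hQq' z hgz]
    exact C5 z hza
  have hbound : ∀ z, ‖Q z‖ ≤ 2 * (C / δ) + C ^ 2 := by
    intro z
    by_cases hza : ∀ a, g a = 0 → 2 * δ ≤ ‖z - a‖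
    · exact hfar z hza
    · push Not at hza
      obtain ⟨a, ha, hlt⟩ := hza
      refine max_principle (c := a) (r := 2 * δ) (by linarith) hQ.differentiableOn
        hQ.continuous.continuousOn ?_ z (by rw [mem_closedBall, dist_eq_norm]; exact hlt.le)
      intro w hw
      rw [mem_sphere, dist_eq_norm] at hw
      apply hfar
      intro b hb
      rcases eq_or_ne b a with rfl | hne
      · exact hw.ge
      · have h1 := sep b a hb ha hne
        have h2 := norm_sub_le_norm_sub_add_norm_sub a w b
        rw [norm_sub_rev a w] at h2
        linarith
  have hconst : ∀ z, Q z = Q 0 := fun z =>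
    hQ.apply_eq_apply_of_bounded (by
      rw [isBounded_iff_forall_norm_le]
      exact ⟨_, by rintro _ ⟨z, rfl⟩; exact hbound z⟩) z 0
  refine endgame (κ := Q 0) hs hse hh0 hK hg hg0 hg1 hz hG ?_
  intro z
  by_cases hgz : g z = 0
  · rw [hgz, (hz z hgz).1]; simp
  · rw [← hconst z, hQq' z hgz]
    simp only [hq]
    field_simp

end NF

namespace NF

lemma iterDeriv_diffOn {g : ℂ → ℂ} {U : Set ℂ} (hU : IsOpen U) (hg : DifferentiableOn ℂ g U) (k : ℕ) :
    DifferentiableOn ℂ (iteratedDeriv k g) U := by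
  induction k with
  | zero => simpa using hg
  | succ k ih => rw [iteratedDeriv_succ]; exact ih.deriv hU

lemma iterDeriv_lim {F : ℕ → ℂ → ℂ} {G : ℂ → ℂ} {l : Filter ℕ} {U : Set ℂ} (hU : IsOpen U)
    (hF : ∀ᶠ n in l, DifferentiableOn ℂ (F n) U) (hlim : TendstoLocallyUniformlyOn F G l U) (k : ℕ) :
    TendstoLocallyUniformlyOn (fun n => iteratedDeriv k (F n)) (iteratedDeriv k G) l U := by
  induction k with
  | zero => simpa using hlim
  | succ k ih =>
    simp only [iteratedDeriv_succ]
    exact ih.deriv (hF.mono fun n hn => iterDeriv_diffOn hU hn k) hU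

lemma ident {G : ℂ → ℂ} {U : Set ℂ} (hU : IsOpen U) (hc : IsPreconnected U)
    (hG : DifferentiableOn ℂ G U) {a : ℂ} (ha : a ∈ U) (h : ∀ᶠ z in 𝓝 a, G z = 0) :
    ∀ z ∈ U, G z = 0 :=
  (hG.analyticOnNhd hU).eqOn_zero_of_preconnected_of_eventuallyEq_zero hc ha h

/-- The hypotheses pass to locally uniform limits. -/
lemma good_limit {s : ℕ} {F H : ℕ → ℂ → ℂ} {G B : ℂ → ℂ} {l : Filter ℕ} [l.NeBot] {U : Set ℂ}
    (hU : IsOpen U) (hc : IsPreconnected U)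
    (hF : ∀ᶠ n in l, Good s (F n) (H n) U) (hH : ∀ᶠ n in l, DifferentiableOn ℂ (H n) U)
    (hlim : TendstoLocallyUniformlyOn F G l U) (hHlim : TendstoLocallyUniformlyOn H B l U)
    (hG : ¬ ∀ z ∈ U, G z = 0) :
    DifferentiableOn ℂ G U ∧
    (∀ z ∈ U, G z = 0 → deriv G z = 0 ∧ iteratedDeriv 2 G z = B z ∧ iteratedDeriv 3 G z = 0) ∧
    ((∀ z ∈ U, iteratedDeriv 2 G z = B z) ∨
      ∀ z ∈ U, iteratedDeriv 2 G z = B z → iteratedDeriv s G z = 0) := by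
  have hFd : ∀ᶠ n in l, DifferentiableOn ℂ (F n) U := hF.mono fun n h => h.1
  have hGd : DifferentiableOn ℂ G U := hlim.differentiableOn hFd hU
  have hBd : DifferentiableOn ℂ B U := hHlim.differentiableOn hH hU
  have hk := iterDeriv_lim hU hFd hlim
  have hGk := iterDeriv_diffOn hU hGd
  refine ⟨hGd, ?_, ?_⟩
  · intro a ha h0
    have hne : ¬ ∀ᶠ z in 𝓝 a, G z = 0 := fun h => hG (ident hU hc hGd ha h)
    refine ⟨?_, ?_, ?_⟩
    · have := hurwitz_transfer hU ha hFd hlim (hk 1) (hGk 1).continuousOn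
        (hF.mono fun n hn z hz h => by rw [iteratedDeriv_one]; exact (hn.2.1 z hz h).1) h0 hne
      rwa [iteratedDeriv_one] at this
    · have := hurwitz_transfer hU ha hFd hlim ((hk 2).sub hHlim)
        ((hGk 2).continuousOn.sub hBd.continuousOn)
        (hF.mono fun n hn z hz h => by
          simp only [Pi.sub_apply]
          rw [(hn.2.1 z hz h).2.1, sub_self]) h0 hne
      simpa [sub_eq_zero] using this
    · exact hurwitz_transfer hU ha hFd hlim (hk 3) (hGk 3).continuousOn
        (hF.mono fun n hn z hz h => (hn.2.1 z hz h).2.2) h0 hne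
  · by_cases hall : ∀ z ∈ U, iteratedDeriv 2 G z = B z
    · exact Or.inl hall
    · right
      intro a ha h0
      have hd : DifferentiableOn ℂ (iteratedDeriv 2 G - B) U := (hGk 2).sub hBd
      have hne : ¬ ∀ᶠ z in 𝓝 a, (iteratedDeriv 2 G - B) z = 0 := fun h =>
        hall fun z hz => by simpa [sub_eq_zero] using ident hU hc hd ha h z hz
      refine hurwitz_transfer hU ha ?_ ((hk 2).sub hHlim) (hk s) (hGk s).continuousOn ?_ ?_ hne
      · filter_upwards [hFd, hH] with n h1 h2
        exact (iterDeriv_diffOn hU h1 2).sub h2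
      · refine hF.mono fun n hn z hz h => hn.2.2 z hz ?_
        simpa [sub_eq_zero] using h
      · simp [h0]

lemma normAt_of_seq {f : ℕ → ℂ → ℂ} {z : ℂ} {ε : ℝ} (hε : 0 < ε)
    (P : (ℕ → ℕ) → Prop) (hP : ∃ N, ∀ φ : ℕ → ℕ, StrictMono φ → (∀ n, N ≤ φ n) → P φ)
    (h : ∀ φ : ℕ → ℕ, StrictMono φ → P φ → ∃ ψ : ℕ → ℕ, StrictMono ψ ∧
      ConvF (fun n => f (φ n)) (map ψ atTop) (ball z ε)) : NormAt f z := by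
  obtain ⟨N, hN⟩ := hP
  refine ⟨ε, hε, fun φ hφ => ?_⟩
  have hm : StrictMono (fun n => φ (n + N)) := fun a b hab => hφ (by omega)
  obtain ⟨ψ, hψ, hc⟩ := h _ hm (hN _ hm fun n => by
    have := hφ.id_le (n + N); simp only [id] at this; omega)
  refine ⟨fun n => ψ n + N, fun a b hab => by have := hψ hab; simpa using this, ?_⟩
  exact hc

lemma normAt_of_bounded {f : ℕ → ℂ → ℂ} {c : ℂ} {r M : ℝ} (hr : 0 < r)
    (hf : ∀ᶠ n in atTop, DifferentiableOn ℂ (f n) (ball c (2 * r)))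
    (hM : ∀ᶠ n in atTop, ∀ z ∈ ball c (2 * r), ‖f n z‖ ≤ M) : NormAt f c := by
  obtain ⟨N, hN⟩ := eventually_atTop.1 (hf.and hM)
  refine normAt_of_seq hr (fun φ => ∀ n, N ≤ φ n) ⟨N, fun φ _ h => h⟩ ?_
  intro φ _ hφN
  obtain ⟨ψ, hψ, g, hg⟩ := montel (f := fun n => f (φ n)) hr (fun n => (hN _ (hφN n)).1)
    (fun n => (hN _ (hφN n)).2)
  exact ⟨ψ, hψ, Or.inl ⟨g, hg.mono ball_subset_closedBall⟩⟩

lemma inv_lim {F : ℕ → ℂ → ℂ} {G : ℂ → ℂ} {l : Filter ℕ} {S : Set ℂ} {m : ℝ} (hm : 0 < m)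
    (hlim : TendstoUniformlyOn F G l S) (hG : ∀ z ∈ S, m ≤ ‖G z‖) :
    TendstoUniformlyOn (fun n z => (F n z)⁻¹) (fun z => (G z)⁻¹) l S := by
  rw [Metric.tendstoUniformlyOn_iff] at hlim ⊢
  intro ε hε
  filter_upwards [hlim (m / 2) (by linarith), hlim (ε * m ^ 2 / 4) (by positivity)] with n h1 h2 z hz
  have a1 := h1 z hz
  have a2 := h2 z hz
  have a3 := hG z hz
  rw [dist_eq_norm] at a1 a2 ⊢
  have a4 := norm_sub_norm_le (G z) (F n z)
  have a5 : m / 2 ≤ ‖F n z‖ := by linarith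
  have hG0 : G z ≠ 0 := norm_pos_iff.1 (by linarith)
  have hF0 : F n z ≠ 0 := norm_pos_iff.1 (by linarith)
  have e : (G z)⁻¹ - (F n z)⁻¹ = -(G z - F n z) / (G z * F n z) := by field_simp; ring
  rw [e, norm_div, norm_neg, norm_mul, div_lt_iff₀ (by positivity)]
  have : m * (m / 2) ≤ ‖G z‖ * ‖F n z‖ := by gcongr
  nlinarith

lemma caseI {f : ℕ → ℂ → ℂ} {z0 : ℂ} {R lam K : ℝ} (hR : 0 < R) (hl : 0 < lam) (hK : 0 ≤ K)
    (hf : ∀ n, DifferentiableOn ℂ (f n) (ball z0 R))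
    (hgK : ∀ n, ∀ z ∈ ball z0 R, ‖f n z‖ ≤ lam → ‖deriv (f n) z‖ ^ 2 ≤ K * ‖f n z‖) :
    ∃ ψ : ℕ → ℕ, StrictMono ψ ∧ ConvF f (map ψ atTop) (ball z0 (R / 16)) := by
  by_cases hfreq : ∃ᶠ n in atTop, ∃ p ∈ ball z0 (R / 4), ‖f n p‖ ≤ lam
  · obtain ⟨φ, hφ, hp⟩ := extraction_of_frequently_atTop hfreq
    obtain ⟨ψ, hψ, g, hg⟩ := montel (f := fun n => f (φ n)) (c := z0) (r := R / 8)
      (M := lam * Real.exp (2 * Real.sqrt (K / lam) * (R / 2))) (by linarith)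
      (fun n => (hf _).mono (ball_subset_ball (by linarith))) (by
        intro n z hz
        obtain ⟨p, hp1, hp2⟩ := hp n
        rw [mem_ball, dist_eq_norm] at hz hp1
        have h1 : ‖p - z‖ ≤ R / 2 := by
          have := norm_sub_le_norm_sub_add_norm_sub p z0 z
          rw [norm_sub_rev z0 z] at this
          linarith
        have := boundB (z := z) hl hK (hf (φ n)) (hgK (φ n)) hp2 (by linarith)
        refine this.trans ?_
        gcongr)
    refine ⟨φ ∘ ψ, hφ.comp hψ, Or.inl ⟨g, ?_⟩⟩
    exact hg.mono (ball_subset_closedBall.trans (closedBall_subset_closedBall (by linarith)))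
  · rw [not_frequently] at hfreq
    obtain ⟨N, hN⟩ := eventually_atTop.1 hfreq
    have hgt : ∀ n, ∀ p ∈ ball z0 (R / 4), lam < ‖f (n + N) p‖ := by
      intro n p hp
      have := hN (n + N) (by omega)
      push Not at this
      exact this p hp
    have hne : ∀ n, ∀ p ∈ ball z0 (R / 4), f (n + N) p ≠ 0 := fun n p hp =>
      norm_pos_iff.1 (hl.trans (hgt n p hp))
    have hdi : ∀ n, DifferentiableOn ℂ (fun z => (f (n + N) z)⁻¹) (ball z0 (R / 4)) := fun n =>
      ((hf _).mono (ball_subset_ball (by linarith))).inv (hne n)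
    obtain ⟨ψ, hψ, G, hG⟩ := montel (f := fun n z => (f (n + N) z)⁻¹) (c := z0) (r := R / 8)
      (M := lam⁻¹) (by linarith)
      (by rw [show 2 * (R / 8) = R / 4 by ring]; exact hdi)
      (by
        rw [show 2 * (R / 8) = R / 4 by ring]
        intro n z hz
        rw [norm_inv]
        exact inv_anti₀ hl (hgt n z hz).le)
    refine ⟨fun n => ψ n + N, fun a b hab => by have := hψ hab; simpa using this, ?_⟩
    have hGb : TendstoUniformlyOn (fun n z => (f (ψ n + N) z)⁻¹) G atTop (ball z0 (R / 8)) :=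
      hG.mono ball_subset_closedBall
    have hsub : ball z0 (R / 8) ⊆ ball z0 (R / 4) := ball_subset_ball (by linarith)
    have hGd : DifferentiableOn ℂ G (ball z0 (R / 8)) :=
      hGb.tendstoLocallyUniformlyOn.differentiableOn
        (Eventually.of_forall fun n => (hdi (ψ n)).mono hsub) isOpen_ball
    by_cases hz : ∃ a ∈ ball z0 (R / 8), G a = 0
    · obtain ⟨a, ha, ha0⟩ := hz
      have hG0 : ∀ z ∈ ball z0 (R / 8), G z = 0 := by
        refine ident isOpen_ball (convex_ball _ _).isPreconnected hGd ha ?_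
        by_contra hcon
        have ha' : R / 8 - dist a z0 > 0 := by rw [mem_ball] at ha; linarith
        have := hurwitz isOpen_ball ha (Eventually.of_forall fun n => (hdi (ψ n)).mono hsub)
          hGb.tendstoLocallyUniformlyOn ha0 hcon _ ha'
        obtain ⟨n, z, hz1, hz2⟩ := this.exists
        refine hne (ψ n) z ?_ (inv_eq_zero.1 hz2)
        rw [mem_ball] at hz1 ⊢
        have := dist_triangle z a z0
        linarith
      right
      intro M
      rw [eventually_map]
      rw [Metric.tendstoUniformlyOn_iff] at hGb
      filter_upwards [hGb (|M| + 1)⁻¹ (by positivity)] with n hn z hz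
      have hz8 : z ∈ ball z0 (R / 8) := ball_subset_ball (by linarith) hz
      have h1 := hn z hz8
      rw [hG0 z hz8, dist_zero_left, norm_inv] at h1
      have h2 : 0 < ‖f (ψ n + N) z‖ := norm_pos_iff.2 (hne _ z (hsub hz8))
      rw [inv_lt_inv₀ h2 (by positivity)] at h1
      linarith [le_abs_self M]
    · push Not at hz
      left
      obtain ⟨y, hy, hmin⟩ := (isCompact_closedBall z0 (R / 16)).exists_isMinOn
        ⟨z0, mem_closedBall_self (by linarith)⟩ (f := fun z => ‖G z‖)
        (hGd.continuousOn.mono (closedBall_subset_ball (by linarith))).norm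
      have hpos : 0 < ‖G y‖ := norm_pos_iff.2 (hz y (closedBall_subset_ball (by linarith) hy))
      have := inv_lim hpos (hGb.mono (ball_subset_ball (by linarith) : ball z0 (R / 16) ⊆ _))
        (fun z hz => hmin (ball_subset_closedBall hz))
      simp only [inv_inv] at this
      exact ⟨_, this⟩

end NF

namespace NF

lemma W_compact {s : ℕ} {f h : ℂ → ℂ} {z0 : ℂ} {r r1 K A : ℝ} (hr1 : r1 < r)
    (hgood : Good s f h (ball z0 r)) (hne : ∀ z ∈ ball z0 r, h z ≠ 0)
    (hA : ∀ z ∈ ball z0 r, ‖h z‖ ≤ A) (hK : 2 * A < K) :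
    IsCompact {z | z ∈ closedBall z0 r1 ∧ f z ≠ 0 ∧ K * ‖f z‖ ≤ ‖deriv f z‖ ^ 2} := by
  have hsub : closedBall z0 r1 ⊆ ball z0 r := closedBall_subset_ball hr1
  have hfc : ContinuousOn f (ball z0 r) := hgood.1.continuousOn
  have hfc' : ContinuousOn (deriv f) (ball z0 r) := (hgood.1.deriv isOpen_ball).continuousOn
  refine (isCompact_closedBall z0 r1).of_isClosed_subset ?_ (fun z hz => hz.1)
  rw [← closure_subset_iff_isClosed]
  intro x hx
  have hx1 : x ∈ closedBall z0 r1 :=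
    (closure_minimal (fun z hz => hz.1) isClosed_closedBall) hx
  have hxr := hsub hx1
  have hfx := hfc.continuousAt (isOpen_ball.mem_nhds hxr)
  have hfx' := hfc'.continuousAt (isOpen_ball.mem_nhds hxr)
  rw [mem_closure_iff_frequently] at hx
  refine ⟨hx1, ?_, ?_⟩
  · intro h0
    obtain ⟨h1, h2, h3⟩ := hgood.2.1 x hxr h0
    obtain ⟨u, hu, hform, hg', hg'', hu0, hu1⟩ := dbl isOpen_ball hxr hgood.1 h0 h1
    have huc := hu.continuousOn.continuousAt (isOpen_ball.mem_nhds hxr)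
    have huc' := (hu.deriv isOpen_ball).continuousOn.continuousAt (isOpen_ball.mem_nhds hxr)
    have hux : ‖h x‖ = 2 * ‖u x‖ := by
      rw [← h2, hu0, norm_mul, Complex.norm_two]
    have hupos : 0 < ‖u x‖ := by
      have := norm_pos_iff.2 (hne x hxr)
      linarith
    have hlt : ‖2 * u x + (x - x) * deriv u x‖ ^ 2 < K * ‖u x‖ := by
      rw [sub_self, zero_mul, add_zero, norm_mul, Complex.norm_two]
      have := hA x hxr
      nlinarith
    have hc1 : ContinuousAt (fun y => ‖2 * u y + (y - x) * deriv u y‖ ^ 2) x := by fun_prop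
    have hc2 : ContinuousAt (fun y => K * ‖u y‖) x := by fun_prop
    have hev := hc1.eventually_lt hc2 hlt
    obtain ⟨y, hy, hy2, hyb⟩ := (hx.and_eventually (hev.and (isOpen_ball.mem_nhds hxr))).exists
    obtain ⟨-, hy0, hyK⟩ := hy
    have hyx : 0 < ‖y - x‖ := by
      rw [norm_pos_iff, sub_ne_zero]; rintro rfl; exact hy0 h0
    rw [hg' y hyb, hform y, norm_mul, norm_mul, norm_pow, mul_pow] at hyK
    have : 0 < ‖y - x‖ ^ 2 := by positivity
    nlinarith
  · by_contra hcon
    push Not at hcon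
    have hev := (hfx'.norm.pow 2).eventually_lt (hfx.norm.const_mul K) hcon
    obtain ⟨y, hy, hy2⟩ := (hx.and_eventually hev).exists
    exact absurd hy.2.2 (not_le.2 hy2)

/-- Existence of a rescaled limit leads to a contradiction. -/
lemma caseII {s : ℕ} (hs : 2 ≤ s) (hse : Even s) {f hn : ℕ → ℂ → ℂ} {h : ℂ → ℂ} {z0 zs : ℂ}
    {r r1 K A : ℝ} (hr1 : r1 < r) (hr1p : 0 < r1)
    (hgood : ∀ n, Good s (f n) (hn n) (ball z0 r))
    (hnd : ∀ n, DifferentiableOn ℂ (hn n) (ball z0 r))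
    (hconv : TendstoUniformlyOn hn h atTop (ball z0 r))
    (hne : ∀ z ∈ ball z0 r, h z ≠ 0) (hA : ∀ z ∈ ball z0 r, ‖h z‖ ≤ A) (hK : 2 * A < K)
    (z : ℕ → ℂ) (hz : ∀ n, z n ∈ closedBall z0 r1) (hz0 : ∀ n, f n (z n) ≠ 0)
    (hzK : ∀ n, K * ‖f n (z n)‖ ≤ ‖deriv (f n) (z n)‖ ^ 2)
    (hmax : ∀ n, ∀ y ∈ closedBall z0 r1, f n y ≠ 0 → K * ‖f n y‖ ≤ ‖deriv (f n) y‖ ^ 2 →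
      (r1 - ‖y - z0‖) ^ 2 / ‖f n y‖ ≤ (r1 - ‖z n - z0‖) ^ 2 / ‖f n (z n)‖)
    (hT : Tendsto (fun n => (r1 - ‖z n - z0‖) ^ 2 / ‖f n (z n)‖) atTop atTop)
    (hlimz : Tendsto z atTop (𝓝 zs)) : False := by
  have hzs1 : zs ∈ closedBall z0 r1 :=
    isClosed_closedBall.mem_of_tendsto hlimz (Eventually.of_forall hz)
  have hzs : zs ∈ ball z0 r := closedBall_subset_ball hr1 hzs1
  have hAnn : 0 ≤ A := (norm_nonneg _).trans (hA zs hzs)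
  have hKpos : 0 < K := by linarith
  have hhd : DifferentiableOn ℂ h (ball z0 r) :=
    hconv.tendstoLocallyUniformlyOn.differentiableOn (Eventually.of_forall hnd) isOpen_ball
  set ρ : ℕ → ℝ := fun n => Real.sqrt ‖f n (z n)‖ with hρ
  have hfp : ∀ n, 0 < ‖f n (z n)‖ := fun n => norm_pos_iff.2 (hz0 n)
  have hρp : ∀ n, 0 < ρ n := fun n => Real.sqrt_pos.2 (hfp n)
  have hρ2 : ∀ n, ρ n ^ 2 = ‖f n (z n)‖ := fun n => Real.sq_sqrt (norm_nonneg _)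
  have hρc : ∀ n, (ρ n : ℂ) ≠ 0 := fun n => by exact_mod_cast (hρp n).ne'
  set R : ℕ → ℝ := fun n => (r1 - ‖z n - z0‖) / ρ n with hR
  have hznn : ∀ n, 0 ≤ r1 - ‖z n - z0‖ := fun n => by
    have := hz n; rw [mem_closedBall, dist_eq_norm] at this; linarith
  have hRnn : ∀ n, 0 ≤ R n := fun n => div_nonneg (hznn n) (hρp n).le
  have hR2 : ∀ n, R n ^ 2 = (r1 - ‖z n - z0‖) ^ 2 / ‖f n (z n)‖ := fun n => by
    simp only [hR]; rw [div_pow, hρ2]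
  have hRρ : ∀ n, ρ n * R n = r1 - ‖z n - z0‖ := fun n => mul_div_cancel₀ _ (hρp n).ne'
  have hRtop : Tendsto R atTop atTop := by
    have h1 := Real.tendsto_sqrt_atTop.comp hT
    refine h1.congr fun n => ?_
    simp only [Function.comp]
    rw [← hR2, Real.sqrt_sq (hRnn n)]
  have hρ0 : Tendsto ρ atTop (𝓝 0) := by
    have h1 : Tendsto (fun n => r1 / R n) atTop (𝓝 0) := hRtop.const_div_atTop r1
    refine squeeze_zero' (Eventually.of_forall fun n => (hρp n).le) ?_ h1
    filter_upwards [hRtop.eventually_gt_atTop 0] with n hn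
    rw [le_div_iff₀ hn, hRρ]
    linarith [norm_nonneg (z n - z0)]
  set c : ℕ → ℂ := fun n => ((ρ n : ℂ) ^ 2)⁻¹ with hc
  have hc0 : ∀ n, c n ≠ 0 := fun n => inv_ne_zero (pow_ne_zero 2 (hρc n))
  have hcρ : ∀ n, c n * (ρ n : ℂ) ^ 2 = 1 := fun n => inv_mul_cancel₀ (pow_ne_zero 2 (hρc n))
  have hcn : ∀ n, ‖c n‖ = (ρ n ^ 2)⁻¹ := fun n => by
    simp only [hc]; rw [norm_inv, norm_pow, Complex.norm_real, Real.norm_of_nonneg (hρp n).le]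
  set g : ℕ → ℂ → ℂ := fun n ζ => c n * f n (z n + ρ n * ζ) with hg
  set H : ℕ → ℂ → ℂ := fun n ζ => hn n (z n + ρ n * ζ) with hH
  have hmapR : ∀ n, ∀ ζ ∈ ball (0:ℂ) (R n), z n + ρ n * ζ ∈ closedBall z0 r1 ∧
      ‖(z n + ρ n * ζ) - z0‖ ≤ ‖z n - z0‖ + ρ n * ‖ζ‖ := by
    intro n ζ hζ
    rw [mem_ball_zero_iff] at hζ
    have h1 : ‖(z n + ρ n * ζ) - z0‖ ≤ ‖z n - z0‖ + ρ n * ‖ζ‖ := by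
      calc _ = ‖(z n - z0) + ρ n * ζ‖ := by congr 1; ring
        _ ≤ _ := norm_add_le _ _
        _ = _ := by rw [norm_mul, Complex.norm_real, Real.norm_of_nonneg (hρp n).le]
    refine ⟨?_, h1⟩
    rw [mem_closedBall, dist_eq_norm]
    have h2 : ρ n * ‖ζ‖ ≤ ρ n * R n := by have := (hρp n).le; gcongr
    rw [hRρ] at h2
    linarith
  have hsub : ∀ n, ball (0:ℂ) (R n) ⊆ (fun ζ => z n + ρ n * ζ) ⁻¹' (ball z0 r) := fun n ζ hζ =>
    closedBall_subset_ball hr1 (hmapR n ζ hζ).1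
  have hgG : ∀ n, Good s (g n) (H n) (ball 0 (R n)) := by
    intro n
    have := ((hgood n).scale (z n) (hc0 n) (hρc n)).mono (hsub n)
    simp only [hcρ, one_mul] at this
    exact this
  have hHd : ∀ n, DifferentiableOn ℂ (H n) (ball 0 (R n)) := by
    intro n
    exact (hnd n).comp (f := fun ζ => z n + ρ n * ζ) (by fun_prop) (hsub n)
  have hgd : ∀ n ζ, deriv (g n) ζ = c n * ρ n * deriv (f n) (z n + ρ n * ζ) := by
    intro n ζ
    have := congrFun (iterDeriv_scale (f n) (c n) (ρ n) (z n) 1) ζ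
    rw [iteratedDeriv_one, pow_one, iteratedDeriv_one] at this
    exact this
  have hgn : ∀ n ζ, ‖g n ζ‖ = ‖f n (z n + ρ n * ζ)‖ / ρ n ^ 2 := by
    intro n ζ
    simp only [hg]; rw [norm_mul, hcn, inv_mul_eq_div]
  have hgdn : ∀ n ζ, ‖deriv (g n) ζ‖ ^ 2 = ‖deriv (f n) (z n + ρ n * ζ)‖ ^ 2 / ρ n ^ 2 := by
    intro n ζ
    have := hρp n
    rw [hgd, norm_mul, norm_mul, hcn, Complex.norm_real, Real.norm_of_nonneg this.le]
    field_simp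
  have hg0 : ∀ n, ‖g n 0‖ = 1 := by
    intro n
    rw [hgn, mul_zero, add_zero, hρ2, div_self (hfp n).ne']
  have hg1 : ∀ n, K ≤ ‖deriv (g n) 0‖ ^ 2 := by
    intro n
    rw [hgdn, mul_zero, add_zero, hρ2, le_div_iff₀ (hfp n)]
    exact hzK n
  have hgK : ∀ n, ∀ ζ ∈ ball (0:ℂ) (R n / 4), ‖g n ζ‖ ≤ 1 / 2 →
      ‖deriv (g n) ζ‖ ^ 2 ≤ K * ‖g n ζ‖ := by
    intro n ζ hζ hle
    by_contra hcon
    push Not at hcon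
    have hζ' : ‖ζ‖ < R n / 4 := by simpa using hζ
    have hRp : 0 < R n := by linarith [norm_nonneg ζ]
    have hζR : ζ ∈ ball (0:ℂ) (R n) := by rw [mem_ball_zero_iff]; linarith
    obtain ⟨hy1, hy2⟩ := hmapR n ζ hζR
    set y := z n + ρ n * ζ with hy
    have hp2 : 0 < ρ n ^ 2 := pow_pos (hρp n) 2
    rw [hgdn, hgn, ← hy, ← mul_div_assoc, div_lt_div_iff_of_pos_right hp2] at hcon
    rw [hgn, ← hy, div_le_iff₀ hp2] at hle
    have hfy : f n y ≠ 0 := by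
      intro h0
      have := ((hgood n).2.1 y (closedBall_subset_ball hr1 hy1) h0).1
      rw [this, h0] at hcon
      simp at hcon
    have hm := hmax n y hy1 hfy hcon.le
    rw [← hR2, div_le_iff₀ (norm_pos_iff.2 hfy)] at hm
    have h1 : R n ^ 2 * ‖f n y‖ ≤ 1 / 2 * (ρ n * R n) ^ 2 := by
      have : 0 ≤ R n ^ 2 := by positivity
      nlinarith
    have h2 : ρ n * ‖ζ‖ ≤ ρ n * R n / 4 := by
      have := hρp n; nlinarith
    have h3 : 3 / 4 * (ρ n * R n) ≤ r1 - ‖y - z0‖ := by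
      rw [hRρ] at h2 ⊢; linarith
    have h4 : 0 < ρ n * R n := mul_pos (hρp n) hRp
    nlinarith
  -- nearby small point
  set P := 2 * Real.log 2 / Real.sqrt K + 1 with hP
  have hsK : 0 < Real.sqrt K := Real.sqrt_pos.2 hKpos
  have hlog2 : 0 < Real.log 2 := Real.log_pos (by norm_num)
  have hPpos : 0 < P := by positivity
  have hpt : ∀ n, P < R n / 4 → ∃ p ∈ ball (0:ℂ) P, ‖g n p‖ ≤ 1 / 2 := by
    intro n hPR
    by_contra hcon
    push Not at hcon
    have h1 := (harnack hPpos (by norm_num : (0:ℝ) < 1 / 2)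
      ((hgG n).1.mono (ball_subset_ball (by linarith))) hcon).1
    rw [hg0 n] at h1
    have h2 : Real.sqrt K ≤ ‖deriv (g n) 0‖ := by
      rw [← Real.sqrt_sq (norm_nonneg (deriv (g n) 0))]
      exact Real.sqrt_le_sqrt (hg1 n)
    have h3 : Real.sqrt K ≤ 2 * Real.log 2 / P := by
      refine h2.trans (h1.trans (le_of_eq ?_))
      norm_num
    rw [le_div_iff₀ hPpos, hP, mul_add, mul_div_cancel₀ _ hsK.ne'] at h3
    linarith
  have hbdd : ∀ N : ℝ, ∃ M, ∀ᶠ n in atTop, ∀ ζ ∈ ball (0:ℂ) N, ‖g n ζ‖ ≤ M := by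
    intro N
    refine ⟨1 / 2 * Real.exp (2 * Real.sqrt (K / (1 / 2)) * (P + N)), ?_⟩
    filter_upwards [hRtop.eventually_gt_atTop (4 * (P + 2 * N)), hRtop.eventually_gt_atTop (4 * P)]
      with n hn1 hn2 ζ hζ
    obtain ⟨p, hp1, hp2⟩ := hpt n (by linarith)
    rw [mem_ball_zero_iff] at hp1 hζ
    have h1 : ‖p - ζ‖ ≤ P + N := by linarith [norm_sub_le p ζ]
    have := boundB (z := ζ) (c := 0) (R := R n / 4) (by norm_num : (0:ℝ) < 1 / 2) hKpos.le
      ((hgG n).1.mono (ball_subset_ball (by linarith [hRnn n]))) (hgK n) hp2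
      (by rw [sub_zero]; linarith)
    refine this.trans ?_
    gcongr
  have hdiffN : ∀ N : ℝ, ∀ᶠ n in atTop, N ≤ R n := fun N => hRtop.eventually_ge_atTop N
  have hnorm : ∀ ζ ∈ (univ : Set ℂ), NormAt g ζ := by
    intro ζ _
    obtain ⟨M, hM⟩ := hbdd (‖ζ‖ + 2)
    have hsubb : ball ζ (2 * 1) ⊆ ball 0 (‖ζ‖ + 2) := by
      intro y hy
      rw [mem_ball, dist_eq_norm] at hy
      rw [mem_ball_zero_iff]
      have := norm_sub_norm_le y ζ
      linarith
    refine normAt_of_bounded one_pos (M := M) ?_ ?_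
    · filter_upwards [hdiffN (‖ζ‖ + 2)] with n hn
      exact (hgG n).1.mono (hsubb.trans (ball_subset_ball hn))
    · filter_upwards [hM] with n hn y hy using hn y (hsubb hy)
  obtain ⟨φ, hφ, hlim | hlim⟩ := glue isOpen_univ isConnected_univ hnorm
  swap
  · have := hlim {0} (subset_univ _) isCompact_singleton 2
    obtain ⟨n, hn⟩ := this.exists
    have := hn 0 rfl
    rw [hg0] at this
    norm_num at this
  obtain ⟨G, hG⟩ := hlim
  have hle : map φ atTop ≤ atTop := hφ.tendsto_atTop
  -- limit of H
  have hHlim : ∀ N : ℝ, TendstoLocallyUniformlyOn H (fun _ => h zs) (map φ atTop) (ball 0 N) := by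
    intro N
    apply TendstoUniformlyOn.tendstoLocallyUniformlyOn
    have : TendstoUniformlyOn H (fun _ => h zs) atTop (ball 0 N) := by
      rw [Metric.tendstoUniformlyOn_iff] at hconv ⊢
      intro ε hε
      have hhc := hhd.continuousOn.continuousAt (isOpen_ball.mem_nhds hzs)
      obtain ⟨η, hη, hηh⟩ := Metric.continuousAt_iff.1 hhc (ε / 2) (by linarith)
      have h1 : Tendsto (fun n => dist (z n) zs + ρ n * N) atTop (𝓝 0) := by
        have := (tendsto_iff_dist_tendsto_zero.1 hlimz).add (hρ0.mul_const N)
        simpa using this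
      filter_upwards [hconv (ε / 2) (by linarith), h1.eventually_lt_const hη, hdiffN N]
        with n hn1 hn2 hn3 ζ hζ
      have hyb : z n + ρ n * ζ ∈ ball z0 r := hsub n (ball_subset_ball hn3 hζ)
      rw [mem_ball_zero_iff] at hζ
      have h3 : dist (z n + ρ n * ζ) zs < η := by
        refine lt_of_le_of_lt ?_ hn2
        rw [dist_eq_norm, dist_eq_norm]
        calc _ = ‖(z n - zs) + ρ n * ζ‖ := by congr 1; ring
          _ ≤ _ := norm_add_le _ _
          _ = ‖z n - zs‖ + ρ n * ‖ζ‖ := by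
            rw [norm_mul, Complex.norm_real, Real.norm_of_nonneg (hρp n).le]
          _ ≤ _ := by have := (hρp n).le; gcongr
      have h4 := hηh h3
      have h5 := hn1 _ hyb
      rw [dist_comm] at h4
      have := dist_triangle (h zs) (h (z n + ρ n * ζ)) (hn n (z n + ρ n * ζ))
      simp only [hH]
      linarith
    exact fun u hu => hle (this u hu)
  have hGN : ∀ N : ℝ, TendstoLocallyUniformlyOn g G (map φ atTop) (ball 0 N) := fun N =>
    hG.mono (subset_univ _)
  have hgdN : ∀ N : ℝ, ∀ᶠ n in map φ atTop, DifferentiableOn ℂ (g n) (ball 0 N) := fun N => by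
    refine hle ?_
    filter_upwards [hdiffN N] with n hn using (hgG n).1.mono (ball_subset_ball hn)
  have hpt0 : ∀ ζ, Tendsto (fun n => g n ζ) (map φ atTop) (𝓝 (G ζ)) := fun ζ =>
    hG.tendsto_at (mem_univ ζ)
  have hpt1 : ∀ ζ, Tendsto (fun n => deriv (g n) ζ) (map φ atTop) (𝓝 (deriv G ζ)) := fun ζ => by
    have := ((hGN (‖ζ‖ + 1)).deriv (hgdN _) isOpen_ball).tendsto_at (a := ζ) (by
      rw [mem_ball_zero_iff]; linarith)
    exact this
  have hG0 : ‖G 0‖ = 1 := by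
    have := (hpt0 0).norm
    simp only [hg0] at this
    exact (tendsto_nhds_unique this tendsto_const_nhds)
  have hlimN := fun N : ℝ => fun hN : 0 < N => good_limit (s := s) (U := ball (0:ℂ) N) isOpen_ball
    (convex_ball _ _).isPreconnected
    (hle (by filter_upwards [hdiffN N] with n hn using (hgG n).mono (ball_subset_ball hn)))
    (hle (by filter_upwards [hdiffN N] with n hn using (hHd n).mono (ball_subset_ball hn)))
    (hGN N) (hHlim N) (fun hall => by
      have := hall 0 (mem_ball_self hN)
      rw [this] at hG0; simp at hG0)
  have hmemN : ∀ ζ : ℂ, ζ ∈ ball (0:ℂ) (‖ζ‖ + 1) := fun ζ => by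
    rw [mem_ball_zero_iff]; linarith
  refine classification (g := G) (h0 := h zs) (K := K) (lam := 1 / 4) hs hse (hne zs hzs)
    (by linarith [hA zs hzs]) (by norm_num) ?_ ?_ hG0 ?_ ?_ ?_
  · intro ζ
    exact (hlimN (‖ζ‖ + 1) (by positivity)).1.differentiableAt (isOpen_ball.mem_nhds (hmemN ζ))
  · intro ζ hζ
    have h1 := (hpt0 ζ).norm
    have h2 := (hpt1 ζ).norm.pow 2
    refine le_of_tendsto_of_tendsto h2 (h1.const_mul K) ?_
    have h3 : ∀ᶠ n in map φ atTop, ‖g n ζ‖ < 1 / 2 := h1.eventually_lt_const (by linarith)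
    filter_upwards [h3, hle (hdiffN (4 * (‖ζ‖ + 1)))] with n hn1 hn2
    exact hgK n ζ (by rw [mem_ball_zero_iff]; linarith) hn1.le
  · exact ge_of_tendsto ((hpt1 0).norm.pow 2) (Eventually.of_forall hg1)
  · intro ζ h0
    exact (hlimN (‖ζ‖ + 1) (by positivity)).2.1 ζ (hmemN ζ) h0
  · by_cases hall : ∀ ζ, iteratedDeriv 2 G ζ = h zs
    · exact Or.inl hall
    · right
      push Not at hall
      obtain ⟨ζ1, hζ1⟩ := hall
      intro ζ hζ
      have hN := hlimN (‖ζ‖ + ‖ζ1‖ + 1) (by positivity)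
      rcases hN.2.2 with h1 | h1
      · exact absurd (h1 ζ1 (by rw [mem_ball_zero_iff]; linarith [norm_nonneg ζ])) hζ1
      · exact h1 ζ (by rw [mem_ball_zero_iff]; linarith [norm_nonneg ζ1]) hζ

lemma local_core {s : ℕ} (hs : 2 ≤ s) (hse : Even s) {f hn : ℕ → ℂ → ℂ} {h : ℂ → ℂ} {z0 : ℂ}
    {r A : ℝ} (hr : 0 < r)
    (hgood : ∀ n, Good s (f n) (hn n) (ball z0 r))
    (hnd : ∀ n, DifferentiableOn ℂ (hn n) (ball z0 r))
    (hnne : ∀ n, ∀ z ∈ ball z0 r, hn n z ≠ 0)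
    (hnA : ∀ n, ∀ z ∈ ball z0 r, ‖hn n z‖ ≤ A)
    (hconv : TendstoUniformlyOn hn h atTop (ball z0 r))
    (hne : ∀ z ∈ ball z0 r, h z ≠ 0) (hA : ∀ z ∈ ball z0 r, ‖h z‖ ≤ A) :
    ∃ ψ : ℕ → ℕ, StrictMono ψ ∧ ConvF f (map ψ atTop) (ball z0 (r / 64)) := by
  have hAnn : 0 ≤ A := (norm_nonneg _).trans (hA z0 (mem_ball_self hr))
  set K := 2 * A + 1 with hK
  set r1 := r / 2 with hr1
  have hr1r : r1 < r := by rw [hr1]; linarith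
  have hr1p : 0 < r1 := by rw [hr1]; linarith
  set W : ℕ → Set ℂ := fun n =>
    {z | z ∈ closedBall z0 r1 ∧ f n z ≠ 0 ∧ K * ‖f n z‖ ≤ ‖deriv (f n) z‖ ^ 2} with hW
  have hWc : ∀ n, IsCompact (W n) := fun n =>
    W_compact hr1r (hgood n) (hnne n) (hnA n) (by rw [hK]; linarith)
  by_cases hI : ∃ T : ℝ, ∃ᶠ n in atTop, ∀ z ∈ W n, (r1 - ‖z - z0‖) ^ 2 / ‖f n z‖ ≤ T
  · obtain ⟨T, hT⟩ := hI
    obtain ⟨φ, hφ, hφT⟩ := extraction_of_frequently_atTop hT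
    set lam := (r1 / 2) ^ 2 / (|T| + 1) with hlam
    have hlp : 0 < lam := by positivity
    obtain ⟨ψ, hψ, hc⟩ := caseI (f := fun n => f (φ n)) (z0 := z0) (R := r / 4) (lam := lam) (K := K)
      (by linarith) hlp (by linarith)
      (fun n => (hgood _).1.mono (ball_subset_ball (by linarith))) (by
        intro n y hy hle
        by_contra hcon
        push Not at hcon
        rw [mem_ball, dist_eq_norm] at hy
        have hfy : f (φ n) y ≠ 0 := by
          intro h0
          have := ((hgood (φ n)).2.1 y (by rw [mem_ball, dist_eq_norm]; linarith) h0).1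
          rw [this, h0] at hcon
          simp at hcon
        have h1 := hφT n y ⟨by rw [mem_closedBall, dist_eq_norm, hr1]; linarith, hfy, hcon.le⟩
        have hp := norm_pos_iff.2 hfy
        rw [div_le_iff₀ hp] at h1
        rw [hlam, le_div_iff₀ (by positivity)] at hle
        have h2 : T * ‖f (φ n) y‖ < ‖f (φ n) y‖ * (|T| + 1) := by
          nlinarith [le_abs_self T]
        have h3 : r1 / 2 ≤ r1 - ‖y - z0‖ := by rw [hr1]; linarith
        have h4 : (r1 / 2) ^ 2 ≤ (r1 - ‖y - z0‖) ^ 2 := by gcongr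
        linarith)
    refine ⟨φ ∘ ψ, hφ.comp hψ, ?_⟩
    rw [show r / 64 = r / 4 / 16 by ring]
    exact hc
  · exfalso
    push Not at hI
    have hI' : ∀ T : ℝ, ∀ᶠ n in atTop, ∃ z ∈ W n, T < (r1 - ‖z - z0‖) ^ 2 / ‖f n z‖ := by
      intro T
      have := hI T
      exact this
    have hmaxi : ∀ᶠ n in atTop, ∃ z ∈ W n,
        IsMaxOn (fun z => (r1 - ‖z - z0‖) ^ 2 / ‖f n z‖) (W n) z := by
      filter_upwards [hI' 0] with n hn
      obtain ⟨z, hz, -⟩ := hn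
      refine (hWc n).exists_isMaxOn ⟨z, hz⟩ ?_
      have hsub : W n ⊆ ball z0 r := fun z hz => closedBall_subset_ball hr1r hz.1
      exact ContinuousOn.div (by fun_prop) ((hgood n).1.continuousOn.mono hsub).norm
        (fun z hz => norm_ne_zero_iff.2 hz.2.1)
    obtain ⟨N, hN⟩ := eventually_atTop.1 hmaxi
    choose! z hzW hzmax using hN
    obtain ⟨zs, hzs, χ, hχ, hχlim⟩ := (isCompact_closedBall z0 r1).tendsto_subseq
      (x := fun n => z (n + N)) (fun n => (hzW (n + N) (by omega)).1)
    have hsm : Tendsto (fun n => χ n + N) atTop atTop :=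
      (tendsto_add_atTop_nat N).comp hχ.tendsto_atTop
    refine caseII hs hse (f := fun n => f (χ n + N)) (hn := fun n => hn (χ n + N)) (h := h)
      (K := K) (A := A) (r1 := r1) (zs := zs) hr1r hr1p
      (fun n => hgood _) (fun n => hnd _) ?_ hne hA (by rw [hK]; linarith) (fun n => z (χ n + N))
      (fun n => (hzW _ (by omega)).1) (fun n => (hzW _ (by omega)).2.1)
      (fun n => (hzW _ (by omega)).2.2) ?_ ?_ hχlim
    · exact fun u hu => hsm.eventually (hconv u hu)
    · intro n y hy1 hy2 hy3
      exact hzmax (χ n + N) (by omega) (show y ∈ W (χ n + N) from ⟨hy1, hy2, hy3⟩)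
    · rw [Filter.tendsto_atTop]
      intro T
      filter_upwards [hsm.eventually (hI' T)] with n hn
      obtain ⟨y, hy, hyT⟩ := hn
      exact hyT.le.trans (hzmax (χ n + N) (by omega) hy)

lemma local_normal {s : ℕ} (hs : 2 ≤ s) (hse : Even s) {f hn : ℕ → ℂ → ℂ} {h : ℂ → ℂ} {z0 : ℂ}
    {r A : ℝ} (hr : 0 < r)
    (hgood : ∀ᶠ n in atTop, Good s (f n) (hn n) (ball z0 r))
    (hnd : ∀ᶠ n in atTop, DifferentiableOn ℂ (hn n) (ball z0 r))
    (hnne : ∀ᶠ n in atTop, ∀ z ∈ ball z0 r, hn n z ≠ 0)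
    (hconv : TendstoUniformlyOn hn h atTop (ball z0 r))
    (hne : ∀ z ∈ ball z0 r, h z ≠ 0) (hA : ∀ z ∈ ball z0 r, ‖h z‖ ≤ A) : NormAt f z0 := by
  have hb : ∀ᶠ n in atTop, ∀ z ∈ ball z0 r, ‖hn n z‖ ≤ A + 1 := by
    filter_upwards [(Metric.tendstoUniformlyOn_iff.1 hconv) 1 one_pos] with n hn1 z hz
    have h1 := hn1 z hz
    rw [dist_comm, dist_eq_norm] at h1
    have h2 := norm_sub_norm_le (hn n z) (h z)
    linarith [hA z hz]
  obtain ⟨N, hN⟩ := eventually_atTop.1 (hgood.and (hnd.and (hnne.and hb)))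
  refine normAt_of_seq (ε := r / 64) (by linarith) (fun φ => ∀ n, N ≤ φ n) ⟨N, fun φ _ h => h⟩ ?_
  intro φ hφ hφN
  exact local_core hs hse (hn := fun n => hn (φ n)) (A := A + 1) hr (fun n => (hN _ (hφN n)).1)
    (fun n => (hN _ (hφN n)).2.1) (fun n => (hN _ (hφN n)).2.2.1) (fun n => (hN _ (hφN n)).2.2.2)
    (fun u hu => hφ.tendsto_atTop.eventually (hconv u hu)) hne
    (fun z hz => (hA z hz).trans (by linarith))

end NF

namespace NF

lemma fill {F : ℕ → ℂ → ℂ} {G : ℂ → ℂ} {l : Filter ℕ} [l.NeBot] {R : ℝ} (hR : 0 < R)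
    (hF : ∀ᶠ n in l, DifferentiableOn ℂ (F n) (ball 0 R) ∧ ContinuousOn (F n) (closedBall 0 R))
    (hlim : TendstoUniformlyOn F G l (sphere 0 R)) :
    TendstoUniformlyOn F (fun z => limUnder l (fun n => F n z)) l (closedBall 0 R) := by
  have hC : UniformCauchySeqOn F l (closedBall 0 R) := by
    intro u hu
    obtain ⟨ε, hε, hεu⟩ := Metric.mem_uniformity_dist.1 hu
    have h1 := hlim.uniformCauchySeqOn {p | dist p.1 p.2 < ε / 2}
      (Metric.dist_mem_uniformity (by linarith))
    filter_upwards [h1, (hF.prod_mk hF)] with p hp hp2 z hz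
    apply hεu
    have := max_principle (f := fun z => F p.1 z - F p.2 z) hR (hp2.1.1.sub hp2.2.1)
      (hp2.1.2.sub hp2.2.2) (m := ε / 2) (fun z hz => by
        have := hp z hz
        simp only [mem_setOf_eq, dist_eq_norm] at this
        exact this.le) z hz
    rw [dist_eq_norm]
    exact lt_of_le_of_lt this (by linarith)
  refine hC.tendstoUniformlyOn_of_tendsto fun z hz => ?_
  have := hC.cauchy_map hz
  exact this.le_nhds_lim

lemma punct_conn {r : ℝ} (hr : 0 < r) : IsConnected (ball (0:ℂ) r \ {0}) := by
  have h1 : ball (0:ℂ) r \ {0} = Complex.exp '' {z : ℂ | z.re < Real.log r} := by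
    ext z
    constructor
    · rintro ⟨hz, hz0⟩
      have hz0 : z ≠ 0 := hz0
      refine ⟨Complex.log z, ?_, Complex.exp_log hz0⟩
      rw [mem_setOf_eq, Complex.log_re]
      rw [mem_ball_zero_iff] at hz
      exact Real.log_lt_log (norm_pos_iff.2 hz0) hz
    · rintro ⟨w, hw, rfl⟩
      refine ⟨?_, Complex.exp_ne_zero w⟩
      rw [mem_ball_zero_iff, Complex.norm_exp]
      exact (Real.lt_log_iff_exp_lt hr).1 hw
  rw [h1]
  refine IsConnected.image ?_ _ Complex.continuous_exp.continuousOn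
  refine ⟨⟨((Real.log r - 1 : ℝ) : ℂ), by simp⟩, ?_⟩
  exact (convex_halfSpace_re_lt _).isPreconnected

lemma compl_conn : IsConnected ({0}ᶜ : Set ℂ) :=
  isConnected_compl_singleton_of_one_lt_rank (by simp [Complex.rank_real_complex]) 0

/-- Logarithmic derivative at a zero of finite order. -/
lemma logd_an {y : ℂ → ℂ} (hy : AnalyticAt ℂ y 0) (hne : ¬ ∀ᶠ z in 𝓝 (0:ℂ), y z = 0) :
    ∃ M : ℂ → ℂ, AnalyticAt ℂ M 0 ∧ ∀ᶠ z in 𝓝[≠] (0:ℂ), y z ≠ 0 ∧ z * deriv y z / y z = M z := by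
  obtain ⟨N, u, hu, hu0, huy⟩ := hy.exists_eventuallyEq_pow_smul_nonzero_iff.2 hne
  refine ⟨fun z => N + z * deriv u z / u z, ?_, ?_⟩
  · exact analyticAt_const.add ((analyticAt_id.mul hu.deriv).div hu hu0)
  · have h1 : ∀ᶠ z in 𝓝 (0:ℂ), deriv y z = deriv (fun z => (z - 0) ^ N • u z) z :=
      EventuallyEq.deriv huy
    have h2 : ∀ᶠ z in 𝓝 (0:ℂ), u z ≠ 0 := hu.continuousAt.eventually_ne hu0
    have h3 : ∀ᶠ z in 𝓝 (0:ℂ), AnalyticAt ℂ u z := hu.eventually_analyticAt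
    filter_upwards [nhdsWithin_le_nhds h1, nhdsWithin_le_nhds h2, nhdsWithin_le_nhds h3,
      nhdsWithin_le_nhds huy, self_mem_nhdsWithin] with z a1 a2 a3 a4 a5
    have a5 : z ≠ 0 := a5
    rw [a4]
    simp only [sub_zero, smul_eq_mul] at *
    refine ⟨mul_ne_zero (pow_ne_zero _ a5) a2, ?_⟩
    have hd : HasDerivAt (fun z => z ^ N * u z) ((N * z ^ (N - 1)) * u z + z ^ N * deriv u z) z :=
      (hasDerivAt_pow N z).mul a3.differentiableAt.hasDerivAt
    rw [a1, hd.deriv]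
    rcases Nat.eq_zero_or_pos N with h | h
    · subst h; simp
    · have : z ^ N = z * z ^ (N - 1) := by rw [← pow_succ']; congr 1; omega
      rw [this]
      have := pow_ne_zero (N - 1) a5
      field_simp

/-- Max principle on annuli: bounded on small circles implies a meromorphic log derivative. -/
lemma logd_punct {y : ℂ → ℂ} {δ C : ℝ} (hδ : 0 < δ)
    (hy : DifferentiableOn ℂ y (closedBall 0 δ \ {0})) (hyo : DifferentiableOn ℂ y (ball 0 δ \ {0}))
    (h0 : ∀ z ∈ closedBall 0 δ \ {0}, y z ≠ 0)
    (hC : ∀ r > 0, ∃ t, 0 < t ∧ t < r ∧ ∀ z ∈ sphere (0:ℂ) t, ‖y z‖ ≤ C) :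
    ∃ M : ℂ → ℂ, AnalyticAt ℂ M 0 ∧ ∀ᶠ z in 𝓝[≠] (0:ℂ), z * deriv y z / y z = M z := by
  have hsph : sphere (0:ℂ) δ ⊆ closedBall 0 δ \ {0} := by
    intro z hz
    refine ⟨sphere_subset_closedBall hz, ?_⟩
    rintro rfl
    simp at hz; linarith
  obtain ⟨C1, hC1⟩ := (isCompact_sphere (0:ℂ) δ).exists_bound_of_continuousOn
    (hy.continuousOn.mono hsph)
  have hbd : ∀ z ∈ ball (0:ℂ) δ \ {0}, ‖y z‖ ≤ max C C1 := by
    rintro z ⟨hz, hz0⟩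
    have hz0 : z ≠ 0 := hz0
    obtain ⟨t, ht, htz, htC⟩ := hC ‖z‖ (norm_pos_iff.2 hz0)
    rw [mem_ball_zero_iff] at hz
    set U : Set ℂ := ball 0 δ \ closedBall 0 t with hU
    have hUo : IsOpen U := isOpen_ball.sdiff isClosed_closedBall
    have hcl : closure U ⊆ closedBall 0 δ \ ball 0 t := by
      refine closure_minimal ?_ ?_
      · exact diff_subset_diff ball_subset_closedBall ball_subset_closedBall
      · exact isClosed_closedBall.sdiff isOpen_ball
    have hsub : closedBall (0:ℂ) δ \ ball 0 t ⊆ closedBall 0 δ \ {0} := by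
      refine diff_subset_diff_right ?_
      rintro _ rfl
      exact mem_ball_self ht
    have hd : DiffContOnCl ℂ y U :=
      ⟨hy.mono ((subset_closure.trans hcl).trans hsub), (hy.continuousOn).mono (hcl.trans hsub)⟩
    refine Complex.norm_le_of_forall_mem_frontier_norm_le (U := U)
      (isBounded_ball.subset diff_subset) hd ?_ (subset_closure ?_)
    · intro w hw
      rw [frontier, hUo.interior_eq] at hw
      obtain ⟨a1, a2⟩ := hcl hw.1
      have a3 := hw.2
      rw [mem_closedBall_zero_iff] at a1
      rw [mem_ball_zero_iff, not_lt] at a2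
      rw [hU, mem_diff, mem_ball_zero_iff, mem_closedBall_zero_iff, not_and_not_right] at a3
      rcases lt_or_eq_of_le a1 with a | a
      · exact (htC w (by rw [mem_sphere_zero_iff_norm]; exact le_antisymm (a3 a) a2)).trans
          (le_max_left _ _)
      · exact (hC1 w (by rw [mem_sphere_zero_iff_norm]; exact a)).trans (le_max_right _ _)
    · exact ⟨by rwa [mem_ball_zero_iff], by rw [mem_closedBall_zero_iff]; linarith⟩
  have hext := Complex.differentiableOn_update_limUnder_of_bddAbove (f := y) (c := 0)
    (ball_mem_nhds 0 hδ) hyo ⟨max C C1, by rintro _ ⟨z, hz, rfl⟩; exact hbd z hz⟩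
  set Y := Function.update y 0 (limUnder (𝓝[≠] 0) y) with hY
  have hYa : AnalyticAt ℂ Y 0 := hext.analyticAt (ball_mem_nhds 0 hδ)
  have hYy : ∀ z, z ≠ 0 → Y z = y z := fun z hz => by rw [hY, Function.update_of_ne hz]
  have hne : ¬ ∀ᶠ z in 𝓝 (0:ℂ), Y z = 0 := by
    intro h
    have h2 : ∀ᶠ z in 𝓝[≠] (0:ℂ), Y z = 0 ∧ z ∈ ball (0:ℂ) δ :=
      nhdsWithin_le_nhds (h.and (ball_mem_nhds 0 hδ))
    obtain ⟨z, ⟨hz1, hz2⟩, hz3⟩ := (h2.and self_mem_nhdsWithin).exists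
    rw [hYy z hz3] at hz1
    exact h0 z ⟨ball_subset_closedBall hz2, hz3⟩ hz1
  obtain ⟨M, hM, hMy⟩ := logd_an hYa hne
  refine ⟨M, hM, ?_⟩
  filter_upwards [hMy, self_mem_nhdsWithin] with z hz hz0
  have hz0 : z ≠ 0 := hz0
  have hev : Y =ᶠ[𝓝 z] y := by
    filter_upwards [isOpen_ne.mem_nhds hz0] with w hw using hYy w hw
  rw [← hz.2, hev.deriv_eq, hYy z hz0]

end NF

namespace NF

lemma hasD {g : ℂ → ℂ} (hg : Differentiable ℂ g) (k : ℕ) (z : ℂ) :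
    HasDerivAt (iteratedDeriv k g) (iteratedDeriv (k + 1) g z) z := by
  rw [iteratedDeriv_succ]
  exact (iterDeriv_diff hg k z).hasDerivAt

lemma ode_iter {g : ℂ → ℂ} {κ : ℂ} (hg : Differentiable ℂ g)
    (h : ∀ z, z ^ 3 * iteratedDeriv 3 g z = κ * (z * iteratedDeriv 1 g z - iteratedDeriv 0 g z)) (k : ℕ) :
    ∀ z, z ^ 3 * iteratedDeriv (k + 3) g z + 3 * k * z ^ 2 * iteratedDeriv (k + 2) g z
      + 3 * k * (k - 1) * z * iteratedDeriv (k + 1) g z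
      + k * (k - 1) * (k - 2) * iteratedDeriv k g z
      = κ * (z * iteratedDeriv (k + 1) g z + (k - 1) * iteratedDeriv k g z) := by
  induction k with
  | zero =>
    intro z
    have := h z
    simp only [Nat.zero_add, Nat.cast_zero]
    rw [this]; ring
  | succ k ih =>
    intro z
    have d0 := hasD hg k z
    have d1 := hasD hg (k + 1) z
    have d2 := hasD hg (k + 2) z
    have d3 := hasD hg (k + 3) z
    have hz := hasDerivAt_id z
    have hz2 := hasDerivAt_pow 2 z
    have hz3 := hasDerivAt_pow 3 z
    have L := ((((hz3.fun_mul d3).fun_add ((hz2.const_mul (3 * (k:ℂ))).fun_mul d2)).fun_add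
      ((hz.const_mul (3 * (k:ℂ) * (k - 1))).fun_mul d1)).fun_add
      (d0.const_mul ((k:ℂ) * (k - 1) * (k - 2))))
    have Rr := ((hz.fun_mul d1).fun_add (d0.const_mul ((k:ℂ) - 1))).const_mul κ
    have e : (fun z => z ^ 3 * iteratedDeriv (k + 3) g z + 3 * k * z ^ 2 * iteratedDeriv (k + 2) g z
      + 3 * k * (k - 1) * z * iteratedDeriv (k + 1) g z
      + k * (k - 1) * (k - 2) * iteratedDeriv k g z) =
      fun z => κ * (z * iteratedDeriv (k + 1) g z + (k - 1) * iteratedDeriv k g z) := funext ih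
    have L2 := (congrArg (fun F => deriv F z) e)
    have L3 := L.deriv
    have L4 := Rr.deriv
    simp only [id] at L3 L4 L2
    rw [L3, L4] at L2
    push_cast at L2 ⊢
    rw [show k + 1 + 3 = k + 3 + 1 by ring, show k + 1 + 2 = k + 3 by ring] 
    simp only [add_assoc] at L2 ⊢
    norm_num at L2 ⊢
    linear_combination L2

lemma euler_ode {g : ℂ → ℂ} {κ b0 : ℂ} (hg : Differentiable ℂ g) (hb0 : b0 ≠ 0)
    (hT : ∀ z, z ^ 2 * (2 * g z * iteratedDeriv 2 g z - deriv g z ^ 2) = κ * g z ^ 2)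
    (h0 : g 1 = 0) (h1 : deriv g 1 = 0) (h2 : iteratedDeriv 2 g 1 = b0) :
    ∀ z, g z = b0 / 2 * (z - 1) ^ 2 := by
  have hne : ¬ ∀ z, g z = 0 := by
    intro h
    have : g = fun _ => 0 := funext h
    rw [this] at h2
    simp at h2
    exact hb0 h2.symm
  have hode : ∀ z, z ^ 3 * iteratedDeriv 3 g z
      = κ * (z * iteratedDeriv 1 g z - iteratedDeriv 0 g z) := by
    set E : ℂ → ℂ := fun z => z ^ 3 * iteratedDeriv 3 g z
      - κ * (z * iteratedDeriv 1 g z - iteratedDeriv 0 g z) with hE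
    have hEd : Differentiable ℂ E := by
      have := iterDeriv_diff hg 3
      have := iterDeriv_diff hg 1
      have := iterDeriv_diff hg 0
      fun_prop
    have hgE : ∀ z, g z * E z = 0 := by
      intro z
      have d0 := hasD hg 0 z
      have d1 := hasD hg 1 z
      have d2 := hasD hg 2 z
      have L := (hasDerivAt_pow 2 z).fun_mul
        (((d0.const_mul 2).fun_mul d2).fun_sub (d1.fun_pow 2))
      have Rr := (d0.fun_pow 2).const_mul κ
      have e : (fun z => z ^ 2 * (2 * iteratedDeriv 0 g z * iteratedDeriv 2 g z -
          iteratedDeriv 1 g z ^ 2)) = fun z => κ * iteratedDeriv 0 g z ^ 2 := by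
        funext z
        rw [iteratedDeriv_zero, iteratedDeriv_one]; exact hT z
      have L2 := (congrArg (fun F => deriv F z) e)
      rw [L.deriv, Rr.deriv] at L2
      have e2 := congrFun e z
      norm_num at L2
      simp only [hE]
      rw [iteratedDeriv_zero] at *
      rw [iteratedDeriv_one] at *
      linear_combination (z / 2) * L2 - e2
    by_contra hcon
    push Not at hcon
    obtain ⟨a, ha⟩ := hcon
    have hEa : E a ≠ 0 := sub_ne_zero.2 ha
    have h3 : ∀ᶠ z in 𝓝 a, g z = 0 := by
      filter_upwards [hEd.continuous.continuousAt.eventually_ne hEa] with z hz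
      exact (mul_eq_zero.1 (hgE z)).resolve_right hz
    exact hne fun z => ident isOpen_univ isPreconnected_univ hg.differentiableOn (mem_univ a) h3 z
      (mem_univ z)
  have hk : ∀ k : ℕ, ((k:ℂ) - 1) * (k * (k - 2) - κ) * iteratedDeriv k g 0 = 0 := by
    intro k
    have := ode_iter hg hode k 0
    norm_num at this
    linear_combination this
  by_cases hκ : κ = 0
  · have h3 : ∀ z, iteratedDeriv 3 g z = 0 := by
      have : ∀ z, z ^ 3 * iteratedDeriv 3 g z = 0 := fun z => by rw [hode z, hκ, zero_mul]
      have hev : ∀ᶠ z in 𝓝 (1:ℂ), iteratedDeriv 3 g z = 0 := by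
        filter_upwards [isOpen_ne.mem_nhds (one_ne_zero : (1:ℂ) ≠ 0)] with z hz
        exact (mul_eq_zero.1 (this z)).resolve_left (pow_ne_zero _ hz)
      exact fun z => ident isOpen_univ isPreconnected_univ (iterDeriv_diff hg 3).differentiableOn
        (mem_univ 1) hev z (mem_univ z)
    have h2' : ∀ z, iteratedDeriv 2 g z = b0 := by
      intro z
      rw [← h2]
      exact is_const_of_deriv_eq_zero (iterDeriv_diff hg 2)
        (fun z => by rw [← iteratedDeriv_succ]; exact h3 z) z 1
    have h1' : ∀ z, iteratedDeriv 1 g z = b0 * (z - 1) := by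
      intro z
      have hd : ∀ z, HasDerivAt (fun z => iteratedDeriv 1 g z - b0 * (z - 1)) 0 z := by
        intro z
        have := (hasD hg 1 z).fun_sub (((hasDerivAt_id z).sub_const 1).const_mul b0)
        refine this.congr_deriv ?_
        rw [h2' z]; ring
      have := is_const_of_deriv_eq_zero (fun z => (hd z).differentiableAt) (fun z => (hd z).deriv) z 1
      simp only [iteratedDeriv_one, h1, sub_self, mul_zero] at this ⊢
      linear_combination this
    intro z
    have hd : ∀ z, HasDerivAt (fun z => iteratedDeriv 0 g z - b0 / 2 * (z - 1) ^ 2) 0 z := by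
      intro z
      have := (hasD hg 0 z).fun_sub ((((hasDerivAt_id z).sub_const 1).fun_pow 2).const_mul (b0 / 2))
      refine this.congr_deriv ?_
      rw [zero_add, h1' z]; simp; ring
    have := is_const_of_deriv_eq_zero (fun z => (hd z).differentiableAt) (fun z => (hd z).deriv) z 1
    simp only [iteratedDeriv_zero, h0, sub_self] at this ⊢
    norm_num at this
    linear_combination this
  · exfalso
    obtain ⟨k0, hk1, hk0⟩ : ∃ k0 : ℕ, k0 ≠ 1 ∧ ∀ k : ℕ, k ≠ 1 → k ≠ k0 → iteratedDeriv k g 0 = 0 := by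
      by_cases hex : ∃ k0 : ℕ, k0 ≠ 1 ∧ (k0:ℂ) * (k0 - 2) = κ
      · obtain ⟨k0, hk01, hk0⟩ := hex
        refine ⟨k0, hk01, fun k hk1 hkk => ?_⟩
        have := hk k
        refine (mul_eq_zero.1 this).resolve_left ?_
        refine mul_ne_zero (sub_ne_zero.2 (by exact_mod_cast hk1)) (sub_ne_zero.2 ?_)
        intro hkκ
        have h4 : ((k:ℂ) - k0) * (k + k0 - 2) = 0 := by linear_combination hkκ - hk0
        rcases mul_eq_zero.1 h4 with h5 | h5
        · exact hkk (by exact_mod_cast sub_eq_zero.1 h5)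
        · have h6 : k + k0 = 2 := by exact_mod_cast sub_eq_zero.1 h5
          have : k = 0 ∨ k = 2 := by omega
          rcases this with h7 | h7
          · rw [h7] at hkκ; norm_num at hkκ; exact hκ hkκ.symm
          · rw [h7] at hkκ; norm_num at hkκ; exact hκ hkκ.symm
      · refine ⟨0, by norm_num, fun k hk1 _ => ?_⟩
        have := hk k
        refine (mul_eq_zero.1 this).resolve_left ?_
        refine mul_ne_zero (sub_ne_zero.2 (by exact_mod_cast hk1)) (sub_ne_zero.2 ?_)
        intro hkκ
        exact hex ⟨k, hk1, hkκ⟩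
    obtain ⟨β, γ, hform⟩ : ∃ β γ : ℂ, ∀ z, g z = β * z + γ * z ^ k0 := by
      refine ⟨iteratedDeriv 1 g 0, ((k0.factorial : ℂ))⁻¹ * iteratedDeriv k0 g 0, fun z => ?_⟩
      have hs := Complex.hasSum_taylorSeries_of_entire hg 0 z
      have hz : ∀ n ∉ ({1, k0} : Finset ℕ),
          ((n.factorial : ℂ))⁻¹ • (z - 0) ^ n • iteratedDeriv n g 0 = 0 := by
        intro n hn
        simp only [Finset.mem_insert, Finset.mem_singleton, not_or] at hn
        simp [hk0 n hn.1 hn.2]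
      have hs2 := hasSum_sum_of_ne_finset_zero (L := SummationFilter.unconditional ℕ) hz
      rw [hs.unique hs2, Finset.sum_pair hk1.symm]
      simp
      ring
    have hgf : g = fun z => β * z + γ * z ^ k0 := funext hform
    have hd : HasDerivAt g (β * 1 + γ * (k0 * 1 ^ (k0 - 1))) 1 := by
      rw [hgf]
      exact ((hasDerivAt_id (1:ℂ)).const_mul β).fun_add ((hasDerivAt_pow k0 (1:ℂ)).const_mul γ)
    have e1 := hd.deriv
    rw [h1] at e1
    have e0 := hform 1
    rw [h0] at e0
    simp only [one_pow, mul_one] at e0 e1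
    have e2 : γ * ((k0:ℂ) - 1) = 0 := by linear_combination e0 - e1
    have hk1' : (k0:ℂ) - 1 ≠ 0 := sub_ne_zero.2 (by exact_mod_cast hk1)
    have hγ : γ = 0 := (mul_eq_zero.1 e2).resolve_right hk1'
    have hβ : β = 0 := by rw [hγ] at e0; simpa using e0.symm
    exact hne fun z => by rw [hform z, hγ, hβ]; ring

end NF

namespace NF

/-- The quotient `z² T / g²`. -/
noncomputable def QQ (g : ℂ → ℂ) (z : ℂ) : ℂ :=
  z ^ 2 * ((2 * g z * iteratedDeriv 2 g z - deriv g z ^ 2) / g z ^ 2)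

lemma QQ_formula {g P : ℂ → ℂ} {z : ℂ} (hg : Differentiable ℂ g) (hz : z ≠ 0) (hgz : g z ≠ 0)
    (hP : ∀ᶠ w in 𝓝 z, w * deriv g w / g w = P w) :
    QQ g z = 2 * z * deriv P z - 2 * P z + P z ^ 2 := by
  have d0 : HasDerivAt g (deriv g z) z := (hg z).hasDerivAt
  have d1 := hasD hg 1 z
  rw [iteratedDeriv_one] at d1
  have hd := (((hasDerivAt_id z).fun_mul d1).fun_div d0 hgz).deriv
  have h1 : deriv P z = deriv (fun w => w * deriv g w / g w) z := (EventuallyEq.deriv_eq hP).symm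
  simp only [id] at hd
  rw [h1, hd, ← hP.self_of_nhds, QQ]
  field_simp
  ring

lemma QQ_zero {g : ℂ → ℂ} (hg : Differentiable ℂ g) (hne : ¬ ∀ᶠ z in 𝓝 (0:ℂ), g z = 0) :
    ∃ N : ℂ → ℂ, AnalyticAt ℂ N 0 ∧ ∀ᶠ z in 𝓝[≠] (0:ℂ), QQ g z = N z := by
  obtain ⟨M, hM, hMg⟩ := logd_an (hg.analyticAt 0) hne
  refine ⟨fun z => 2 * z * deriv M z - 2 * M z + M z ^ 2, ?_, ?_⟩
  · have := hM.deriv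
    fun_prop
  · filter_upwards [eventually_eventually_nhdsWithin.2 hMg, hMg, self_mem_nhdsWithin] with z h1 h2 h3
    have h3' : z ≠ 0 := h3
    rw [isOpen_compl_singleton.nhdsWithin_eq h3] at h1
    exact QQ_formula hg h3' h2.1 (h1.mono fun w hw => hw.2)

lemma QQ_bdd {g M : ℂ → ℂ} (hg : Differentiable ℂ g) (hM : AnalyticAt ℂ M 0)
    (hMg : ∀ᶠ z in 𝓝[≠] (0:ℂ), g z⁻¹ ≠ 0 ∧ z⁻¹ * deriv g z⁻¹ / g z⁻¹ = M z) :
    ∃ C R : ℝ, ∀ z, R ≤ ‖z‖ → ‖QQ g z‖ ≤ C := by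
  have c1 : ∀ᶠ z in 𝓝 (0:ℂ), ‖M z‖ ≤ ‖M 0‖ + 1 :=
    (hM.continuousAt.norm.eventually_lt continuousAt_const (by simp)).mono fun z h => le_of_lt h
  have c2 : ∀ᶠ z in 𝓝 (0:ℂ), ‖deriv M z‖ ≤ ‖deriv M 0‖ + 1 :=
    (hM.deriv.continuousAt.norm.eventually_lt continuousAt_const (by simp)).mono fun z h => le_of_lt h
  have c3 := hM.eventually_analyticAt
  have hall := (nhdsWithin_le_nhds (s := {0}ᶜ) (c1.and (c2.and c3)))
  have hall2 := (hMg.and hall)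
  rw [eventually_nhdsWithin_iff, Metric.eventually_nhds_iff_ball] at hall2
  obtain ⟨ε, hε, hεb⟩ := hall2
  set C1 := ‖M 0‖ + 1
  set C2 := ‖deriv M 0‖ + 1
  refine ⟨2 * (C2 * ε) + 2 * C1 + C1 ^ 2, 1 / ε + 1, fun z hz => ?_⟩
  have hεp : 0 < 1 / ε := by positivity
  have hz0 : z ≠ 0 := by rw [← norm_pos_iff]; linarith
  have hin : ∀ w : ℂ, 1 / ε < ‖w‖ → w⁻¹ ∈ ball (0:ℂ) ε := by
    intro w hw
    rw [mem_ball_zero_iff, norm_inv]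
    have hwp : 0 < ‖w‖ := by linarith
    rw [inv_lt_comm₀ hwp hε, ← one_div]; exact hw
  have hzb := hin z (by linarith)
  obtain ⟨⟨a1, a2⟩, a3, a4, a5⟩ := hεb z⁻¹ hzb (inv_ne_zero hz0)
  rw [inv_inv] at a1
  have hP : ∀ᶠ w in 𝓝 z, w * deriv g w / g w = (fun w => M w⁻¹) w := by
    have : ∀ᶠ w in 𝓝 z, 1 / ε < ‖w‖ :=
      continuousAt_const.eventually_lt continuous_norm.continuousAt (by linarith)
    filter_upwards [this] with w hw
    have hw0 : w ≠ 0 := by rw [← norm_pos_iff]; linarith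
    have := (hεb w⁻¹ (hin w hw) (inv_ne_zero hw0)).1.2
    rw [inv_inv] at this
    exact this
  have hd : HasDerivAt (fun w => M w⁻¹) (deriv M z⁻¹ * (-(z ^ 2)⁻¹)) z :=
    a5.differentiableAt.hasDerivAt.comp z (hasDerivAt_inv hz0)
  rw [QQ_formula hg hz0 a1 hP, hd.deriv]
  have e : 2 * z * (deriv M z⁻¹ * (-(z ^ 2)⁻¹)) = - (2 * (deriv M z⁻¹ * z⁻¹)) := by
    field_simp
  rw [e]
  rw [mem_ball_zero_iff] at hzb
  calc ‖-(2 * (deriv M z⁻¹ * z⁻¹)) - 2 * M z⁻¹ + M z⁻¹ ^ 2‖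
      ≤ ‖-(2 * (deriv M z⁻¹ * z⁻¹))‖ + ‖2 * M z⁻¹‖ + ‖M z⁻¹ ^ 2‖ :=
        (norm_add_le _ _).trans (add_le_add_left (norm_sub_le _ _) _)
    _ = 2 * (‖deriv M z⁻¹‖ * ‖z⁻¹‖) + 2 * ‖M z⁻¹‖ + ‖M z⁻¹‖ ^ 2 := by
        rw [norm_neg, norm_mul, norm_mul, norm_mul, norm_pow]; simp
    _ ≤ _ := by gcongr

/-- Growth on circles. -/
lemma circ {s : ℕ} (hs : 2 ≤ s) (hse : Even s) {g : ℂ → ℂ} {b0 : ℂ} {m : ℕ} (hb0 : b0 ≠ 0)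
    (hg : Differentiable ℂ g) (hgood : Good s g (fun z => b0 * z ^ m) {0}ᶜ) :
    ∃ C : ℝ, (∀ r > 0, ∃ t, 0 < t ∧ t < r ∧ ∀ z ∈ sphere (0:ℂ) t, ‖z ^ (m + 2) * g z⁻¹‖ ≤ C) ∨
      (∀ r > 0, ∃ t, 0 < t ∧ t < r ∧ ∀ z ∈ sphere (0:ℂ) t, ‖(z ^ (m + 2) * g z⁻¹)⁻¹‖ ≤ C) := by
  set f : ℕ → ℂ → ℂ := fun n ζ => (((n:ℂ) + 1)⁻¹) ^ (m + 2) * g (0 + ((n:ℂ) + 1) * ζ) with hf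
  have hn0 : ∀ n : ℕ, (n:ℂ) + 1 ≠ 0 := fun n => by exact_mod_cast Nat.succ_ne_zero n
  have hfg : ∀ n, Good s (f n) (fun ζ => b0 * ζ ^ m) {0}ᶜ := by
    intro n
    have := hgood.scale (c := (((n:ℂ) + 1)⁻¹) ^ (m + 2)) (ρ := (n:ℂ) + 1) 0
      (pow_ne_zero _ (inv_ne_zero (hn0 n))) (hn0 n)
    have e1 : (fun ζ : ℂ => (((n:ℂ) + 1)⁻¹) ^ (m + 2) * ((n:ℂ) + 1) ^ 2 * (b0 * (0 + ((n:ℂ) + 1) * ζ) ^ m))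
        = fun ζ => b0 * ζ ^ m := by
      funext ζ
      have := hn0 n
      rw [zero_add, mul_pow, inv_pow, pow_add]
      field_simp
    rw [e1] at this
    refine this.mono ?_
    intro ζ hζ
    have hζ : ζ ≠ 0 := hζ
    show 0 + ((n:ℂ) + 1) * ζ ≠ 0
    rw [zero_add]
    exact mul_ne_zero (hn0 n) hζ
  have hN : ∀ z ∈ ({0}ᶜ : Set ℂ), NormAt f z := by
    intro z hz
    have hz : z ≠ 0 := hz
    have hzp : 0 < ‖z‖ := norm_pos_iff.2 hz
    have hb : ∀ w ∈ ball z (‖z‖), w ≠ 0 := by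
      rintro w hw rfl
      rw [mem_ball, dist_zero_left] at hw
      exact lt_irrefl _ hw
    refine local_normal (hn := fun _ ζ => b0 * ζ ^ m) (h := fun ζ => b0 * ζ ^ m)
      (A := ‖b0‖ * (2 * ‖z‖) ^ m) hs hse hzp ?_ ?_ ?_ ?_ ?_ ?_
    · exact Eventually.of_forall fun n => (hfg n).mono fun w hw => hb w hw
    · exact Eventually.of_forall fun n => by fun_prop
    · exact Eventually.of_forall fun n w hw => mul_ne_zero hb0 (pow_ne_zero _ (hb w hw))
    · intro u hu
      exact Eventually.of_forall fun n w hw => refl_mem_uniformity hu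
    · exact fun w hw => mul_ne_zero hb0 (pow_ne_zero _ (hb w hw))
    · intro w hw
      rw [norm_mul, norm_pow]
      rw [mem_ball, dist_eq_norm] at hw
      have := norm_le_norm_add_norm_sub' w z
      gcongr
      linarith
  obtain ⟨φ, hφ, hcase⟩ := glue isOpen_compl_singleton compl_conn hN
  have hsph : sphere (0:ℂ) 1 ⊆ {0}ᶜ := by
    intro z hz
    rw [mem_sphere_zero_iff_norm] at hz
    have : z ≠ 0 := by rw [← norm_pos_iff]; linarith
    exact this
  -- relation
  have hrel : ∀ n : ℕ, ∀ z ∈ sphere (0:ℂ) (1 / ((n:ℝ) + 1)),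
      ∃ ζ ∈ sphere (0:ℂ) 1, ‖z ^ (m + 2) * g z⁻¹‖ = ‖f n ζ‖ := by
    intro n z hz
    rw [mem_sphere_zero_iff_norm] at hz
    have hnp : (0:ℝ) < (n:ℝ) + 1 := by positivity
    have hnn : ‖(n:ℂ) + 1‖ = (n:ℝ) + 1 := by
      have : ((n:ℂ) + 1) = (((n:ℝ) + 1 : ℝ) : ℂ) := by push_cast; rfl
      rw [this, Complex.norm_real, Real.norm_of_nonneg hnp.le]
    refine ⟨((n:ℂ) + 1)⁻¹ * z⁻¹, ?_, ?_⟩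
    · rw [mem_sphere_zero_iff_norm, norm_mul, norm_inv, norm_inv, hz, hnn]
      field_simp
    · simp only [hf]
      rw [zero_add, ← mul_assoc, mul_inv_cancel₀ (hn0 n), one_mul, norm_mul, norm_mul, norm_pow,
        norm_pow, hz, norm_inv, hnn, one_div]
  have hsmall : ∀ r > 0, ∀ᶠ n : ℕ in map φ atTop, 1 / ((n:ℝ) + 1) < r := by
    intro r hr
    have := (tendsto_one_div_add_atTop_nhds_zero_nat (𝕜 := ℝ)).comp hφ.tendsto_atTop
    exact this.eventually (gt_mem_nhds hr)
  rcases hcase with ⟨G, hG⟩ | hinf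
  · have hu := (tendstoLocallyUniformlyOn_iff_forall_isCompact isOpen_compl_singleton).1 hG _ hsph
      (isCompact_sphere 0 1)
    have hGd := hG.differentiableOn (Eventually.of_forall fun n => (hfg n).1) isOpen_compl_singleton
    obtain ⟨C, hC⟩ := (isCompact_sphere (0:ℂ) 1).exists_bound_of_continuousOn
      (hGd.continuousOn.mono hsph)
    refine ⟨C + 1, Or.inl fun r hr => ?_⟩
    obtain ⟨n, h1, h2⟩ := ((Metric.tendstoUniformlyOn_iff.1 hu 1 one_pos).and (hsmall r hr)).exists
    refine ⟨1 / ((n:ℝ) + 1), by positivity, h2, fun z hz => ?_⟩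
    obtain ⟨ζ, hζ, he⟩ := hrel n z hz
    rw [he]
    have a := h1 ζ hζ
    rw [dist_comm, dist_eq_norm] at a
    have := norm_le_norm_add_norm_sub' (f n ζ) (G ζ)
    linarith [hC ζ hζ]
  · refine ⟨1, Or.inr fun r hr => ?_⟩
    obtain ⟨n, h1, h2⟩ := ((hinf _ hsph (isCompact_sphere 0 1) 1).and (hsmall r hr)).exists
    refine ⟨1 / ((n:ℝ) + 1), by positivity, h2, fun z hz => ?_⟩
    obtain ⟨ζ, hζ, he⟩ := hrel n z hz
    rw [norm_inv, he]
    exact inv_le_one_of_one_le₀ (h1 ζ hζ)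

lemma entire_class {s : ℕ} (hs : 2 ≤ s) (hse : Even s) {g : ℂ → ℂ} {b0 : ℂ} {m : ℕ} (hb0 : b0 ≠ 0)
    (hg : Differentiable ℂ g) (hgood : Good s g (fun z => b0 * z ^ m) {0}ᶜ) (h1 : g 1 = 0)
    (hz : ∀ z, 1 < ‖z‖ → g z ≠ 0) : ∀ z, g z = b0 / 2 * (z - 1) ^ 2 := by
  have hne : ∀ a, ¬ ∀ᶠ z in 𝓝 a, g z = 0 := by
    intro a h
    refine hz 2 (by norm_num) ?_
    exact ident isOpen_univ isPreconnected_univ hg.differentiableOn (mem_univ a) h 2 (mem_univ 2)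
  -- behaviour at infinity
  set y : ℂ → ℂ := fun z => z ^ (m + 2) * g z⁻¹ with hy
  have hzi : ∀ z ∈ closedBall (0:ℂ) (1/2) \ {0}, g z⁻¹ ≠ 0 := by
    rintro z ⟨hz1, hz2⟩
    have hz2 : z ≠ 0 := hz2
    rw [mem_closedBall_zero_iff] at hz1
    apply hz
    rw [norm_inv]
    exact (one_lt_inv₀ (norm_pos_iff.2 hz2)).2 (by linarith)
  have hyne : ∀ z ∈ closedBall (0:ℂ) (1/2) \ {0}, y z ≠ 0 := fun z hz =>
    mul_ne_zero (pow_ne_zero _ hz.2) (hzi z hz)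
  have hydA : ∀ z : ℂ, z ≠ 0 → HasDerivAt y (((m + 2 : ℕ) : ℂ) * z ^ (m + 1) * g z⁻¹ +
      z ^ (m + 2) * (deriv g z⁻¹ * (-(z ^ 2)⁻¹))) z := by
    intro z hz
    exact (hasDerivAt_pow (m + 2) z).fun_mul ((hg z⁻¹).hasDerivAt.comp z (hasDerivAt_inv hz))
  have hyd : DifferentiableOn ℂ y {0}ᶜ := fun z hz =>
    (hydA z hz).differentiableAt.differentiableWithinAt
  have hpd : ∀ z ∈ closedBall (0:ℂ) (1/2) \ {0},
      z * deriv y z / y z = (m + 2 : ℕ) - z⁻¹ * deriv g z⁻¹ / g z⁻¹ := by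
    intro z hz'
    have h3 := hzi z hz'
    have h4 : z ≠ 0 := hz'.2
    rw [(hydA z h4).deriv, hy]
    have e1 : z ^ (m + 1) = z * z ^ m := by ring
    have e2 : z ^ (m + 2) = z ^ 2 * z ^ m := by ring
    simp only [e1, e2]
    have := pow_ne_zero m h4
    generalize g z⁻¹ = A at *
    generalize deriv g z⁻¹ = B at *
    generalize ((m + 2 : ℕ) : ℂ) = k at *
    field_simp
    ring
  have hevin : ∀ᶠ z in 𝓝[≠] (0:ℂ), z ∈ closedBall (0:ℂ) (1/2) \ {0} := by
    filter_upwards [nhdsWithin_le_nhds (closedBall_mem_nhds (0:ℂ) (by norm_num : (0:ℝ) < 1/2)),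
      self_mem_nhdsWithin] with z a b using ⟨a, b⟩
  have hM : ∃ M : ℂ → ℂ, AnalyticAt ℂ M 0 ∧
      ∀ᶠ z in 𝓝[≠] (0:ℂ), g z⁻¹ ≠ 0 ∧ z⁻¹ * deriv g z⁻¹ / g z⁻¹ = M z := by
    obtain ⟨C, hC | hC⟩ := circ hs hse hb0 hg hgood
    · obtain ⟨M, hM, hMy⟩ := logd_punct (y := y) (δ := 1/2) (C := C) (by norm_num)
        (hyd.mono fun z hz => hz.2) (hyd.mono fun z hz => hz.2) hyne hC
      refine ⟨fun z => (m + 2 : ℕ) - M z, analyticAt_const.sub hM, ?_⟩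
      filter_upwards [hMy, hevin] with z a b
      refine ⟨hzi z b, ?_⟩
      rw [← a, hpd z b]; ring
    · have hyd' : DifferentiableOn ℂ (fun z => (y z)⁻¹) (closedBall 0 (1/2) \ {0}) :=
        (hyd.mono fun z hz => hz.2).fun_inv hyne
      obtain ⟨M, hM, hMy⟩ := logd_punct (y := fun z => (y z)⁻¹) (δ := 1/2) (C := C) (by norm_num)
        hyd' (hyd'.mono fun z hz => ⟨ball_subset_closedBall hz.1, hz.2⟩)
        (fun z hz => inv_ne_zero (hyne z hz)) hC
      refine ⟨fun z => (m + 2 : ℕ) + M z, analyticAt_const.add hM, ?_⟩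
      filter_upwards [hMy, hevin] with z a b
      refine ⟨hzi z b, ?_⟩
      have hd := ((hydA z b.2).differentiableAt.hasDerivAt.fun_inv (hyne z b)).deriv
      have e : z * deriv (fun z => (y z)⁻¹) z / (y z)⁻¹ = - (z * deriv y z / y z) := by
        rw [hd]
        have := hyne z b
        field_simp
      rw [← a, e, hpd z b]; ring
  obtain ⟨M, hMa, hMg⟩ := hM
  obtain ⟨C, R, hCR⟩ := QQ_bdd hg hMa hMg
  -- extension
  have hcont : ∀ a, g a ≠ 0 → AnalyticAt ℂ (QQ g) a := by
    intro a ha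
    have i1 := hg.analyticAt a
    have i2 := (iterDeriv_diff hg 2).analyticAt a
    have i3 := i1.deriv
    unfold QQ
    exact (analyticAt_id.pow 2).mul (((((analyticAt_const.mul i1)).mul i2).sub (i3.pow 2)).div
      (i1.pow 2) (pow_ne_zero _ ha))
  obtain ⟨Q, hQ, hQF⟩ := ext_removable (F := QQ g) (by
    intro a
    by_cases ha0 : a = 0
    · subst ha0; exact QQ_zero hg (hne 0)
    by_cases ha : g a = 0
    · obtain ⟨c1, c2, c3⟩ := hgood.2.1 a ha0 ha
      obtain ⟨N, hN, hN2⟩ := quot_local (h0 := b0 * a ^ m) (mul_ne_zero hb0 (pow_ne_zero _ ha0)) hg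
        ha c1 c2 c3
      refine ⟨fun z => z ^ 2 * N z, (analyticAt_id.pow 2).mul hN, ?_⟩
      filter_upwards [hN2] with z hz
      rw [QQ, hz]
    · exact ⟨QQ g, hcont a ha, Eventually.of_forall fun z => rfl⟩)
  have hQc : ∀ z w, Q z = Q w := by
    intro z w
    refine hQ.apply_eq_apply_of_bounded ?_ z w
    obtain ⟨C2, hC2⟩ := (isCompact_closedBall (0:ℂ) (max R 2)).exists_bound_of_continuousOn
      hQ.continuous.continuousOn
    rw [isBounded_iff_forall_norm_le]
    refine ⟨max C C2, ?_⟩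
    rintro _ ⟨z, rfl⟩
    rcases le_or_gt ‖z‖ (max R 2) with h | h
    · exact (hC2 z (by rwa [mem_closedBall_zero_iff])).trans (le_max_right _ _)
    · have h2 : 1 < ‖z‖ := by linarith [le_max_right R 2]
      have h3 : R ≤ ‖z‖ := by linarith [le_max_left R 2]
      rw [hQF z (hcont z (hz z h2)).continuousAt]
      exact (hCR z h3).trans (le_max_left _ _)
  obtain ⟨c1, c2, c3⟩ := hgood.2.1 1 (by simp) h1
  refine euler_ode (κ := Q 0) hg hb0 ?_ h1 c1 (by simpa using c2)
  -- identity
  have hid : ∀ z, g z ≠ 0 → z ^ 2 * (2 * g z * iteratedDeriv 2 g z - deriv g z ^ 2) = Q 0 * g z ^ 2 := by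
    intro z hgz
    rw [hQc 0 z, hQF z (hcont z hgz).continuousAt, QQ]
    field_simp
  intro z
  by_cases hgz : g z = 0
  · by_cases hz0 : z = 0
    · rw [hgz, hz0]; simp
    · rw [hgz, (hgood.2.1 z hz0 hgz).1]; simp
  · exact hid z hgz

end NF

namespace NF

lemma no_small_zeros {s : ℕ} (hs : 2 ≤ s) (hse : Even s) {F : ℕ → ℂ → ℂ} {b : ℂ → ℂ} {m : ℕ}
    (hm : 1 ≤ m) {r δ : ℝ} (hδ : 0 < δ) (hδr : δ < r)
    (hgood : ∀ n, Good s (F n) (fun z => z ^ m * b z) (ball 0 r))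
    (hbd : DifferentiableOn ℂ b (ball 0 r)) (hb : ∀ z ∈ ball (0:ℂ) r, b z ≠ 0)
    (hf0 : ∀ n, F n 0 ≠ 0)
    (hinf : ∀ K ⊆ ball (0:ℂ) r \ {0}, IsCompact K → ∀ M : ℝ, ∀ᶠ n in atTop, ∀ z ∈ K, M ≤ ‖F n z‖)
    (hzero : ∀ n, ∃ z ∈ closedBall (0:ℂ) δ, F n z = 0) : False := by
  have hr : 0 < r := hδ.trans hδr
  have hcb : closedBall (0:ℂ) δ ⊆ ball 0 r := closedBall_subset_ball hδr
  have hFc : ∀ n, ContinuousOn (F n) (closedBall 0 δ) := fun n => (hgood n).1.continuousOn.mono hcb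
  -- zero of largest modulus
  have hmax : ∀ n, ∃ w ∈ closedBall (0:ℂ) δ, F n w = 0 ∧
      ∀ z ∈ closedBall (0:ℂ) δ, F n z = 0 → ‖z‖ ≤ ‖w‖ := by
    intro n
    have hcl : IsCompact (closedBall (0:ℂ) δ ∩ F n ⁻¹' {0}) := by
      refine (isCompact_closedBall (0:ℂ) δ).of_isClosed_subset
        ((hFc n).preimage_isClosed_of_isClosed isClosed_closedBall isClosed_singleton) inter_subset_left
    obtain ⟨z, hz, hz0⟩ := hzero n
    obtain ⟨w, hw, hwm⟩ := hcl.exists_isMaxOn ⟨z, hz, hz0⟩ continuous_norm.continuousOn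
    exact ⟨w, hw.1, hw.2, fun z hz hz0 => hwm (show z ∈ _ from ⟨hz, hz0⟩)⟩
  choose w hwδ hw0 hwmax using hmax
  have hwne : ∀ n, w n ≠ 0 := fun n h => hf0 n (h ▸ hw0 n)
  have hwlim : Tendsto (fun n => ‖w n‖) atTop (𝓝 0) := by
    rw [Metric.tendsto_atTop']
    intro ε hε
    have hK := hinf (closedBall 0 δ \ ball 0 ε) (by
      rintro z ⟨h1, h2⟩
      refine ⟨hcb h1, ?_⟩
      rintro rfl
      exact h2 (mem_ball_self hε)) ((isCompact_closedBall (0:ℂ) δ).diff isOpen_ball) 1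
    obtain ⟨N, hN⟩ := eventually_atTop.1 hK
    refine ⟨N, fun n hn => ?_⟩
    rw [dist_zero_right, norm_norm]
    by_contra hcon
    have := hN n hn.le (w n) ⟨hwδ n, by rwa [mem_ball_zero_iff]⟩
    rw [hw0 n, norm_zero] at this
    linarith
  have hwp : ∀ n, 0 < ‖w n‖ := fun n => norm_pos_iff.2 (hwne n)
  have hwR : ∀ R : ℝ, ∀ η > 0, ∀ᶠ n in atTop, ‖w n‖ * R < η := by
    intro R η hη
    have : Tendsto (fun n => ‖w n‖ * R) atTop (𝓝 (0 * R)) := hwlim.mul_const R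
    rw [zero_mul] at this
    exact this.eventually (gt_mem_nhds hη)
  set g : ℕ → ℂ → ℂ := fun n ζ => ((w n)⁻¹) ^ (m + 2) * F n (0 + w n * ζ) with hg
  set H : ℕ → ℂ → ℂ := fun n ζ => ζ ^ m * b (w n * ζ) with hH
  have hmap : ∀ R : ℝ, ∀ η > 0, ∀ᶠ n in atTop, ∀ ζ ∈ ball (0:ℂ) R, ‖w n * ζ‖ < η := by
    intro R η hη
    filter_upwards [hwR R η hη] with n hn ζ hζ
    rw [mem_ball_zero_iff] at hζ
    rw [norm_mul]
    exact lt_of_le_of_lt (mul_le_mul_of_nonneg_left hζ.le (norm_nonneg _)) hn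
  have hgG : ∀ R : ℝ, ∀ᶠ n in atTop, Good s (g n) (H n) (ball 0 R) := by
    intro R
    filter_upwards [hmap R r hr] with n hn
    have := ((hgood n).scale (c := ((w n)⁻¹) ^ (m + 2)) 0 (pow_ne_zero _ (inv_ne_zero (hwne n)))
      (hwne n)).mono (V := ball 0 R) (fun ζ hζ => by
        show 0 + w n * ζ ∈ ball (0:ℂ) r
        rw [zero_add, mem_ball_zero_iff]; exact hn ζ hζ)
    have e1 : (fun ζ : ℂ => (w n)⁻¹ ^ (m + 2) * w n ^ 2 * ((0 + w n * ζ) ^ m * b (0 + w n * ζ)))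
        = H n := by
      funext ζ
      have h1 := hwne n
      rw [zero_add, mul_pow, inv_pow, pow_add, hH]
      field_simp
    rw [e1] at this
    exact this
  have hHd : ∀ R : ℝ, ∀ᶠ n in atTop, DifferentiableOn ℂ (H n) (ball 0 R) := by
    intro R
    filter_upwards [hmap R r hr] with n hn
    refine DifferentiableOn.fun_mul (by fun_prop) ?_
    exact hbd.comp (f := fun ζ => w n * ζ) (by fun_prop) (fun ζ hζ => by
      rw [mem_ball_zero_iff]; exact hn ζ hζ)
  set b0 := b 0 with hb0def
  have hb0 : b0 ≠ 0 := hb 0 (mem_ball_self hr)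
  have hHlim : ∀ R : ℝ, TendstoUniformlyOn H (fun ζ => b0 * ζ ^ m) atTop (ball 0 R) := by
    intro R
    rw [Metric.tendstoUniformlyOn_iff]
    intro ε hε
    have hbc : ContinuousAt b 0 := hbd.continuousOn.continuousAt (ball_mem_nhds 0 hr)
    have hRp : 0 < |R| ^ m + 1 := by positivity
    obtain ⟨η, hη, hηb⟩ := Metric.continuousAt_iff.1 hbc (ε / (|R| ^ m + 1)) (by positivity)
    filter_upwards [hmap R η hη] with n hn ζ hζ
    have h1 := hηb (x := w n * ζ) (by rw [dist_zero_right]; exact hn ζ hζ)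
    rw [dist_eq_norm] at h1 ⊢
    rw [mem_ball_zero_iff] at hζ
    have e : H n ζ - b0 * ζ ^ m = -(ζ ^ m * (b 0 - b (w n * ζ))) := by rw [hH, hb0def]; ring
    rw [norm_sub_rev, e, norm_neg, norm_mul, norm_pow, norm_sub_rev]
    have h2 : ‖ζ‖ ^ m ≤ |R| ^ m := by gcongr; exact hζ.le.trans (le_abs_self R)
    calc ‖ζ‖ ^ m * ‖b (w n * ζ) - b 0‖ ≤ |R| ^ m * (ε / (|R| ^ m + 1)) := by
          refine mul_le_mul h2 ?_ (norm_nonneg _) (by positivity)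
          first | exact h1.le | (rw [norm_sub_rev]; exact h1.le)
      _ < (|R| ^ m + 1) * (ε / (|R| ^ m + 1)) := by
          apply mul_lt_mul_of_pos_right (by linarith) (by positivity)
      _ = ε := by field_simp
  have hg1 : ∀ n, g n 1 = 0 := by
    intro n
    simp only [hg, zero_add, mul_one, hw0, mul_zero]
  -- zeros of g n
  have hgz : ∀ n ζ, ‖w n * ζ‖ ≤ δ → g n ζ = 0 → ‖ζ‖ ≤ 1 ∧ F n (w n * ζ) = 0 := by
    intro n ζ h1 h2
    simp only [hg, zero_add] at h2
    have h3 := (mul_eq_zero.1 h2).resolve_left (pow_ne_zero _ (inv_ne_zero (hwne n)))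
    refine ⟨?_, h3⟩
    have h4 := hwmax n (w n * ζ) (by rwa [mem_closedBall_zero_iff]) h3
    rw [norm_mul] at h4
    exact le_of_mul_le_mul_left (by linarith) (hwp n)
  -- normality
  have hN : ∀ z ∈ ({0}ᶜ : Set ℂ), NormAt g z := by
    intro z hz
    have hz : z ≠ 0 := hz
    have hzp : 0 < ‖z‖ := norm_pos_iff.2 hz
    have hbz : ∀ v ∈ ball z (‖z‖), v ≠ 0 := by
      rintro v hv rfl
      rw [mem_ball, dist_zero_left] at hv
      exact lt_irrefl _ hv
    have hsub : ball z ‖z‖ ⊆ ball 0 (2 * ‖z‖) := by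
      intro v hv
      rw [mem_ball, dist_eq_norm] at hv
      rw [mem_ball_zero_iff]
      have := norm_le_norm_add_norm_sub' v z
      linarith
    refine local_normal (hn := H) (h := fun ζ => b0 * ζ ^ m)
      (A := ‖b0‖ * (2 * ‖z‖) ^ m) hs hse hzp ?_ ?_ ?_ ?_ ?_ ?_
    · exact (hgG (2 * ‖z‖)).mono fun n hn => hn.mono hsub
    · exact (hHd (2 * ‖z‖)).mono fun n hn => hn.mono hsub
    · filter_upwards [hmap (2 * ‖z‖) r hr] with n hn v hv
      refine mul_ne_zero (pow_ne_zero _ (hbz v hv)) (hb _ ?_)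
      rw [mem_ball_zero_iff]; exact hn v (hsub hv)
    · exact (hHlim (2 * ‖z‖)).mono hsub
    · exact fun w hw => mul_ne_zero hb0 (pow_ne_zero _ (hbz w hw))
    · intro v hv
      have := hsub hv
      rw [mem_ball_zero_iff] at this
      rw [norm_mul, norm_pow]
      gcongr
  obtain ⟨φ, hφ, hcase⟩ := glue isOpen_compl_singleton compl_conn hN
  have hle : map φ atTop ≤ atTop := hφ.tendsto_atTop
  rcases hcase with ⟨G0, hG0⟩ | hinf'
  swap
  · obtain ⟨n, hn⟩ := (hinf' {1} (by simp) isCompact_singleton 1).exists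
    have := hn 1 rfl
    rw [hg1, norm_zero] at this
    linarith
  set l := map φ atTop with hl
  have : l.NeBot := by rw [hl]; infer_instance
  set G : ℂ → ℂ := fun z => limUnder l (fun n => g n z) with hGdef
  have hGu : ∀ R > 0, TendstoUniformlyOn g G l (closedBall 0 R) := by
    intro R hR
    refine fill (G := G0) hR ?_ ?_
    · filter_upwards [Eventually.filter_mono hle (hgG (R + 1))] with n hn
      exact ⟨hn.1.mono (ball_subset_ball (by linarith)),
        hn.1.continuousOn.mono (closedBall_subset_ball (by linarith))⟩
    · refine (tendstoLocallyUniformlyOn_iff_forall_isCompact isOpen_compl_singleton).1 hG0 _ ?_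
        (isCompact_sphere 0 R)
      intro z hz
      rw [mem_sphere_zero_iff_norm] at hz
      have : z ≠ 0 := by rw [← norm_pos_iff]; linarith
      exact this
  have hGl : ∀ R : ℝ, 0 < R → TendstoLocallyUniformlyOn g G l (ball 0 R) := fun R hR =>
    ((hGu R hR).mono ball_subset_closedBall).tendstoLocallyUniformlyOn
  have hGd : Differentiable ℂ G := by
    intro z
    have h1 := (hGl (‖z‖ + 1) (by positivity)).differentiableOn
      ((Eventually.filter_mono hle (hgG (‖z‖ + 1))).mono fun n hn => hn.1) isOpen_ball
    exact h1.differentiableAt (isOpen_ball.mem_nhds (by rw [mem_ball_zero_iff]; linarith))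
  have hG1 : G 1 = 0 := by
    have h1 := (hGu 1 one_pos).tendsto_at (x := 1) (by simp)
    simp only [hg1] at h1
    exact tendsto_nhds_unique h1 tendsto_const_nhds
  have hH1 : Tendsto (fun n => H n 1) l (𝓝 b0) := by
    have := ((hHlim 2).tendsto_at (x := 1) (by simp)).mono_left hle
    simpa using this
  have hG2 : iteratedDeriv 2 G 1 = b0 := by
    have h1 := (iterDeriv_lim isOpen_ball ((Eventually.filter_mono hle (hgG 2)).mono fun n hn => hn.1) (hGl 2 two_pos) 2)
    have h2 := h1.tendsto_at (a := 1) (by simp)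
    refine tendsto_nhds_unique (h2.congr' ?_) hH1
    filter_upwards [Eventually.filter_mono hle (hgG 2)] with n hn
    exact (hn.2.1 1 (by simp) (hg1 n)).2.1
  have hGne : ∀ a, ¬ ∀ᶠ z in 𝓝 a, G z = 0 := by
    intro a h
    have : G = fun _ => 0 := funext fun z =>
      ident isOpen_univ isPreconnected_univ hGd.differentiableOn (mem_univ a) h z (mem_univ z)
    rw [this] at hG2
    simp at hG2
    exact hb0 hG2.symm
  have hGz : ∀ z, 1 < ‖z‖ → G z ≠ 0 := by
    intro a ha hGa
    have hur := hurwitz (F := g) (G := G) (l := l) (U := ball 0 (‖a‖ + 1)) (a := a) isOpen_ball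
      (by rw [mem_ball_zero_iff]; linarith) ((Eventually.filter_mono hle (hgG (‖a‖ + 1))).mono fun n hn => hn.1)
      (hGl (‖a‖ + 1) (by positivity)) hGa (hGne a) (‖a‖ - 1) (by linarith)
    obtain ⟨n, ⟨z, hz, hz0⟩, h2⟩ := (hur.and (Eventually.filter_mono hle (hmap (2 * ‖a‖) δ hδ))).exists
    rw [mem_ball, dist_eq_norm] at hz
    have h3 := norm_le_norm_add_norm_sub' z a
    have h4 := norm_le_norm_add_norm_sub' a z
    rw [norm_sub_rev] at h4
    have := (hgz n z (h2 z (by rw [mem_ball_zero_iff]; linarith)).le hz0).1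
    linarith
  -- limit conditions
  have hlimR : ∀ R : ℝ, 2 ≤ R → Good s G (fun z => b0 * z ^ m) (ball 0 R \ {0}) := by
    intro R hR
    have hsub : ball (0:ℂ) R \ {0} ⊆ ball 0 R := sdiff_subset
    have hopen : IsOpen (ball (0:ℂ) R \ {0}) := isOpen_ball.sdiff isClosed_singleton
    have h1mem : (1:ℂ) ∈ ball (0:ℂ) R \ {0} := by
      refine ⟨?_, one_ne_zero⟩
      rw [mem_ball_zero_iff, norm_one]; linarith
    obtain ⟨a1, a2, a3⟩ := good_limit (s := s) (F := g) (H := H) (G := G) (B := fun z => b0 * z ^ m) (l := l)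
      hopen (punct_conn (by linarith)).isPreconnected
      ((Eventually.filter_mono hle (hgG R)).mono fun n hn => hn.mono hsub)
      ((Eventually.filter_mono hle (hHd R)).mono fun n hn => hn.mono hsub)
      ((hGl R (by linarith)).mono hsub)
      (TendstoUniformlyOn.tendstoLocallyUniformlyOn fun u hu => hle (((hHlim R).mono hsub) u hu))
      (fun h => hGne 1 (by
        filter_upwards [hopen.mem_nhds h1mem] with z hz using h z hz))
    refine ⟨a1, a2, ?_⟩
    rcases a3 with a3 | a3
    · exfalso
      have h3 := (a2 1 h1mem hG1).2.2
      have h4 : iteratedDeriv 2 G =ᶠ[𝓝 1] fun z => b0 * z ^ m := by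
        filter_upwards [hopen.mem_nhds h1mem] with z hz using a3 z hz
      rw [iteratedDeriv_succ, h4.deriv_eq] at h3
      have h5 := ((hasDerivAt_pow m (1:ℂ)).const_mul b0).deriv
      rw [h5] at h3
      simp at h3
      rcases h3 with h3 | h3
      · exact hb0 h3
      · omega
    · exact a3
  have hGood : Good s G (fun z => b0 * z ^ m) {0}ᶜ := by
    have hmem : ∀ z ∈ ({0}ᶜ : Set ℂ), z ∈ ball (0:ℂ) (‖z‖ + 2) \ {0} := by
      intro z hz
      exact ⟨by rw [mem_ball_zero_iff]; linarith, hz⟩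
    refine ⟨hGd.differentiableOn, fun z hz => ?_, fun z hz => ?_⟩
    · exact (hlimR (‖z‖ + 2) (by linarith [norm_nonneg z])).2.1 z (hmem z hz)
    · exact (hlimR (‖z‖ + 2) (by linarith [norm_nonneg z])).2.2 z (hmem z hz)
  have hGform := entire_class hs hse hb0 hGd hGood hG1 hGz
  -- final contradiction
  have hb0p : 0 < ‖b0‖ := norm_pos_iff.2 hb0
  have hev1 := Metric.tendstoUniformlyOn_iff.1 (hGu 2 two_pos) (‖b0‖ / 4) (by positivity)
  have hbig : ∀ᶠ n in l, ∀ z ∈ sphere (0:ℂ) δ, 1 ≤ ‖F n z‖ := by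
    refine Eventually.filter_mono hle (hinf _ ?_ (isCompact_sphere 0 δ) 1)
    intro z hz
    refine ⟨hcb (sphere_subset_closedBall hz), ?_⟩
    rintro rfl
    simp at hz; linarith
  have hws : ∀ᶠ n in l, ‖w n‖ * (4 * δ ^ 2 * ‖b0‖) < 1 ∧ ‖w n‖ * 1 < 1 ∧ ‖w n‖ * 2 < δ :=
    Eventually.filter_mono hle ((hwR _ 1 one_pos).and ((hwR _ 1 one_pos).and (hwR _ δ hδ)))
  obtain ⟨n, hn1, hn2, ⟨hn3, hn4, hn4'⟩, hn5⟩ := (hev1.and (hbig.and (hws.and (Eventually.filter_mono hle (hgG 3))))).exists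
  -- p_n
  have h1mem : (1:ℂ) ∈ ball (0:ℂ) 3 := by simp
  obtain ⟨p, hp, hpf, -, -, hp2, -⟩ := dbl isOpen_ball h1mem hn5.1 (hg1 n)
    (hn5.2.1 1 h1mem (hg1 n)).1
  have hpb : ∀ z ∈ closedBall (0:ℂ) 2, ‖p z - b0 / 2‖ ≤ ‖b0‖ / 4 := by
    refine max_principle two_pos ?_ ?_ ?_
    · exact (hp.mono (ball_subset_ball (by norm_num))).sub_const _
    · exact (hp.continuousOn.mono (closedBall_subset_ball (by norm_num))).sub continuousOn_const
    · intro z hz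
      have h1 := hn1 z (sphere_subset_closedBall hz)
      rw [dist_comm, dist_eq_norm, hGform, hpf] at h1
      have e : (z - 1) ^ 2 * p z - b0 / 2 * (z - 1) ^ 2 = (z - 1) ^ 2 * (p z - b0 / 2) := by ring
      rw [e, norm_mul, norm_pow] at h1
      rw [mem_sphere_zero_iff_norm] at hz
      have h2 : 1 ≤ ‖z - 1‖ := by
        have := norm_sub_norm_le z 1
        rw [hz, norm_one] at this; linarith
      have h3 : 1 ≤ ‖z - 1‖ ^ 2 := one_le_pow₀ h2
      nlinarith [norm_nonneg (p z - b0 / 2)]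
  have hb2 : ‖b0 / 2‖ = ‖b0‖ / 2 := by simp
  have hpne : ∀ z ∈ closedBall (0:ℂ) 2, p z ≠ 0 := by
    intro z hz h0
    have := hpb z hz
    rw [h0, zero_sub, norm_neg, hb2] at this
    linarith
  have hg0 : ‖g n 0‖ ≤ ‖b0‖ := by
    have h1 := hpb 0 (by simp)
    have h2 := hpf 0
    have h3 := norm_le_norm_add_norm_sub' (p 0) (b0 / 2)
    rw [hb2] at h3
    have e : g n 0 = p 0 := by rw [h2]; ring
    rw [e]; linarith
  -- u_n
  have hwr : w n ∈ ball (0:ℂ) r := hcb (hwδ n)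
  obtain ⟨a1, a2, a3⟩ := (hgood n).2.1 (w n) hwr (hw0 n)
  obtain ⟨u, hu, huf, -, -, hu2, -⟩ := dbl isOpen_ball hwr (hgood n).1 (hw0 n) a1
  have hune : ∀ z ∈ closedBall (0:ℂ) δ, u z ≠ 0 := by
    intro z hz h0
    by_cases hzw : z = w n
    · rw [hzw] at h0
      rw [h0, mul_zero] at hu2
      rw [hu2] at a2
      exact (mul_ne_zero (pow_ne_zero m (hwne n)) (hb _ hwr)) a2.symm
    · have hFz : F n z = 0 := by rw [huf, h0, mul_zero]
      have h1 := hwmax n z hz hFz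
      set ζ := (w n)⁻¹ * z with hζ
      have hζz : w n * ζ = z := by rw [hζ, mul_inv_cancel_left₀ (hwne n)]
      have h2 : g n ζ = 0 := by
        simp only [hg, zero_add]; rw [hζz, hFz, mul_zero]
      have h3 : ‖ζ‖ ≤ 1 := (hgz n ζ (by rw [hζz]; rwa [mem_closedBall_zero_iff] at hz) h2).1
      rw [hpf] at h2
      rcases mul_eq_zero.1 h2 with h4 | h4
      · have h5 : ζ = 1 := sub_eq_zero.1 (pow_eq_zero_iff (two_ne_zero) |>.1 h4)
        rw [h5, mul_one] at hζz
        exact hzw hζz.symm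
      · exact hpne ζ (by rw [mem_closedBall_zero_iff]; linarith) h4
  have hub := min_principle (f := u) (m := 1 / (4 * δ ^ 2)) hδ
    (hu.mono (ball_subset_ball hδr.le)) (hu.continuousOn.mono hcb) hune (by
      intro z hz
      have h1 := hn2 z hz
      rw [huf, norm_mul, norm_pow] at h1
      rw [mem_sphere_zero_iff_norm] at hz
      have h2 : ‖z - w n‖ ≤ 2 * δ := by
        have := norm_sub_le z (w n)
        have h5 := hwδ n
        rw [mem_closedBall_zero_iff] at h5
        linarith
      have h3 : ‖z - w n‖ ^ 2 ≤ (2 * δ) ^ 2 := by gcongr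
      rw [div_le_iff₀ (by positivity)]
      nlinarith [norm_nonneg (u z)]) 0 (by simp [hδ.le])
  have hF0 : ‖F n 0‖ = ‖w n‖ ^ 2 * ‖u 0‖ := by
    rw [huf, zero_sub, norm_mul, norm_pow, norm_neg]
  have hgn0 : ‖w n‖ ^ (m + 2) * ‖g n 0‖ = ‖F n 0‖ := by
    simp only [hg, mul_zero, add_zero]
    rw [norm_mul, norm_pow, norm_inv, ← mul_assoc, ← mul_pow, mul_inv_cancel₀ (hwp n).ne', one_pow,
      one_mul]
  rw [hF0, pow_add, mul_comm (‖w n‖ ^ m), mul_assoc] at hgn0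
  have h7 : ‖w n‖ ^ m * ‖g n 0‖ = ‖u 0‖ := mul_left_cancel₀ (pow_pos (hwp n) 2).ne' hgn0
  have h8 : ‖w n‖ ^ m ≤ ‖w n‖ := pow_le_of_le_one (norm_nonneg _) (by linarith) (by omega)
  have h9 : 1 / (4 * δ ^ 2) ≤ ‖w n‖ * ‖b0‖ := by
    rw [← h7] at hub
    exact hub.trans (mul_le_mul h8 hg0 (norm_nonneg _) (norm_nonneg _))
  rw [div_le_iff₀ (by positivity)] at h9
  nlinarith

end NF

namespace NF

lemma normAt_ne {s : ℕ} (hs : 2 ≤ s) (hse : Even s) {f : ℕ → ℂ → ℂ} {h : ℂ → ℂ} {U : Set ℂ} {z0 : ℂ}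
    (hU : IsOpen U) (hz0 : z0 ∈ U) (hgood : ∀ n, Good s (f n) h U) (hd : DifferentiableOn ℂ h U)
    (hne : h z0 ≠ 0) : NormAt f z0 := by
  have hc : ContinuousAt h z0 := hd.continuousOn.continuousAt (hU.mem_nhds hz0)
  have h1 : ∀ᶠ z in 𝓝 z0, h z ≠ 0 := hc.eventually_ne hne
  have h2 : ∀ᶠ z in 𝓝 z0, ‖h z‖ < ‖h z0‖ + 1 :=
    hc.norm.eventually_lt continuousAt_const (by simp)
  obtain ⟨r, hr, hrb⟩ := Metric.eventually_nhds_iff_ball.1 ((h1.and h2).and (hU.mem_nhds hz0))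
  have hsub : ball z0 r ⊆ U := fun z hz => (hrb z hz).2
  refine local_normal (hn := fun _ => h) (h := h) (A := ‖h z0‖ + 1) hs hse hr ?_ ?_ ?_ ?_ ?_ ?_
  · exact Eventually.of_forall fun n => (hgood n).mono hsub
  · exact Eventually.of_forall fun n => hd.mono hsub
  · exact Eventually.of_forall fun n z hz => (hrb z hz).1.1
  · intro u hu
    exact Eventually.of_forall fun n w hw => refl_mem_uniformity hu
  · exact fun z hz => (hrb z hz).1.1
  · exact fun z hz => (hrb z hz).1.2.le

lemma zero_case {s : ℕ} (hs : 2 ≤ s) (hse : Even s) {f : ℕ → ℂ → ℂ} {b : ℂ → ℂ} {m : ℕ}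
    (hm : 1 ≤ m) {r : ℝ} (hr : 0 < r)
    (hgood : ∀ n, Good s (f n) (fun z => z ^ m * b z) (ball 0 r))
    (hbd : DifferentiableOn ℂ b (ball 0 r)) (hb : ∀ z ∈ ball (0:ℂ) r, b z ≠ 0)
    (hf0 : ∀ n, f n 0 ≠ 0) : NormAt f 0 := by
  set δ := r / 2 with hδdef
  have hδ : 0 < δ := by rw [hδdef]; linarith
  have hδr : δ < r := by rw [hδdef]; linarith
  have hcb : closedBall (0:ℂ) δ ⊆ ball 0 r := closedBall_subset_ball hδr
  have hopen : IsOpen (ball (0:ℂ) r \ {0}) := isOpen_ball.sdiff isClosed_singleton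
  have hsph : sphere (0:ℂ) δ ⊆ ball 0 r \ {0} := by
    intro z hz
    refine ⟨hcb (sphere_subset_closedBall hz), ?_⟩
    rintro rfl
    simp at hz; linarith
  refine ⟨δ, hδ, fun φ hφ => ?_⟩
  have hN : ∀ z ∈ ball (0:ℂ) r \ {0}, NormAt (fun n => f (φ n)) z := by
    intro z hz
    refine normAt_ne hs hse (h := fun z => z ^ m * b z) isOpen_ball hz.1 (fun n => hgood _) ?_ ?_
    · exact DifferentiableOn.fun_mul (by fun_prop) hbd
    · exact mul_ne_zero (pow_ne_zero _ hz.2) (hb z hz.1)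
  obtain ⟨ψ, hψ, hcase⟩ := glue hopen (punct_conn hr) hN
  have hdc : ∀ n, DifferentiableOn ℂ (f n) (ball 0 δ) ∧ ContinuousOn (f n) (closedBall 0 δ) :=
    fun n => ⟨(hgood n).1.mono (ball_subset_ball hδr.le), (hgood n).1.continuousOn.mono hcb⟩
  rcases hcase with ⟨G, hG⟩ | hinf
  · have h1 := (tendstoLocallyUniformlyOn_iff_forall_isCompact hopen).1 hG _ hsph (isCompact_sphere 0 δ)
    have h2 := fill (F := fun n => f (φ n)) hδ (Eventually.of_forall fun n => hdc (φ n)) h1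
    exact ⟨ψ, hψ, Or.inl ⟨_, h2.mono ball_subset_closedBall⟩⟩
  · by_cases hfr : ∃ᶠ n in atTop, ∀ z ∈ closedBall (0:ℂ) δ, f (φ (ψ n)) z ≠ 0
    · obtain ⟨χ, hχ, hχz⟩ := extraction_of_frequently_atTop hfr
      refine ⟨ψ ∘ χ, hψ.comp hχ, Or.inr fun M => ?_⟩
      have h1 : ∀ᶠ n in atTop, ∀ z ∈ sphere (0:ℂ) δ, M ≤ ‖f (φ (ψ n)) z‖ :=
        hinf _ hsph (isCompact_sphere 0 δ) M
      have h2 := hχ.tendsto_atTop.eventually h1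
      show ∀ᶠ n in atTop, ∀ z ∈ ball (0:ℂ) δ, M ≤ ‖f (φ (ψ (χ n))) z‖
      filter_upwards [h2] with n hn z hz
      exact min_principle hδ (hdc _).1 (hdc _).2 (hχz n) hn z (ball_subset_closedBall hz)
    · exfalso
      rw [not_frequently] at hfr
      obtain ⟨N, hNz⟩ := eventually_atTop.1 hfr
      refine no_small_zeros hs hse hm hδ hδr (F := fun n => f (φ (ψ (n + N)))) (fun n => hgood _) hbd hb
        (fun n => hf0 _) ?_ ?_
      · intro K hK hKc M
        have h1 : ∀ᶠ n in atTop, ∀ z ∈ K, M ≤ ‖f (φ (ψ n)) z‖ := hinf K hK hKc M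
        exact (tendsto_add_atTop_nat N).eventually h1
      · intro n
        have := hNz (n + N) (by omega)
        push Not at this
        exact this

lemma main_aux {D : Set ℂ} (hD : IsOpen D) (hDconn : IsConnected D) {s : ℕ} (hs : 2 ≤ s) (hse : Even s)
    {h : ℂ → ℂ} (hh : DifferentiableOn ℂ h D) (hh0 : ¬ ∀ z ∈ D, h z = 0) {f : ℕ → ℂ → ℂ}
    (hgood : ∀ n, Good s (f n) h D) (hnc : ∀ n, ∀ z ∈ D, ¬ (h z = 0 ∧ f n z = 0)) :
    ∀ z ∈ D, NormAt f z := by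
  intro z0 hz0
  by_cases hz : h z0 = 0
  swap
  · exact normAt_ne hs hse hD hz0 hgood hh hz
  have hne : ¬ ∀ᶠ z in 𝓝 z0, h z = 0 := fun he => hh0 (ident hD hDconn.isPreconnected hh hz0 he)
  obtain ⟨m, u, hu, hu0, huh⟩ :=
    ((hh.analyticAt (hD.mem_nhds hz0)).exists_eventuallyEq_pow_smul_nonzero_iff).2 hne
  have hm : 1 ≤ m := by
    by_contra hm
    have hm0 : m = 0 := by omega
    have := huh.self_of_nhds
    rw [hm0, hz] at this
    simp at this
    exact hu0 this.symm
  obtain ⟨r, hr, hrb⟩ := Metric.eventually_nhds_iff_ball.1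
    (((hu.continuousAt.eventually_ne hu0).and hu.eventually_analyticAt).and (huh.and (hD.mem_nhds hz0)))
  have hmem : ∀ ζ ∈ ball (0:ℂ) r, z0 + ζ ∈ ball z0 r := by
    intro ζ hζ
    rw [mem_ball_zero_iff] at hζ
    rw [mem_ball, dist_eq_norm, add_sub_cancel_left]; exact hζ
  have key : NormAt (fun n ζ => 1 * f n (z0 + 1 * ζ)) 0 := by
    refine zero_case hs hse hm hr (b := fun ζ => u (z0 + ζ)) ?_ ?_ ?_ ?_
    · intro n
      have h1 := ((hgood n).scale (c := 1) (ρ := 1) z0 one_ne_zero one_ne_zero).mono (V := ball 0 r)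
        (fun ζ hζ => by
          show z0 + 1 * ζ ∈ D
          rw [one_mul]; exact (hrb _ (hmem ζ hζ)).2.2)
      have e : ∀ ζ ∈ ball (0:ℂ) r, (1:ℂ) * 1 ^ 2 * h (z0 + 1 * ζ) = ζ ^ m * u (z0 + ζ) := by
        intro ζ hζ
        have h3 := (hrb _ (hmem ζ hζ)).2.1
        rw [one_pow, one_mul, one_mul, one_mul, h3, add_sub_cancel_left, smul_eq_mul]
      refine ⟨h1.1, fun ζ hζ h0 => ?_, fun ζ hζ h2 => ?_⟩
      · obtain ⟨a1, a2, a3⟩ := h1.2.1 ζ hζ h0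
        exact ⟨a1, a2.trans (e ζ hζ), a3⟩
      · exact h1.2.2 ζ hζ (h2.trans (e ζ hζ).symm)
    · intro ζ hζ
      have h2 : DifferentiableAt ℂ u (z0 + ζ) := (hrb _ (hmem ζ hζ)).1.2.differentiableAt
      exact (h2.comp ζ (f := fun ζ => z0 + ζ) (by fun_prop)).differentiableWithinAt
    · exact fun ζ hζ => (hrb _ (hmem ζ hζ)).1.1
    · intro n h0
      simp only [one_mul, add_zero] at h0
      exact hnc n z0 hz0 ⟨hz, h0⟩
  obtain ⟨ε, hε, hkey⟩ := key
  refine ⟨ε, hε, fun φ hφ => ?_⟩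
  obtain ⟨ψ, hψ, hc⟩ := hkey φ hφ
  have hmem' : ∀ z ∈ ball z0 ε, z - z0 ∈ ball (0:ℂ) ε := by
    intro z hz
    rw [mem_ball, dist_eq_norm] at hz
    rwa [mem_ball_zero_iff]
  refine ⟨ψ, hψ, ?_⟩
  rcases hc with ⟨G, hG⟩ | hinf
  · refine Or.inl ⟨fun z => G (z - z0), fun v hv => ?_⟩
    filter_upwards [hG v hv] with n hn z hz
    have := hn (z - z0) (hmem' z hz)
    simpa using this
  · refine Or.inr fun M => ?_
    filter_upwards [hinf M] with n hn z hz
    have := hn (z - z0) (hmem' z hz)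
    simpa using this

end NF

end

/-- Theorem 3: if all zeros of members of `F` are multiple, `s ≥ 2` is even, `h ≢ 0` is
holomorphic on `D` with no common zeros with any `f ∈ F`, and every `f ∈ F` satisfies
(a) `f(z)=0 ⟹ f''(z)=h(z)` and (b) `f''(z)=h(z) ⟹ f'''(z)=f^{(s)}(z)=0`, then `F` is
normal on `D`. -/
theorem stmt_16 (D : Set ℂ) (hD : IsOpen D) (hDconn : IsConnected D)
    (F : Set (ℂ → ℂ)) (hol : ∀ f ∈ F, DifferentiableOn ℂ f D)
    (s : ℕ) (hs : 2 ≤ s) (hse : Even s)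
    (hmult : ∀ f ∈ F, ∀ z ∈ D, f z = 0 → deriv f z = 0)
    (h : ℂ → ℂ) (hh : DifferentiableOn ℂ h D) (hh0 : ¬ ∀ z ∈ D, h z = 0)
    (hnc : ∀ f ∈ F, ∀ z ∈ D, ¬ (h z = 0 ∧ f z = 0))
    (ha : ∀ f ∈ F, ∀ z ∈ D, f z = 0 → iteratedDeriv 2 f z = h z)
    (hb : ∀ f ∈ F, ∀ z ∈ D, iteratedDeriv 2 f z = h z →
      iteratedDeriv 3 f z = 0 ∧ iteratedDeriv s f z = 0) :
    SphericallyNormalOn F D := by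
  intro f hf
  have hgood : ∀ n, NF.Good s (f n) h D := by
    intro n
    refine ⟨hol _ (hf n), fun z hz h0 => ?_, fun z hz h2 => (hb _ (hf n) z hz h2).2⟩
    have h2 := ha _ (hf n) z hz h0
    exact ⟨hmult _ (hf n) z hz h0, h2, (hb _ (hf n) z hz h2).1⟩
  obtain ⟨φ, hφ, hc⟩ := NF.glue hD hDconn
    (NF.main_aux hD hDconn hs hse hh hh0 hgood (fun n => hnc _ (hf n)))
  refine ⟨φ, hφ, ?_⟩
  rcases hc with ⟨g, hg⟩ | hinf
  · refine Or.inl ⟨g, fun u hu x hx => ?_⟩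
    obtain ⟨t, ht, htu⟩ := hg u hu x hx
    exact ⟨t, ht, htu⟩
  · exact Or.inr fun K hK hKc M => hinf K hK hKc M
end

section
/- Let f be a meromorphic function on ℂ whose spherical derivative f^# is uniformly bounded on ℂ. Then f has order at most 2; moreover, if f is entire, then f has order at most 1. -/
/-- The spherical derivative of a meromorphic function (at poles the value is
immaterial for the integrals below). -/
noncomputable def sphericalDeriv (f : ℂ → ℂ) (z : ℂ) : ℝ :=
  ‖deriv f z‖ / (1 + ‖f z‖ ^ 2)

/-- The Ahlfors–Shimizu characteristic
`T(r) = ∫₀^r A(t)/t dt`, where `A(t) = (1/π) ∫_{|z| ≤ t} (f^#)² dm`.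
For meromorphic functions it differs from the Nevanlinna characteristic by a
bounded term, so it defines the same order. -/
noncomputable def ahlforsShimizuT (f : ℂ → ℂ) (r : ℝ) : ℝ :=
  ∫ t in Set.Ioc (0 : ℝ) r,
    (∫ z in Metric.closedBall (0 : ℂ) t, (sphericalDeriv f z) ^ 2) / (Real.pi * t)

open InnerProductSpace in
lemma harnack_lower {u : ℂ → ℝ} {c w : ℂ} {R : ℝ}
    (hu : HarmonicOnNhd u (Metric.closedBall c R)) (hpos : ∀ z ∈ Metric.sphere c R, 0 ≤ u z)
    (hw : w ∈ Metric.ball c R) :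
    (R - ‖w - c‖) / (R + ‖w - c‖) * u c ≤ u w := by
  have hR : 0 < R := Metric.pos_of_mem_ball hw
  have h1 := hu.circleAverage_re_herglotzRieszKernel_smul hw
  have hu' : HarmonicOnNhd u (Metric.closedBall c |R|) := by rwa [abs_of_pos hR]
  have h2 := hu'.circleAverage_eq
  have hc : ContinuousOn u (Metric.sphere c |R|) :=
    hu'.continuousOn.mono Metric.sphere_subset_closedBall
  rw [← h1, ← h2, ← smul_eq_mul, ← Real.circleAverage_fun_smul]
  apply Real.circleAverage_mono
  · exact ContinuousOn.circleIntegrable' (by fun_prop)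
  · apply ContinuousOn.circleIntegrable'
    exact (Complex.continuous_re.comp_continuousOn
      (continuousOn_herglotzRieszKernel_sphere hw)).smul hc
  · intro z hz
    rw [abs_of_pos hR] at hz
    have := le_re_herglotzRieszKernel hz hw
    simpa [herglotzRieszKernel_def] using mul_le_mul_of_nonneg_right this (hpos z hz)

lemma hopf_bound {f : ℂ → ℂ} (hf : Differentiable ℂ f) {c ζ : ℂ} {R : ℝ} (hR : 0 < R)
    (hge : ∀ z ∈ Metric.closedBall c R, 1 ≤ ‖f z‖) (hζ : ‖ζ - c‖ = R) (hfζ : ‖f ζ‖ = 1) :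
    Real.log ‖f c‖ ≤ 2 * (‖deriv f ζ‖ * R) := by
  have hharm : InnerProductSpace.HarmonicOnNhd (fun z => Real.log ‖f z‖)
      (Metric.closedBall c R) := fun z hz =>
    (hf.analyticAt z).harmonicAt_log_norm (by
      intro h; have := hge z hz; rw [h] at this; norm_num at this)
  have hu0 : 0 ≤ Real.log ‖f c‖ := Real.log_nonneg (hge c (by simp [hR.le]))
  have key : ∀ s : ℝ, s ∈ Set.Ioo (0:ℝ) 1 →
      Real.log ‖f c‖ / 2 ≤ ‖s⁻¹ • (f (ζ + (0 + s : ℝ) * (c - ζ)) - f (ζ + (0 : ℝ) * (c - ζ)))‖ := by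
    intro s hs
    obtain ⟨hs0, hs1⟩ := hs
    set w : ℂ := ζ + s * (c - ζ) with hw
    have hwc : ‖w - c‖ = (1 - s) * R := by
      have : w - c = ((1 - s : ℝ) : ℂ) * (ζ - c) := by rw [hw]; push_cast; ring
      rw [this, norm_mul, hζ, Complex.norm_real, Real.norm_of_nonneg (by linarith)]
    have hwb : w ∈ Metric.ball c R := by
      rw [mem_ball_iff_norm, hwc]; nlinarith
    have h1 := harnack_lower hharm
      (fun z hz => Real.log_nonneg (hge z (Metric.sphere_subset_closedBall hz))) hwb
    have hge1 := hge w (Metric.ball_subset_closedBall hwb)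
    have h2 : Real.log ‖f w‖ ≤ ‖f w‖ - 1 := Real.log_le_sub_one_of_pos (by linarith)
    have h3 : ‖f w‖ - 1 ≤ ‖f w - f ζ‖ := by rw [← hfζ]; exact norm_sub_norm_le _ _
    have h4 : s / 2 ≤ (R - ‖w - c‖) / (R + ‖w - c‖) := by
      rw [hwc, div_le_div_iff₀ (by norm_num) (by nlinarith)]; nlinarith [mul_pos hs0 hR, mul_pos hs0 (mul_pos hs0 hR)]
    have h5 := mul_le_mul_of_nonneg_right h4 hu0
    have h6 : s / 2 * Real.log ‖f c‖ ≤ ‖f w - f ζ‖ := by linarith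
    simp only [zero_add, Complex.ofReal_zero, zero_mul, add_zero]
    rw [norm_smul, norm_inv, Real.norm_of_nonneg hs0.le, ← div_eq_inv_mul, le_div_iff₀ hs0]
    linarith
  have hd : HasDerivAt (fun s : ℝ => f (ζ + s * (c - ζ))) (deriv f ζ * (c - ζ)) 0 := by
    have hin : HasDerivAt (fun s : ℂ => ζ + s * (c - ζ)) (c - ζ) ((0 : ℝ) : ℂ) := by
      simpa using ((hasDerivAt_id (((0 : ℝ) : ℂ))).mul_const (c - ζ)).const_add ζ
    have hf' : HasDerivAt f (deriv f ζ) (ζ + ((0:ℝ):ℂ) * (c - ζ)) := by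
      simpa using (hf ζ).hasDerivAt
    exact (HasDerivAt.comp (h := fun s : ℂ => ζ + s * (c - ζ)) ((0 : ℝ) : ℂ) hf' hin).comp_ofReal
  have ht := (hasDerivAt_iff_tendsto_slope_zero.1 hd).norm
  have ht' := ht.mono_left (nhdsWithin_mono (0:ℝ) (fun x (hx : x ∈ Set.Ioi (0:ℝ)) => ne_of_gt hx))
  have := ge_of_tendsto ht' (by
    filter_upwards [Ioo_mem_nhdsGT (show (0:ℝ) < 1 by norm_num)] with s hs using key s hs)
  rw [norm_mul, norm_sub_rev c ζ, hζ] at this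
  linarith

lemma exp_type {f : ℂ → ℂ} (hf : Differentiable ℂ f) {M : ℝ}
    (hbd : ∀ z : ℂ, sphericalDeriv f z ≤ M) :
    ∃ A : ℝ, 0 ≤ A ∧ ∀ z, ‖f z‖ ≤ Real.exp (A + 4 * M * ‖z‖) := by
  have hM : 0 ≤ M := le_trans (by unfold sphericalDeriv; positivity) (hbd 0)
  by_cases hne : ∃ a, ‖f a‖ ≤ 1
  · obtain ⟨a, ha⟩ := hne
    refine ⟨4 * M * ‖a‖, by positivity, fun c => ?_⟩
    by_cases hc : ‖f c‖ ≤ 1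
    · exact hc.trans (Real.one_le_exp (by positivity))
    have hK : IsClosed {z | ‖f z‖ ≤ 1} := isClosed_le hf.continuous.norm continuous_const
    obtain ⟨ζ, hζ, hd⟩ := hK.exists_infDist_eq_dist ⟨a, ha⟩ c
    have hR : 0 < dist c ζ := dist_pos.2 (by rintro rfl; exact hc hζ)
    have hball : ∀ z ∈ Metric.ball c (dist c ζ), 1 ≤ ‖f z‖ := by
      intro z hz
      by_contra h
      have := Metric.infDist_le_dist_of_mem (x := c) (s := {z | ‖f z‖ ≤ 1}) (y := z) (not_le.1 h).le
      rw [Metric.mem_ball'] at hz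
      linarith
    have hcb : ∀ z ∈ Metric.closedBall c (dist c ζ), 1 ≤ ‖f z‖ := by
      intro z hz
      rw [← closure_ball c hR.ne'] at hz
      exact closure_minimal hball (isClosed_le continuous_const hf.continuous.norm) hz
    have hfζ : ‖f ζ‖ = 1 := le_antisymm hζ (hcb ζ (by simp [dist_comm]))
    have h1 := hopf_bound hf hR hcb (by rw [dist_eq_norm, norm_sub_rev]) hfζ
    have h2 := hbd ζ
    unfold sphericalDeriv at h2
    rw [hfζ, div_le_iff₀ (by norm_num)] at h2
    have h3 : dist c ζ ≤ ‖c‖ + ‖a‖ := by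
      rw [← hd]
      refine (Metric.infDist_le_dist_of_mem (x := c) (s := {z | ‖f z‖ ≤ 1}) (y := a) ha).trans ?_
      rw [dist_eq_norm]; exact norm_sub_le _ _
    rw [← Real.log_le_iff_le_exp (by linarith)]
    calc _ ≤ _ := h1
      _ ≤ 2 * (M * (1 + 1 ^ 2) * (‖c‖ + ‖a‖)) := by gcongr
      _ = _ := by ring
  · push Not at hne
    have h0 : ∀ z, f z ≠ 0 := fun z h => by have := hne z; rw [h] at this; norm_num at this
    have hdi : Differentiable ℂ (fun z => (f z)⁻¹) := fun z => (hf z).inv (h0 z)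
    have hb : Bornology.IsBounded (Set.range (fun z => (f z)⁻¹)) := by
      rw [isBounded_iff_forall_norm_le]
      refine ⟨1, ?_⟩
      rintro _ ⟨z, rfl⟩
      simp only [norm_inv]
      exact inv_le_one_of_one_le₀ (hne z).le
    refine ⟨Real.log ‖f 0‖, Real.log_nonneg (hne 0).le, fun z => ?_⟩
    have := hdi.apply_eq_apply_of_bounded hb z 0
    rw [inv_inj.1 this, Real.exp_add, Real.exp_log (by linarith [hne 0])]
    exact le_mul_of_one_le_right (norm_nonneg _) (Real.one_le_exp (by positivity))

lemma T_bound {f : ℂ → ℂ} {M : ℝ} (hbd : ∀ z : ℂ, sphericalDeriv f z ≤ M) {r : ℝ} (hr : 0 < r) :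
    |ahlforsShimizuT f r| ≤ M ^ 2 * r ^ 2 := by
  have h0 : ∀ z, 0 ≤ sphericalDeriv f z := fun z => by unfold sphericalDeriv; positivity
  unfold ahlforsShimizuT
  rw [← Real.norm_eq_abs]
  have hin : ∀ t ∈ Set.Ioc (0:ℝ) r,
      ‖(∫ z in Metric.closedBall (0 : ℂ) t, (sphericalDeriv f z) ^ 2) / (Real.pi * t)‖
        ≤ M ^ 2 * r := by
    intro t ht
    have hv : MeasureTheory.volume.real (Metric.closedBall (0:ℂ) t) = Real.pi * t ^ 2 := by
      rw [MeasureTheory.measureReal_def, Complex.volume_closedBall]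
      simp [ht.1.le, mul_comm]
    have := MeasureTheory.norm_setIntegral_le_of_norm_le_const (μ := MeasureTheory.volume)
      (s := Metric.closedBall (0:ℂ) t) (f := fun z => (sphericalDeriv f z) ^ 2) (C := M ^ 2)
      MeasureTheory.measure_closedBall_lt_top
      (fun z _ => by
        rw [Real.norm_of_nonneg (by positivity)]
        exact pow_le_pow_left₀ (h0 z) (hbd z) 2)
    rw [hv] at this
    have hpt : 0 < Real.pi * t := mul_pos Real.pi_pos ht.1
    rw [norm_div, Real.norm_of_nonneg hpt.le, div_le_iff₀ hpt]
    refine this.trans ?_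
    have : Real.pi * t ^ 2 ≤ r * (Real.pi * t) := by nlinarith [ht.2]
    nlinarith [sq_nonneg M]
  have := MeasureTheory.norm_setIntegral_le_of_norm_le_const (μ := MeasureTheory.volume)
    (s := Set.Ioc (0:ℝ) r) measure_Ioc_lt_top hin
  refine this.trans ?_
  rw [Real.volume_real_Ioc_of_le hr.le]
  apply le_of_eq; ring

/-- A meromorphic function on `ℂ` with uniformly bounded spherical derivative has
order at most `2`; if moreover it is entire, it has order at most `1`. -/
theorem stmt_17 (f : ℂ → ℂ) (hf : MeromorphicOn f Set.univ)
    (M : ℝ) (hbd : ∀ z : ℂ, sphericalDeriv f z ≤ M) :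
    Filter.limsup (fun r : ℝ => Real.log (ahlforsShimizuT f r) / Real.log r)
        Filter.atTop ≤ 2 ∧
      (Differentiable ℂ f →
        ∀ ε : ℝ, 0 < ε → ∃ C : ℝ, ∀ z : ℂ, ‖f z‖ ≤ C * Real.exp (‖z‖ ^ (1 + ε))) := by
  have hM : 0 ≤ M := le_trans (by unfold sphericalDeriv; positivity) (hbd 0)
  constructor
  · rw [Filter.limsup_eq]
    by_cases hB : BddBelow {a : ℝ | ∀ᶠ r : ℝ in Filter.atTop,
        Real.log (ahlforsShimizuT f r) / Real.log r ≤ a}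
    · refine le_of_forall_pos_le_add fun ε hε => csInf_le hB ?_
      have ht : Filter.Tendsto (fun r : ℝ => ε * Real.log r) Filter.atTop Filter.atTop :=
        Real.tendsto_log_atTop.const_mul_atTop hε
      filter_upwards [Filter.eventually_gt_atTop 1,
        ht.eventually_ge_atTop (Real.log (M ^ 2))] with r hr1 hr2
      have hl : 0 < Real.log r := Real.log_pos hr1
      rw [div_le_iff₀ hl]
      have hT := T_bound hbd (show 0 < r by linarith)
      by_cases h0 : ahlforsShimizuT f r = 0
      · rw [h0, Real.log_zero]; positivity
      · have h1 := Real.log_le_log (abs_pos.2 h0) hT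
        have hM0 : M ^ 2 ≠ 0 := by
          intro h
          rw [h, zero_mul] at hT
          exact h0 (abs_nonpos_iff.1 hT)
        rw [Real.log_abs, Real.log_mul hM0 (by positivity), Real.log_pow r 2] at h1
        push_cast at h1
        linarith
    · rw [Real.sInf_of_not_bddBelow hB]; norm_num
  · intro hd ε hε
    obtain ⟨A, hA, h⟩ := exp_type hd hbd
    set K := 4 * M with hK
    have hK0 : 0 ≤ K := by positivity
    refine ⟨Real.exp (A + K * K ^ (1 / ε)), fun z => (h z).trans ?_⟩
    rw [← Real.exp_add]
    apply Real.exp_le_exp.2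
    have hz := norm_nonneg z
    have hp : 0 ≤ K ^ (1 / ε) := by positivity
    have hp2 : 0 ≤ ‖z‖ ^ (1 + ε) := by positivity
    rcases le_total ‖z‖ (K ^ (1 / ε)) with hle | hle
    · nlinarith
    · have h1 : K ≤ ‖z‖ ^ ε := by
        have := Real.rpow_le_rpow hp hle hε.le
        rwa [← Real.rpow_mul hK0, one_div, inv_mul_cancel₀ hε.ne', Real.rpow_one] at this
      have h2 : ‖z‖ ^ (1 + ε) = ‖z‖ * ‖z‖ ^ ε := by
        rw [Real.rpow_add_of_nonneg hz (by norm_num) hε.le, Real.rpow_one]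
      rw [h2]
      nlinarith [mul_nonneg hK0 hp]
end
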